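/- arXiv:2307.12669 — 2 statements merged into one kernel-verified Lean document; each statement's English description precedes it below -/
import Mathlib

section
/- Let n ≥ 2, let 1 ≤ a < n, set t = gcd(2n, a), let K be a field, and let S = K[V(C_{2n}(a,n))]. (a) If 2n/t is even, then sdepth(S/I(C_{2n}(a,n))) ≥ ⌈n/(2t)⌉ · t if n/t ≡ 1 (mod 4), and sdepth(S/I(C_{2n}(a,n))) ≥ ⌈(n−t)/(2t)⌉ · t otherwise. (b) If 2n/t is odd, then sdepth(S/I(C_{2n}(a,n))) ≥ ⌈(2n−t)/(2t)⌉ · (t/2) if 2n/t ≡ 1 (mod 4), and sdepth(S/I(C_{2n}(a,n))) ≥ ⌈n/t⌉ · (t/2) if 2n/t ≡ 3 (mod 4). -/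
open MvPolynomial

/-- The edge ideal of a simple graph `G`, inside `K[x_v : v ∈ V]`. -/
noncomputable def edgeIdeal (K : Type*) [Field K] {V : Type*} (G : SimpleGraph V) :
    Ideal (MvPolynomial V K) :=
  Ideal.span {m | ∃ i j : V, G.Adj i j ∧ m = X i * X j}

/-- The graded maximal ideal of `K[x_v : v ∈ V]`. -/
noncomputable def maxIdeal (K : Type*) [Field K] (V : Type*) : Ideal (MvPolynomial V K) :=
  Ideal.span (Set.range (X : V → MvPolynomial V K))

/-- depth of `S/I` over `S = K[x_v]`: the supremum of lengths of regular sequences on `S/I`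
consisting of elements of the graded maximal ideal. -/
noncomputable def depthQuot {K : Type*} [Field K] {V : Type*} (I : Ideal (MvPolynomial V K)) : ℕ :=
  sSup {n : ℕ | ∃ rs : List (MvPolynomial V K), rs.length = n ∧
    (∀ r ∈ rs, r ∈ maxIdeal K V) ∧
    RingTheory.Sequence.IsRegular (MvPolynomial V K ⧸ I) rs}

/-- The Stanley space `u·K[Z]` inside `S/I`, as a `K`-subspace. -/
noncomputable def stanleySpace {K : Type*} [Field K] {V : Type*}
    (I : Ideal (MvPolynomial V K)) (u : V →₀ ℕ) (Z : Finset V) :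
    Submodule K (MvPolynomial V K ⧸ I) :=
  Submodule.span K
    {x | ∃ a : V →₀ ℕ, a.support ⊆ Z ∧ x = Ideal.Quotient.mk I (monomial (u + a) (1 : K))}

/-- A Stanley decomposition of `S/I`: a finite family of Stanley spaces `u_j K[Z_j]`,
each of which is a free `K[Z_j]`-module (expressed by linear independence of the monomial
spanning set), whose internal direct sum is all of `S/I`. -/
structure StanleyDecomposition {K : Type*} [Field K] {V : Type*}
    (I : Ideal (MvPolynomial V K)) : Type _ where
  m : ℕ
  u : Fin m → (V →₀ ℕ)
  Z : Fin m → Finset V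
  free : ∀ j : Fin m, LinearIndependent K
    (fun a : {a : V →₀ ℕ // a.support ⊆ Z j} =>
      Ideal.Quotient.mk I (monomial (u j + (a : V →₀ ℕ)) (1 : K)))
  internal : DirectSum.IsInternal (fun j : Fin m => stanleySpace I (u j) (Z j))

/-- The Stanley depth of `S/I`. -/
noncomputable def sdepthQuot {K : Type*} [Field K] {V : Type*}
    (I : Ideal (MvPolynomial V K)) : ℕ :=
  sSup {n : ℕ | ∃ D : StanleyDecomposition I, ∀ j, n ≤ (D.Z j).card}

/-- `pdimLE R n M`: the `R`-module `M` has projective dimension at most `n`,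
i.e. it admits a projective resolution of length `n`. -/
def pdimLE (R : Type*) [CommRing R] :
    (n : ℕ) → (M : Type*) → [AddCommGroup M] → [Module R M] → Prop
  | 0, M, _, _ => Module.Projective R M
  | (n+1), M, _, _ => ∃ (P : Type _) (_ : AddCommGroup P) (_ : Module R P)
      (f : P →ₗ[R] M), Module.Projective R P ∧ Function.Surjective f ∧
        pdimLE R n (LinearMap.ker f)

/-- The projective dimension of `S/I` over `S`: the length of a minimal (projective/free)
resolution, i.e. the least `n` such that `S/I` has a projective resolution of length `n`. -/
noncomputable def pdimQuot {K : Type*} [Field K] {V : Type*}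
    (I : Ideal (MvPolynomial V K)) : ℕ :=
  sInf {n : ℕ | pdimLE (MvPolynomial V K) n (MvPolynomial V K ⧸ I)}

/-- The ladder graph `A n` on `2n` vertices: `inl i = x_{i+1}`, `inr i = y_{i+1}`. -/
def graphA (n : ℕ) : SimpleGraph (Fin n ⊕ Fin n) :=
  SimpleGraph.fromRel (fun a b =>
    match a, b with
    | .inl i, .inl j => (i : ℕ) + 1 = j
    | .inr i, .inr j => (i : ℕ) + 1 = j
    | .inl i, .inr j => (i : ℕ) = (j : ℕ)
    | .inr _, .inl _ => False)

/-- The graph `B n`: the ladder `A n` with one extra vertex `y_{n+1}` and edge `{y_n, y_{n+1}}`.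
Here `inl i = x_{i+1}` (`i < n`) and `inr i = y_{i+1}` (`i < n+1`). -/
def graphB (n : ℕ) : SimpleGraph (Fin n ⊕ Fin (n+1)) :=
  SimpleGraph.fromRel (fun a b =>
    match a, b with
    | .inl i, .inl j => (i : ℕ) + 1 = j
    | .inr i, .inr j => (i : ℕ) + 1 = j
    | .inl i, .inr j => (i : ℕ) = (j : ℕ)
    | .inr _, .inl _ => False)

/-- The graph `C n`: the ladder `A n` with two extra vertices `y_{n+1}, y_{n+2}` and extra
edges `{y_n, y_{n+1}}` and `{y_1, y_{n+2}}`. Here `inl i = x_{i+1}` (`i < n`) and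
`inr i = y_{i+1}` (`i < n+2`). -/
def graphC (n : ℕ) : SimpleGraph (Fin n ⊕ Fin (n+2)) :=
  SimpleGraph.fromRel (fun a b =>
    match a, b with
    | .inl i, .inl j => (i : ℕ) + 1 = j
    | .inr i, .inr j => ((i : ℕ) + 1 = j ∧ (j : ℕ) ≤ n) ∨ ((i : ℕ) = 0 ∧ (j : ℕ) = n + 1)
    | .inl i, .inr j => (i : ℕ) = (j : ℕ)
    | .inr _, .inl _ => False)

/-- The graph `D n`: the ladder `A n` with two extra vertices `x_{n+1}, y_{n+1}` and extra
edges `{y_n, y_{n+1}}` and `{x_1, x_{n+1}}`. Here `inl i = x_{i+1}` and `inr i = y_{i+1}`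
(`i < n+1`). -/
def graphD (n : ℕ) : SimpleGraph (Fin (n+1) ⊕ Fin (n+1)) :=
  SimpleGraph.fromRel (fun a b =>
    match a, b with
    | .inl i, .inl j => ((i : ℕ) + 1 = j ∧ (j : ℕ) ≤ n - 1) ∨ ((i : ℕ) = 0 ∧ (j : ℕ) = n)
    | .inr i, .inr j => (i : ℕ) + 1 = j
    | .inl i, .inr j => (i : ℕ) = (j : ℕ) ∧ (i : ℕ) ≤ n - 1
    | .inr _, .inl _ => False)

/-- The circulant graph `C_q(s)` on vertex set `{x_1, …, x_q}` (realized as `Fin q`):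
`x_i` and `x_j` are adjacent iff `|i - j| ∈ s` or `q - |i - j| ∈ s`. -/
def circulantGraph (q : ℕ) (s : Set ℕ) : SimpleGraph (Fin q) :=
  SimpleGraph.fromRel (fun i j =>
    ((i : ℤ) - (j : ℤ)).natAbs ∈ s ∨ q - ((i : ℤ) - (j : ℤ)).natAbs ∈ s)



namespace CubicAux

/-- Finset independent in `G`. -/
def Indep {V : Type*} (G : SimpleGraph V) (T : Finset V) : Prop :=
  ∀ i ∈ T, ∀ j ∈ T, ¬ G.Adj i j

/-- Decision trees certifying an interval partition of the independence complex of `G[W]`. -/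
inductive DT {V : Type*} (G : SimpleGraph V) : Set V → ℕ → Prop
  | nil (W : Set V) : W = ∅ → DT G W 0
  | iso (v : V) (W W' : Set V) (d : ℕ) : v ∉ W → (∀ w ∈ W, ¬ G.Adj v w) →
      W' = insert v W → DT G W d → DT G W' (d + 1)
  | branch (v : V) (W W₁ W₂ : Set V) (d : ℕ) : v ∈ W → W₁ = W \ {v} →
      W₂ = {w | w ∈ W ∧ w ≠ v ∧ ¬ G.Adj v w} → DT G W₁ (d + 1) → DT G W₂ d → DT G W (d + 1)
  | mono (W : Set V) (d d' : ℕ) : d' ≤ d → DT G W d → DT G W d'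

theorem DT.union {V : Type*} {G : SimpleGraph V} {W₁ W₂ : Set V} {d₁ d₂ : ℕ}
    (h₁ : DT G W₁ d₁) (h₂ : DT G W₂ d₂) (hd : Disjoint W₁ W₂)
    (hadj : ∀ v ∈ W₁, ∀ w ∈ W₂, ¬ G.Adj v w) : DT G (W₁ ∪ W₂) (d₁ + d₂) := by
  induction h₁ with
  | nil W hW => subst hW; simpa using h₂
  | iso v W W' d hv hW hW' h ih =>
    subst hW'
    rw [Set.disjoint_left] at hd
    have := ih (by rw [Set.disjoint_left]; intro x hx; exact hd (Or.inr hx))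
      (fun x hx => hadj x (Or.inr hx))
    rw [show d + 1 + d₂ = d + d₂ + 1 by omega]
    refine DT.iso v (W ∪ W₂) _ _ ?_ ?_ (by rw [Set.insert_union]) this
    · rintro (h | h)
      · exact hv h
      · exact hd (Or.inl rfl) h
    · rintro w (h | h)
      · exact hW w h
      · exact hadj v (Or.inl rfl) w h
  | branch v W W₁ W₂' d hv e₁ e₂ h₁ h₂' ih₁ ih₂ =>
    rw [Set.disjoint_left] at hd
    subst e₁ e₂
    have i1 := ih₁ (by rw [Set.disjoint_left]; intro x hx; exact hd hx.1)
      (fun x hx => hadj x hx.1)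
    have i2 := ih₂ (by rw [Set.disjoint_left]; intro x hx; exact hd hx.1)
      (fun x hx => hadj x hx.1)
    rw [show d + 1 + d₂ = d + d₂ + 1 by omega] at *
    refine DT.branch v _ _ _ _ (Or.inl hv) ?_ ?_ i1 i2
    · ext x
      have := @hd v hv
      simp only [Set.mem_union, Set.mem_sdiff, Set.mem_singleton_iff]
      grind
    · ext x
      have := @hd v hv
      have := hadj v hv x
      simp only [Set.mem_union, Set.mem_ofPred_eq]
      grind
  | mono W d d' hd' h ih => exact DT.mono _ _ _ (by omega) (ih hd hadj)

theorem DT.map {V V' : Type*} {G : SimpleGraph V} {G' : SimpleGraph V'} (f : V → V')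
    {W : Set V} {d : ℕ} (h : DT G W d) (hinj : Set.InjOn f W)
    (hadj : ∀ v ∈ W, ∀ w ∈ W, G'.Adj (f v) (f w) ↔ G.Adj v w) : DT G' (f '' W) d := by
  induction h with
  | nil W hW => exact DT.nil _ (by simp [hW])
  | iso v W W' d hv hW hW' h ih =>
    subst hW'
    have := ih (hinj.mono (Set.subset_insert _ _))
      (fun x hx y hy => hadj x (Or.inr hx) y (Or.inr hy))
    refine DT.iso (f v) (f '' W) _ _ ?_ ?_ (Set.image_insert_eq) this
    · rintro ⟨w, hw, e⟩
      have := hinj (Or.inr hw) (Or.inl rfl) e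
      exact hv (this ▸ hw)
    · rintro _ ⟨w, hw, rfl⟩
      rw [hadj v (Or.inl rfl) w (Or.inr hw)]
      exact hW w hw
  | branch v W W₁ W₂' d hv e₁ e₂ h₁ h₂' ih₁ ih₂ =>
    subst e₁ e₂
    have i1 := ih₁ (hinj.mono (fun x hx => hx.1)) (fun x hx y hy => hadj x hx.1 y hy.1)
    have i2 := ih₂ (hinj.mono (fun x hx => hx.1)) (fun x hx y hy => hadj x hx.1 y hy.1)
    refine DT.branch (f v) _ _ _ _ ⟨v, hv, rfl⟩ ?_ ?_ i1 i2
    · ext x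
      constructor
      · rintro ⟨w, ⟨hw, hne⟩, rfl⟩
        exact ⟨⟨w, hw, rfl⟩, fun e => hne (hinj hw hv e)⟩
      · rintro ⟨⟨w, hw, rfl⟩, hne⟩
        exact ⟨w, ⟨hw, fun e => hne (by rw [Set.mem_singleton_iff] at e; rw [e]; rfl)⟩, rfl⟩
    · ext x
      constructor
      · rintro ⟨w, ⟨hw, hne, ha⟩, rfl⟩
        exact ⟨⟨w, hw, rfl⟩, fun e => hne (hinj hw hv e), by rwa [hadj v hv w hw]⟩
      · rintro ⟨⟨w, hw, rfl⟩, hne, ha⟩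
        exact ⟨w, ⟨hw, fun e => hne (by rw [e]), by rwa [hadj v hv w hw] at ha⟩, rfl⟩
  | mono W d d' hd' h ih => exact DT.mono _ _ _ (by omega) (ih hinj hadj)

/-- Interval partitions of the independence complex. -/
def IP {V : Type*} (G : SimpleGraph V) (W : Set V) (d : ℕ)
    (P : Finset (Finset V × Finset V)) : Prop :=
  (∀ b ∈ P, b.1 ⊆ b.2 ∧ (b.2 : Set V) ⊆ W ∧ Indep G b.2 ∧ d ≤ b.2.card) ∧
  (∀ T : Finset V, (T : Set V) ⊆ W → Indep G T → ∃ b ∈ P, b.1 ⊆ T ∧ T ⊆ b.2) ∧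
  (∀ T : Finset V, ∀ b ∈ P, ∀ c ∈ P, b.1 ⊆ T → T ⊆ b.2 → c.1 ⊆ T → T ⊆ c.2 → b = c)

theorem Indep.mono {V : Type*} {G : SimpleGraph V} {S T : Finset V} (h : Indep G T)
    (hS : S ⊆ T) : Indep G S := fun i hi j hj => h i (hS hi) j (hS hj)

theorem Indep.insert {V : Type*} [DecidableEq V] {G : SimpleGraph V} {T : Finset V} {v : V}
    (h : Indep G T) (hv : ∀ w ∈ T, ¬ G.Adj v w) : Indep G (insert v T) := by
  intro i hi j hj hij
  rw [Finset.mem_insert] at hi hj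
  rcases hi with rfl | hi <;> rcases hj with rfl | hj
  · exact G.irrefl hij
  · exact hv j hj hij
  · exact hv i hi hij.symm
  · exact h i hi j hj hij

theorem DT.exists_IP {V : Type*} {G : SimpleGraph V} {W : Set V} {d : ℕ} (h : DT G W d) :
    ∃ P, IP G W d P := by
  classical
  induction h with
  | nil W hW =>
    subst hW
    refine ⟨{(∅, ∅)}, ?_, ?_, ?_⟩
    · simp [Indep]
    · intro T hT _
      have : T = ∅ := by simpa using hT
      simp [this]
    · intro T b hb c hc _ _ _ _
      simp at hb hc
      rw [hb, hc]
  | iso v W W' d hv hW hW' h ih =>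
    subst hW'
    obtain ⟨P, h1, h2, h3⟩ := ih
    have hvb : ∀ b ∈ P, v ∉ b.2 := fun b hb hvb => hv ((h1 b hb).2.1 hvb)
    have hva : ∀ b ∈ P, v ∉ b.1 := fun b hb hvb' => hvb b hb ((h1 b hb).1 hvb')
    refine ⟨P.image (fun b => (b.1, insert v b.2)), ?_, ?_, ?_⟩
    · intro b hb
      obtain ⟨c, hc, rfl⟩ := Finset.mem_image.1 hb
      obtain ⟨q1, q2, q3, q4⟩ := h1 c hc
      refine ⟨q1.trans (Finset.subset_insert _ _), ?_, ?_, ?_⟩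
      · rw [Finset.coe_insert]; exact Set.insert_subset_insert q2
      · exact q3.insert (fun w hw => hW w (q2 hw))
      · rw [Finset.card_insert_of_notMem (hvb c hc)]; omega
    · intro T hT hTi
      obtain ⟨b, hb, b1, b2⟩ := h2 (T.erase v) (by
        intro x hx
        simp at hx
        rcases hT hx.1 with h | h
        · exact absurd h hx.2
        · exact h) (hTi.mono (Finset.erase_subset _ _))
      refine ⟨_, Finset.mem_image_of_mem _ hb, b1.trans (Finset.erase_subset _ _), ?_⟩
      rw [Finset.subset_insert_iff]
      · exact b2
    · intro T b hb₀ c hc₀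
      obtain ⟨b, hb, rfl⟩ := Finset.mem_image.1 hb₀
      obtain ⟨c, hc, rfl⟩ := Finset.mem_image.1 hc₀
      intro b1 b2 c1 c2
      have := h3 (T.erase v) b hb c hc (Finset.subset_erase.2 ⟨b1, hva b hb⟩)
        (Finset.subset_insert_iff.1 b2) (Finset.subset_erase.2 ⟨c1, hva c hc⟩)
        (Finset.subset_insert_iff.1 c2)
      rw [this]
  | branch v W W₁ W₂' d hv e₁ e₂ h₁ h₂' ih₁ ih₂ =>
    subst e₁ e₂
    obtain ⟨P, h1, h2, h3⟩ := ih₁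
    obtain ⟨Q, k1, k2, k3⟩ := ih₂
    have hvP : ∀ b ∈ P, v ∉ b.2 := fun b hb hvb => ((h1 b hb).2.1 hvb).2 rfl
    have hvQ : ∀ b ∈ Q, v ∉ b.2 := fun b hb hvb => ((k1 b hb).2.1 hvb).2.1 rfl
    have hvQ' : ∀ b ∈ Q, v ∉ b.1 := fun b hb hvb => hvQ b hb ((k1 b hb).1 hvb)
    refine ⟨P ∪ Q.image (fun b => (insert v b.1, insert v b.2)), ?_, ?_, ?_⟩
    · intro b hb
      rcases Finset.mem_union.1 hb with hb | hb
      · obtain ⟨q1, q2, q3, q4⟩ := h1 b hb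
        exact ⟨q1, fun x hx => (q2 hx).1, q3, q4⟩
      obtain ⟨c, hc, rfl⟩ := Finset.mem_image.1 hb
      obtain ⟨q1, q2, q3, q4⟩ := k1 c hc
      refine ⟨Finset.insert_subset_insert _ q1, ?_, ?_, ?_⟩
      · rw [Finset.coe_insert]; exact Set.insert_subset hv (fun x hx => (q2 hx).1)
      · exact q3.insert (fun w hw => (q2 hw).2.2)
      · rw [Finset.card_insert_of_notMem (hvQ c hc)]; omega
    · intro T hT hTi
      by_cases hvT : v ∈ T
      · obtain ⟨b, hb, b1, b2⟩ := k2 (T.erase v) (by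
          intro x hx
          simp at hx
          exact ⟨hT hx.1, hx.2, hTi v hvT x hx.1⟩) (hTi.mono (Finset.erase_subset _ _))
        refine ⟨_, Finset.mem_union_right _ (Finset.mem_image_of_mem _ hb), ?_, ?_⟩
        · exact Finset.insert_subset hvT (b1.trans (Finset.erase_subset _ _))
        · rw [Finset.subset_insert_iff]
          exact b2
      · obtain ⟨b, hb, b1, b2⟩ := h2 T (by
          intro x hx
          refine ⟨hT hx, ?_⟩
          rintro rfl
          exact hvT hx) hTi
        exact ⟨b, Finset.mem_union_left _ hb, b1, b2⟩
    · intro T b hb₀ c hc₀ b1 b2 c1 c2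
      rcases Finset.mem_union.1 hb₀ with hb | hb₁ <;> rcases Finset.mem_union.1 hc₀ with hc | hc₁
      · exact h3 T b hb c hc b1 b2 c1 c2
      · obtain ⟨c, hc, rfl⟩ := Finset.mem_image.1 hc₁
        exact absurd (b2 (c1 (Finset.mem_insert_self _ _))) (hvP b hb)
      · obtain ⟨b, hb, rfl⟩ := Finset.mem_image.1 hb₁
        exact absurd (c2 (b1 (Finset.mem_insert_self _ _))) (hvP c hc)
      · obtain ⟨b, hb, rfl⟩ := Finset.mem_image.1 hb₁
        obtain ⟨c, hc, rfl⟩ := Finset.mem_image.1 hc₁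
        have := k3 (T.erase v) b hb c hc
          (Finset.subset_erase.2 ⟨(Finset.subset_insert _ _).trans b1, hvQ' b hb⟩)
          (Finset.subset_insert_iff.1 b2)
          (Finset.subset_erase.2 ⟨(Finset.subset_insert _ _).trans c1, hvQ' c hc⟩)
          (Finset.subset_insert_iff.1 c2)
        rw [this]
  | mono W d d' hd' h ih =>
    obtain ⟨P, h1, h2, h3⟩ := ih
    exact ⟨P, fun b hb => ⟨(h1 b hb).1, (h1 b hb).2.1, (h1 b hb).2.2.1,
      hd'.trans (h1 b hb).2.2.2⟩, h2, h3⟩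

theorem mem_edgeIdeal_iff {K : Type*} [Field K] {V : Type*} (G : SimpleGraph V)
    (f : MvPolynomial V K) :
    f ∈ edgeIdeal K G ↔ ∀ m ∈ f.support, ∃ i j, G.Adj i j ∧
      (Finsupp.single i 1 + Finsupp.single j 1 : V →₀ ℕ) ≤ m := by
  have : edgeIdeal K G = Ideal.span ((fun s => monomial s (1 : K)) ''
      {s : V →₀ ℕ | ∃ i j, G.Adj i j ∧ s = Finsupp.single i 1 + Finsupp.single j 1}) := by
    unfold edgeIdeal
    congr 1
    ext m
    constructor
    · rintro ⟨i, j, h, rfl⟩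
      exact ⟨_, ⟨i, j, h, rfl⟩, by simp [X, monomial_mul]⟩
    · rintro ⟨_, ⟨i, j, h, rfl⟩, rfl⟩
      exact ⟨i, j, h, by simp [X, monomial_mul]⟩
  rw [this, mem_ideal_span_monomial_image]
  constructor
  · intro h m hm
    obtain ⟨_, ⟨i, j, hij, rfl⟩, hs⟩ := h m hm
    exact ⟨i, j, hij, hs⟩
  · intro h m hm
    obtain ⟨i, j, hij, hs⟩ := h m hm
    exact ⟨_, ⟨i, j, hij, rfl⟩, hs⟩

theorem edge_le_iff {V : Type*} (G : SimpleGraph V) (m : V →₀ ℕ) :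
    (∃ i j, G.Adj i j ∧ (Finsupp.single i 1 + Finsupp.single j 1 : V →₀ ℕ) ≤ m) ↔
      ¬ Indep G m.support := by
  classical
  unfold Indep
  push Not
  constructor
  · rintro ⟨i, j, hij, h⟩
    have hi := h i
    have hj := h j
    simp at hi hj
    exact ⟨i, by simp; omega, j, by simp; omega, hij⟩
  · rintro ⟨i, hi, j, hj, hij⟩
    refine ⟨i, j, hij, ?_⟩
    intro k
    have := hij.ne
    simp at hi hj
    simp only [Finsupp.add_apply, Finsupp.single_apply]
    split_ifs <;> grind

/-- The standard monomials of `S/I(G)`. -/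
noncomputable def stdMon (K : Type*) [Field K] {V : Type*} (G : SimpleGraph V)
    (e : {e : V →₀ ℕ // Indep G e.support}) : MvPolynomial V K ⧸ edgeIdeal K G :=
  Ideal.Quotient.mk (edgeIdeal K G) (monomial e.1 (1 : K))

theorem stdMon_li (K : Type*) [Field K] {V : Type*} (G : SimpleGraph V) :
    LinearIndependent K (stdMon K G) := by
  classical
  have hb : LinearIndependent K (fun e : {e : V →₀ ℕ // Indep G e.support} =>
      (monomial e.1 (1 : K) : MvPolynomial V K)) := by
    have := (basisMonomials V K).linearIndependent
    have h2 := this.comp (fun e : {e : V →₀ ℕ // Indep G e.support} => e.1)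
      Subtype.val_injective
    simpa [Function.comp_def] using h2
  have := hb.map (f := (Ideal.Quotient.mkₐ K (edgeIdeal K G)).toLinearMap) (by
    rw [Submodule.disjoint_def]
    intro f hf hk
    have hk' : f ∈ edgeIdeal K G := by
      rw [LinearMap.mem_ker] at hk
      exact Ideal.Quotient.eq_zero_iff_mem.1 hk
    rw [mem_edgeIdeal_iff] at hk'
    have hs : ∀ m ∈ f.support, Indep G m.support := by
      refine Submodule.span_induction (p := fun f _ => ∀ m ∈ f.support, Indep G m.support)
        ?_ ?_ ?_ ?_ hf
      · rintro _ ⟨e, rfl⟩ m hm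
        have := support_monomial_subset hm
        simp at this
        rw [this]; exact e.2
      · simp
      · intro x y _ _ hx hy m hm
        rcases Finset.mem_union.1 (support_add hm) with h | h
        · exact hx m h
        · exact hy m h
      · intro a x _ hx m hm
        exact hx m (support_smul hm)
    rw [← support_eq_empty, Finset.eq_empty_iff_forall_notMem]
    intro m hm
    exact (edge_le_iff G m).1 (hk' m hm) (hs m hm))
  exact this

theorem stdMon_span (K : Type*) [Field K] {V : Type*} (G : SimpleGraph V) :
    Submodule.span K (Set.range (stdMon K G)) = ⊤ := by
  classical
  rw [eq_top_iff]
  rintro x -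
  obtain ⟨f, rfl⟩ := Ideal.Quotient.mk_surjective x
  induction f using MvPolynomial.induction_on' with
  | monomial u a =>
    have e : Ideal.Quotient.mk (edgeIdeal K G) (monomial u a) =
        a • Ideal.Quotient.mk (edgeIdeal K G) (monomial u (1 : K)) := by
      rw [← Ideal.Quotient.mkₐ_eq_mk K, ← map_smul, smul_monomial, smul_eq_mul, mul_one]
    rw [e]
    apply Submodule.smul_mem
    by_cases h : Indep G u.support
    · exact Submodule.subset_span ⟨⟨u, h⟩, rfl⟩
    · rw [Ideal.Quotient.eq_zero_iff_mem.2]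
      · exact Submodule.zero_mem _
      · rw [mem_edgeIdeal_iff]
        intro m hm
        have := support_monomial_subset hm
        simp at this
        rw [this]
        exact (edge_le_iff G u).2 h
  | add p q hp hq =>
    rw [map_add]
    exact Submodule.add_mem _ hp hq

theorem le_sdepth_of_IP (K : Type*) [Field K] {V : Type*} [Fintype V] (G : SimpleGraph V)
    {d : ℕ} {P : Finset (Finset V × Finset V)} (hP : IP G Set.univ d P) :
    d ≤ sdepthQuot (edgeIdeal K G) := by
  classical
  obtain ⟨h1, h2, h3⟩ := hP
  have li := stdMon_li K G
  let q : Fin P.card → Finset V × Finset V := fun j => (P.equivFin.symm j : _)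
  have hq : ∀ j, q j ∈ P := fun j => (P.equivFin.symm j).2
  have hqi : Function.Injective q := Subtype.val_injective.comp P.equivFin.symm.injective
  have hqs : ∀ b ∈ P, ∃ j, q j = b := fun b hb => ⟨P.equivFin ⟨b, hb⟩, by simp [q]⟩
  let u : Fin P.card → (V →₀ ℕ) := fun j => Finsupp.indicator (q j).1 (fun _ _ => 1)
  have hu : ∀ j x, u j x = if x ∈ (q j).1 then 1 else 0 := by
    intro j x; simp [u, Finsupp.indicator_apply]
  have hsupp : ∀ j (e : V →₀ ℕ), ((q j).1 ⊆ e.support ∧ e.support ⊆ (q j).2) ↔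
      ∃ a : V →₀ ℕ, a.support ⊆ (q j).2 ∧ e = u j + a := by
    intro j e
    constructor
    · rintro ⟨ha, hb⟩
      refine ⟨e - u j, ?_, ?_⟩
      · refine subset_trans ?_ hb
        intro x hx
        simp at hx ⊢
        omega
      · ext x
        simp only [Finsupp.add_apply, Finsupp.tsub_apply, hu]
        split_ifs with hx
        · have := ha hx
          simp at this
          omega
        · omega
    · rintro ⟨a, ha, rfl⟩
      constructor
      · intro x hx
        simp [hu, hx]
      · intro x hx
        by_contra hx'
        have hx1 : x ∉ (q j).1 := fun h => hx' ((h1 _ (hq j)).1 h)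
        have hx2 : x ∉ a.support := fun h => hx' (ha h)
        simp at hx2
        simp [hu, hx1, hx2] at hx
  have hind : ∀ j (a : V →₀ ℕ), a.support ⊆ (q j).2 → Indep G (u j + a).support := by
    intro j a ha
    exact (h1 _ (hq j)).2.2.1.mono ((hsupp j _).2 ⟨a, ha, rfl⟩).2
  let S : Fin P.card → Set {e : V →₀ ℕ // Indep G e.support} := fun j =>
    {e | (q j).1 ⊆ e.1.support ∧ e.1.support ⊆ (q j).2}
  have hspace : ∀ j, stanleySpace (edgeIdeal K G) (u j) (q j).2 =
      Submodule.span K (stdMon K G '' S j) := by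
    intro j
    unfold stanleySpace
    congr 1
    ext x
    constructor
    · rintro ⟨a, ha, rfl⟩
      exact ⟨⟨u j + a, hind j a ha⟩, (hsupp j _).2 ⟨a, ha, rfl⟩, rfl⟩
    · rintro ⟨e, he, rfl⟩
      obtain ⟨a, ha, he'⟩ := (hsupp j _).1 he
      exact ⟨a, ha, by rw [← he']; rfl⟩
  have hSd : ∀ j k, j ≠ k → Disjoint (S j) (S k) := by
    intro j k hjk
    rw [Set.disjoint_left]
    intro e hj hk
    exact hjk (hqi (h3 e.1.support _ (hq j) _ (hq k) hj.1 hj.2 hk.1 hk.2))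
  let D : StanleyDecomposition (edgeIdeal K G) :=
    { m := P.card
      u := u
      Z := fun j => (q j).2
      free := by
        intro j
        exact li.comp (fun a : {a : V →₀ ℕ // a.support ⊆ (q j).2} =>
          (⟨u j + a.1, hind j a.1 a.2⟩ : {e : V →₀ ℕ // Indep G e.support})) (by
            intro a b hab
            have : u j + a.1 = u j + b.1 := congrArg Subtype.val hab
            exact Subtype.ext (add_left_cancel this))
      internal := by
        rw [DirectSum.isInternal_submodule_iff_iSupIndep_and_iSup_eq_top]
        constructor
        · intro j
          simp only [hspace]
          simp only [← Submodule.span_iUnion, ← Set.image_iUnion]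
          apply li.disjoint_span_image
          rw [Set.disjoint_iUnion_right]
          intro k
          rw [Set.disjoint_iUnion_right]
          intro hk
          exact hSd j k hk.symm
        · simp only [hspace]
          rw [← Submodule.span_iUnion, ← Set.image_iUnion, ← stdMon_span K G, ← Set.image_univ]
          congr 2
          rw [Set.eq_univ_iff_forall]
          intro e
          obtain ⟨b, hb, b1, b2⟩ := h2 e.1.support (Set.subset_univ _) e.2
          obtain ⟨j, rfl⟩ := hqs b hb
          exact Set.mem_iUnion.2 ⟨j, b1, b2⟩ }
  unfold sdepthQuot
  apply le_csSup
  · refine ⟨Fintype.card V, ?_⟩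
    rintro m ⟨D', hD'⟩
    have hm : 0 < D'.m := by
      by_contra hm
      have hm : D'.m = 0 := by omega
      have hi := D'.internal
      rw [DirectSum.isInternal_submodule_iff_iSupIndep_and_iSup_eq_top] at hi
      have : IsEmpty (Fin D'.m) := by rw [hm]; infer_instance
      have h0 := hi.2
      rw [iSup_of_empty] at h0
      have hne := li.ne_zero ⟨0, by intro i hi; simp at hi⟩
      apply hne
      have : stdMon K G ⟨0, by intro i hi; simp at hi⟩ ∈
        (⊥ : Submodule K (MvPolynomial V K ⧸ edgeIdeal K G)) := by rw [h0]; trivial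
      simpa using this
    exact (hD' ⟨0, hm⟩).trans (Finset.card_le_univ _)
  · exact ⟨D, fun j => (h1 _ (hq j)).2.2.2⟩

/-- The two-way infinite ladder. -/
def ladder : SimpleGraph (ℤ × Bool) where
  Adj v w := (v.2 = w.2 ∧ (w.1 = v.1 + 1 ∨ v.1 = w.1 + 1)) ∨ (v.1 = w.1 ∧ v.2 ≠ w.2)
  symm := ⟨by intro v w h; grind⟩
  loopless := ⟨by intro v h; grind⟩

theorem ladder_adj (v w : ℤ × Bool) : ladder.Adj v w ↔
    (v.2 = w.2 ∧ (w.1 = v.1 + 1 ∨ v.1 = w.1 + 1)) ∨ (v.1 = w.1 ∧ v.2 ≠ w.2) := Iff.rfl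

/-- Ladder segment with a pendant on the left. -/
def BS (i : ℤ) (r : Bool) (j : ℤ) : Set (ℤ × Bool) :=
  {v | i ≤ v.1 ∧ v.1 ≤ j ∧ (v.1 = i → v.2 = r)}

/-- Ladder segment with pendants on both ends. -/
def ES (i : ℤ) (r : Bool) (j : ℤ) (s : Bool) : Set (ℤ × Bool) :=
  {v | i ≤ v.1 ∧ v.1 ≤ j ∧ (v.1 = i → v.2 = r) ∧ (v.1 = j → v.2 = s)}

theorem mem_BS (i : ℤ) (r : Bool) (j k : ℤ) (q : Bool) :
    (k, q) ∈ BS i r j ↔ i ≤ k ∧ k ≤ j ∧ (k = i → q = r) := Iff.rfl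

theorem mem_ES (i : ℤ) (r : Bool) (j : ℤ) (s : Bool) (k : ℤ) (q : Bool) :
    (k, q) ∈ ES i r j s ↔ i ≤ k ∧ k ≤ j ∧ (k = i → q = r) ∧ (k = j → q = s) := Iff.rfl

theorem DT_B (m : ℕ) : ∀ (i : ℤ) (r : Bool) (j : ℤ), j = i + m - 1 →
    DT ladder (BS i r j) ((m + 1) / 2) := by
  induction m using Nat.strong_induction_on with
  | _ m ih =>
  intro i r j hj
  match m, ih, hj with
  | 0, ih, hj =>
    refine DT.nil _ ?_
    ext ⟨k, q⟩
    simp only [mem_BS, Set.mem_empty_iff_false, iff_false]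
    omega
  | 1, ih, hj =>
    refine DT.iso (i, r) ∅ _ 0 (by simp) (by simp) ?_ (DT.nil _ rfl)
    ext ⟨k, q⟩
    simp only [mem_BS, Set.mem_insert_iff, Set.mem_empty_iff_false, or_false, Prod.mk.injEq]
    grind
  | m + 2, ih, hj =>
    have b1 := ih (m + 1) (by omega) (i + 1) (!r) j (by push_cast at *; omega)
    have b2 := ih m (by omega) (i + 2) (!r) j (by push_cast at *; omega)
    rw [show (m + 2 + 1) / 2 = (m + 1) / 2 + 1 by omega]
    refine DT.branch (i + 1, r) _ _ _ _ ?_ rfl ?_ (DT.mono _ ((m + 1 + 1) / 2 + 1) _ (by omega)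
      (DT.iso (i, r) (BS (i + 1) (!r) j) _ _ ?_ ?_ ?_ b1)) b2
    · rw [mem_BS]; push_cast at *; omega
    · ext ⟨k, q⟩
      simp only [mem_BS, Set.mem_ofPred_eq, ladder_adj, ne_eq, Prod.mk.injEq]
      push_cast at *
      cases r <;> cases q <;> simp <;> omega
    · rw [mem_BS]; omega
    · rintro ⟨k, q⟩ h
      rw [mem_BS] at h
      rw [ladder_adj]
      cases r <;> cases q <;> simp at * <;> omega
    · ext ⟨k, q⟩
      simp only [mem_BS, Set.mem_sdiff, Set.mem_singleton_iff, Set.mem_insert_iff, Prod.mk.injEq]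
      push_cast at *
      cases r <;> cases q <;> simp <;> omega

/-- Value for the two-sided segment. -/
def segVal (m : ℕ) (b : Bool) : ℕ := if b then 2 * ((m + 1) / 4) + 1 else 2 * ((m + 3) / 4)

theorem DT_E (m : ℕ) : ∀ (i : ℤ) (r : Bool) (j : ℤ) (s : Bool), j = i + m →
    DT ladder (ES i r j s) (segVal m (r == s)) := by
  induction m using Nat.strong_induction_on with
  | _ m ih =>
  intro i r j s hj
  match m, ih, hj with
  | 0, ih, hj =>
    by_cases hrs : r = s
    · subst hrs
      rw [show segVal 0 (r == r) = 1 by simp [segVal]]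
      refine DT.iso (i, r) ∅ _ 0 (by simp) (by simp) ?_ (DT.nil _ rfl)
      ext ⟨k, q⟩
      simp only [mem_ES, Set.mem_insert_iff, Set.mem_empty_iff_false, or_false, Prod.mk.injEq]
      grind
    · rw [show segVal 0 (r == s) = 0 by simp [segVal, hrs]]
      refine DT.nil _ ?_
      ext ⟨k, q⟩
      simp only [mem_ES, Set.mem_empty_iff_false, iff_false]
      grind
  | 1, ih, hj =>
    have hj : j = i + 1 := by simpa using hj
    by_cases hrs : r = s
    · subst hrs
      rw [show segVal 1 (r == r) = 0 + 1 by simp [segVal]]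
      refine DT.branch (i, r) _ {(i + 1, r)} ∅ 0 ?_ ?_ ?_
        (DT.iso (i + 1, r) ∅ _ 0 (by simp) (by simp) (by simp) (DT.nil _ rfl)) (DT.nil _ rfl)
      · rw [mem_ES]; grind
      · ext ⟨k, q⟩
        simp only [mem_ES, Set.mem_sdiff, Set.mem_singleton_iff, Prod.mk.injEq]
        cases r <;> cases q <;> simp <;> omega
      · ext ⟨k, q⟩
        simp only [mem_ES, Set.mem_ofPred_eq, ladder_adj, ne_eq, Prod.mk.injEq,
          Set.mem_empty_iff_false, false_iff]
        cases r <;> cases q <;> simp <;> omega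
    · obtain rfl : s = !r := by cases r <;> cases s <;> simp_all
      rw [show segVal 1 (r == !r) = 0 + 1 + 1 by simp [segVal]]
      refine DT.iso (i, r) {(i + 1, !r)} _ _ (by simp) ?_ ?_
        (DT.iso (i + 1, !r) ∅ _ 0 (by simp) (by simp) (by simp) (DT.nil _ rfl))
      · rintro ⟨k, q⟩ h
        simp at h
        rw [ladder_adj]
        simp [h]
      · ext ⟨k, q⟩
        simp only [mem_ES, Set.mem_insert_iff, Set.mem_singleton_iff, Prod.mk.injEq]
        cases r <;> cases q <;> simp <;> omega
  | m + 2, ih, hj =>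
    have b1 := ih (m + 1) (by omega) (i + 1) (!r) j s (by push_cast at *; omega)
    have b2 := ih m (by omega) (i + 2) (!r) j s (by push_cast at *; omega)
    have e1 : segVal (m + 2) (r == s) = segVal m ((!r) == s) + 1 := by
      cases r <;> cases s <;> simp [segVal] <;> omega
    have e2 : segVal m ((!r) == s) ≤ segVal (m + 1) ((!r) == s) := by
      cases r <;> cases s <;> simp [segVal] <;> omega
    rw [e1]
    refine DT.branch (i + 1, r) _ _ _ _ ?_ rfl ?_ (DT.mono _ (_ + 1) _ (by omega)
      (DT.iso (i, r) (ES (i + 1) (!r) j s) _ _ ?_ ?_ ?_ b1)) b2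
    · rw [mem_ES]; push_cast at *; omega
    · ext ⟨k, q⟩
      simp only [mem_ES, Set.mem_ofPred_eq, ladder_adj, ne_eq, Prod.mk.injEq]
      push_cast at *
      cases r <;> cases q <;> cases s <;> simp <;> omega
    · rw [mem_ES]; omega
    · rintro ⟨k, q⟩ h
      rw [mem_ES] at h
      rw [ladder_adj]
      cases r <;> cases q <;> simp at * <;> omega
    · ext ⟨k, q⟩
      simp only [mem_ES, Set.mem_sdiff, Set.mem_singleton_iff, Set.mem_insert_iff, Prod.mk.injEq]
      push_cast at *
      cases r <;> cases q <;> cases s <;> simp <;> omega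

set_option maxHeartbeats 2000000 in
theorem DT_cyc {V : Type*} {G : SimpleGraph V} (p : ℤ × Bool → V) (N : ℕ) (hN : 2 ≤ N) (tw : Bool)
    (hper : ∀ (i : ℤ) (r : Bool), p (i + N, r) = p (i, r ^^ tw))
    (hinj : ∀ (i : ℤ) (r : Bool) (j : ℤ) (s : Bool), i - j < N → j - i < N → p (i, r) = p (j, s) → i = j ∧ r = s)
    (hadj : ∀ (i : ℤ) (r : Bool) (v : V), G.Adj (p (i, r)) v ↔ v = p (i + 1, r) ∨ v = p (i - 1, r) ∨ v = p (i, !r))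
    (d : ℕ) (h1 : d + 1 ≤ (N + 1) / 2) (h2 : d + 1 ≤ segVal (N - 2) (!tw) + 1) (h3 : d + 1 ≤ segVal (N - 1) tw) :
    DT G (Set.range p) (d + 1) := by
  have hr : Set.range p = p '' {v | 0 ≤ v.1 ∧ v.1 < N} := by
    apply Set.Subset.antisymm
    · rintro _ ⟨⟨i, r⟩, rfl⟩
      have key : ∀ (k : ℕ) (i : ℤ) (r : Bool), -(k : ℤ) ≤ i → i < N + k →
          p (i, r) ∈ p '' {v | 0 ≤ v.1 ∧ v.1 < N} := by
        intro k
        induction k with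
        | zero =>
          intro i r h h'
          exact ⟨(i, r), ⟨by simpa using h, by simpa using h'⟩, rfl⟩
        | succ k ih =>
          intro i r h h'
          push_cast at h h'
          by_cases c1 : i < 0
          · have := hper i (r ^^ tw)
            rw [show ((r ^^ tw) ^^ tw) = r by cases r <;> cases tw <;> rfl] at this
            rw [← this]
            exact ih _ _ (by omega) (by omega)
          · by_cases c2 : i < N
            · exact ih _ _ (by omega) (by omega)
            · have := hper (i - N) r
              rw [sub_add_cancel] at this
              rw [this]
              exact ih _ _ (by omega) (by omega)
      exact key i.natAbs i r (by omega) (by omega)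
    · exact Set.image_subset_range _ _
  rw [hr]
  -- special identifications
  have q1 : p (-1, false) = p ((N : ℤ) - 1, tw) := by
    have := hper (-1) tw
    rw [show (tw ^^ tw) = false by simp] at this
    rw [← this, show (-1 + (N : ℤ)) = N - 1 by ring]
  have q2 : p (0, true) = p ((N : ℤ), !tw) := by
    have := hper 0 (!tw)
    rw [show ((!tw) ^^ tw) = true by simp] at this
    rw [← this, zero_add]
  have q3 : p ((N : ℤ) + 1, !tw) = p (1, true) := by
    have := hper 1 (!tw)
    rw [show ((!tw) ^^ tw) = true by simp] at this
    rw [← this]; congr 2; omega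
  -- transport on columns 1..N-1
  have tr : ∀ (X : Set (ℤ × Bool)) (e : ℕ), (∀ v ∈ X, 1 ≤ v.1 ∧ v.1 ≤ (N : ℤ) - 1) →
      DT ladder X e → DT G (p '' X) e := by
    intro X e hX hD
    refine hD.map p ?_ ?_
    · rintro ⟨i, r⟩ hi ⟨j, s⟩ hj h
      have a1 := hX _ hi
      have a2 := hX _ hj
      have := hinj i r j s (by simp at *; omega) (by simp at *; omega) h
      rw [this.1, this.2]
    · rintro ⟨i, r⟩ hi ⟨j, s⟩ hj
      have a1 := hX _ hi
      have a2 := hX _ hj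
      simp only at a1 a2
      rw [hadj, ladder_adj]
      constructor
      · rintro (h | h | h)
        · have := hinj _ _ _ _ (by omega) (by omega) h
          grind
        · have := hinj _ _ _ _ (by omega) (by omega) h
          grind
        · have := hinj _ _ _ _ (by omega) (by omega) h
          cases r <;> grind
      · simp only
        rintro (⟨rfl, rfl | rfl⟩ | ⟨rfl, h⟩)
        · left; rfl
        · right; left; congr 2; omega
        · right; right; congr 2; revert h; cases r <;> cases s <;> simp
  have D1 : DT G (p '' ES 1 true ((N : ℤ) - 1) (!tw)) d := by
    refine DT.mono _ (segVal (N - 2) (!tw)) _ (by omega) (tr _ _ ?_ ?_)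
    · rintro ⟨k, q⟩ h
      rw [mem_ES] at h
      exact ⟨h.1, h.2.1⟩
    · have := DT_E (N - 2) 1 true ((N : ℤ) - 1) (!tw) (by omega)
      simpa using this
  have D2 : DT G (p '' BS 2 false ((N : ℤ) - 1)) d := by
    refine DT.mono _ ((N - 2 + 1) / 2) _ (by omega) (tr _ _ ?_ ?_)
    · rintro ⟨k, q⟩ h
      rw [mem_BS] at h
      exact ⟨by simp only; omega, h.2.1⟩
    · exact DT_B (N - 2) 2 false ((N : ℤ) - 1) (by omega)
  have D3 : DT G (p '' ES 1 false (N : ℤ) (!tw)) (d + 1) := by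
    refine DT.mono _ (segVal (N - 1) tw) _ (by omega) ?_
    have := DT_E (N - 1) 1 false (N : ℤ) (!tw) (by omega)
    rw [show (false == !tw) = tw by cases tw <;> rfl] at this
    refine this.map p ?_ ?_
    · rintro ⟨i, r⟩ hi ⟨j, s⟩ hj h
      rw [mem_ES] at hi hj
      have := hinj i r j s (by omega) (by omega) h
      rw [this.1, this.2]
    · rintro ⟨i, r⟩ hi ⟨j, s⟩ hj
      rw [mem_ES] at hi hj
      rw [hadj, ladder_adj]
      simp only
      constructor
      · rintro (h | h | h)
        · by_cases hc : i = N ∧ j = 1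
          · obtain ⟨rfl, rfl⟩ := hc
            rw [hi.2.2.2 rfl, q3] at h
            have w := hinj _ _ _ _ (by omega) (by omega) h
            have w2 := hj.2.2.1 rfl
            exact absurd (w.2.symm.trans w2) (by simp)
          · have := hinj _ _ _ _ (by omega) (by omega) h
            left
            exact ⟨this.2.symm, Or.inl this.1⟩
        · by_cases hc : i = 1 ∧ j = N
          · obtain ⟨rfl, rfl⟩ := hc
            rw [hj.2.2.2 rfl, ← q2] at h
            have w := hinj _ _ _ _ (by omega) (by omega) h
            have w2 := hi.2.2.1 rfl
            exact absurd (w.2.trans w2) (by simp)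
          · have := hinj _ _ _ _ (by omega) (by omega) h
            left
            exact ⟨this.2.symm, Or.inr (by omega)⟩
        · have := hinj _ _ _ _ (by omega) (by omega) h
          right
          exact ⟨this.1.symm, by rw [this.2]; simp⟩
      · rintro (⟨rfl, rfl | rfl⟩ | ⟨rfl, h⟩)
        · left; rfl
        · right; left; congr 2; omega
        · right; right; congr 2; revert h; cases r <;> cases s <;> simp
  refine DT.branch (p (0, false)) _ _ _ d ⟨(0, false), by simp; omega, rfl⟩ rfl ?_
    (DT.branch (p (1, true)) _ _ _ d ?_ ?_ ?_ D3 D2) D1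
  · -- take (0, false)
    ext x
    constructor
    · rintro ⟨⟨k, q⟩, h, rfl⟩
      rw [mem_ES] at h
      refine ⟨⟨(k, q), ⟨by simp only; omega, by simp only; omega⟩, rfl⟩, ?_, ?_⟩
      · intro e
        have := hinj _ _ _ _ (by omega) (by omega) e
        omega
      · rw [hadj]
        rintro (e | e | e)
        · have w := hinj _ _ _ _ (by omega) (by omega) e
          have w2 := h.2.2.1 (by omega)
          exact absurd (w.2.symm.trans w2) (by simp)
        · rw [zero_sub, q1] at e
          have w := hinj _ _ _ _ (by omega) (by omega) e
          have w2 := h.2.2.2 w.1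
          exact absurd (w.2.symm.trans w2) (by simp)
        · have := hinj _ _ _ _ (by omega) (by omega) e
          omega
    · rintro ⟨⟨⟨k, q⟩, ⟨hk, hk'⟩, rfl⟩, hne, ha⟩
      simp only at hk hk'
      rw [hadj] at ha
      push Not at ha
      refine ⟨(k, q), ?_, rfl⟩
      rw [mem_ES]
      have k0 : k ≠ 0 := by
        rintro rfl
        cases q
        · exact hne rfl
        · exact ha.2.2 rfl
      refine ⟨by omega, by omega, ?_, ?_⟩
      · rintro rfl
        cases q
        · exact absurd rfl ha.1
        · rfl
      · rintro rfl
        by_contra hq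
        apply ha.2.1
        rw [zero_sub, q1]
        congr 2
        revert hq
        cases q <;> cases tw <;> simp
  · refine ⟨⟨(1, true), ⟨by simp, by simp; omega⟩, rfl⟩, ?_⟩
    intro e
    have := hinj _ _ _ _ (by omega) (by omega) e
    omega
  · -- drop (1, true)
    ext x
    constructor
    · rintro ⟨⟨k, q⟩, h, rfl⟩
      rw [mem_ES] at h
      by_cases hk : k = N
      · subst hk
        rw [h.2.2.2 rfl, ← q2]
        refine ⟨⟨⟨(0, true), ⟨by simp, by simp; omega⟩, rfl⟩, ?_⟩, ?_⟩
        · intro e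
          have := hinj _ _ _ _ (by omega) (by omega) e
          simp at this
        · intro e
          have := hinj _ _ _ _ (by omega) (by omega) e
          simp at this
      · refine ⟨⟨⟨(k, q), ⟨by simp only; omega, by simp only; omega⟩, rfl⟩, ?_⟩, ?_⟩
        · intro e
          have := hinj _ _ _ _ (by omega) (by omega) e
          omega
        · intro e
          have w := hinj _ _ _ _ (by omega) (by omega) e
          have w2 := h.2.2.1 w.1
          exact absurd (w.2.symm.trans w2) (by simp)
    · rintro ⟨⟨⟨⟨k, q⟩, ⟨hk, hk'⟩, rfl⟩, hne⟩, hne'⟩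
      simp only at hk hk'
      by_cases k0 : k = 0
      · subst k0
        cases q
        · exact absurd rfl hne
        · rw [q2]
          refine ⟨_, ?_, rfl⟩
          rw [mem_ES]
          refine ⟨by omega, by omega, by omega, by simp⟩
      · refine ⟨(k, q), ?_, rfl⟩
        rw [mem_ES]
        refine ⟨by omega, by omega, ?_, by omega⟩
        rintro rfl
        cases q
        · rfl
        · exact absurd rfl hne'
  · -- take (1, true)
    ext x
    constructor
    · rintro ⟨⟨k, q⟩, h, rfl⟩
      rw [mem_BS] at h
      refine ⟨⟨⟨(k, q), ⟨by simp only; omega, by simp only; omega⟩, rfl⟩, ?_⟩, ?_, ?_⟩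
      · intro e
        have := hinj _ _ _ _ (by omega) (by omega) e
        omega
      · intro e
        have := hinj _ _ _ _ (by omega) (by omega) e
        omega
      · rw [hadj]
        rintro (e | e | e)
        · have w := hinj _ _ _ _ (by omega) (by omega) e
          have w2 := h.2.2 (by omega)
          exact absurd (w.2.symm.trans w2) (by simp)
        · have := hinj _ _ _ _ (by omega) (by omega) e
          omega
        · have := hinj _ _ _ _ (by omega) (by omega) e
          omega
    · rintro ⟨⟨⟨⟨k, q⟩, ⟨hk, hk'⟩, rfl⟩, hne0⟩, hne, ha⟩
      simp only at hk hk'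
      rw [hadj] at ha
      push Not at ha
      refine ⟨(k, q), ?_, rfl⟩
      rw [mem_BS]
      have k0 : k ≠ 0 := by
        rintro rfl
        cases q
        · exact hne0 rfl
        · exact ha.2.1 rfl
      have k1 : k ≠ 1 := by
        rintro rfl
        cases q
        · exact ha.2.2 rfl
        · exact hne rfl
      refine ⟨by omega, by omega, ?_⟩
      rintro rfl
      cases q
      · rfl
      · exact absurd rfl ha.1

/-- Residue class as a vertex. -/
def cl (n : ℕ) (hn : 2 ≤ n) (x : ℤ) : Fin (2 * n) :=
  ⟨(x % ((2 * n : ℕ) : ℤ)).toNat, by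
    have := Int.emod_lt_of_pos x (show (0 : ℤ) < ((2 * n : ℕ) : ℤ) by omega)
    omega⟩

theorem cl_val (n : ℕ) (hn : 2 ≤ n) (x : ℤ) :
    (((cl n hn x : Fin (2 * n)) : ℕ) : ℤ) = x % ((2 * n : ℕ) : ℤ) := by
  have := Int.emod_nonneg x (show ((2 * n : ℕ) : ℤ) ≠ 0 by omega)
  simp only [cl]
  omega

theorem cl_eq_iff (n : ℕ) (hn : 2 ≤ n) (x y : ℤ) :
    cl n hn x = cl n hn y ↔ ((2 * n : ℕ) : ℤ) ∣ x - y := by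
  rw [Fin.ext_iff, ← Int.natCast_inj, cl_val, cl_val,
    Int.emod_eq_emod_iff_emod_sub_eq_zero, Int.dvd_iff_emod_eq_zero]

theorem cl_self (n : ℕ) (hn : 2 ≤ n) (v : Fin (2 * n)) : cl n hn ((v : ℕ) : ℤ) = v := by
  rw [Fin.ext_iff, ← Int.natCast_inj, cl_val]
  exact Int.emod_eq_of_lt (by omega) (by have := v.2; omega)

theorem circ_adj (n a : ℕ) (hn : 2 ≤ n) (ha : 1 ≤ a) (han : a < n) (x y : ℤ) :
    (circulantGraph (2 * n) ({a, n} : Set ℕ)).Adj (cl n hn x) (cl n hn y) ↔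
      (cl n hn y = cl n hn (x + a) ∨ cl n hn y = cl n hn (x - a) ∨
        cl n hn y = cl n hn (x + n)) := by
  have hx := cl_val n hn x
  have hy := cl_val n hn y
  have ex := Int.emod_add_mul_ediv x ((2 * n : ℕ) : ℤ)
  have ey := Int.emod_add_mul_ediv y ((2 * n : ℕ) : ℤ)
  rw [← hx] at ex
  rw [← hy] at ey
  have lx := (cl n hn x).2
  have ly := (cl n hn y).2
  have red : ∀ z : ℤ, cl n hn y = cl n hn (x + z) ↔ ∃ k : ℤ,
      (((cl n hn y : Fin (2 * n)) : ℕ) : ℤ) - ((cl n hn x : Fin (2 * n)) : ℕ) - z =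
        ((2 * n : ℕ) : ℤ) * k := by
    intro z
    rw [cl_eq_iff]
    constructor
    · rintro ⟨k, hk⟩
      exact ⟨k - y / ((2 * n : ℕ) : ℤ) + x / ((2 * n : ℕ) : ℤ), by linarith⟩
    · rintro ⟨k, hk⟩
      exact ⟨k + y / ((2 * n : ℕ) : ℤ) - x / ((2 * n : ℕ) : ℤ), by linarith⟩
  rw [sub_eq_add_neg, red, red, red]
  unfold circulantGraph
  rw [SimpleGraph.fromRel_adj]
  generalize cl n hn x = u at *
  generalize cl n hn y = v at *
  rw [ne_eq, Fin.ext_iff]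
  generalize (u : ℕ) = u at *
  generalize (v : ℕ) = v at *
  clear ex ey hx hy red
  simp only [Set.mem_insert_iff, Set.mem_singleton_iff]
  constructor
  · rintro ⟨hne, h⟩
    have : ((v : ℤ) - u - a = 0 ∨ (v : ℤ) - u - a = - (2 * n) ∨ (v : ℤ) - u + a = 0 ∨
      (v : ℤ) - u + a = 2 * n ∨ (v : ℤ) - u - n = 0 ∨ (v : ℤ) - u - n = -(2 * n)) := by omega
    rcases this with h | h | h | h | h | h
    · left; exact ⟨0, by omega⟩
    · left; exact ⟨-1, by push_cast; omega⟩
    · right; left; exact ⟨0, by omega⟩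
    · right; left; exact ⟨1, by push_cast; omega⟩
    · right; right; exact ⟨0, by omega⟩
    · right; right; exact ⟨-1, by push_cast; omega⟩
  · have bd : ∀ k z : ℤ, -(2 * n : ℤ) < z → z < 2 * n → (v : ℤ) - u - z = ((2 * n : ℕ) : ℤ) * k →
        k = -1 ∨ k = 0 ∨ k = 1 := by
      intro k z h1 h2 h
      push_cast at h
      have k1 : k < 2 := by
        by_contra hk
        nlinarith
      have k2 : -2 < k := by
        by_contra hk
        nlinarith
      omega
    rintro (⟨k, h⟩ | ⟨k, h⟩ | ⟨k, h⟩)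
    · rcases bd k _ (by omega) (by omega) h with rfl | rfl | rfl <;> push_cast at h <;>
        constructor <;> omega
    · rcases bd k _ (by omega) (by omega) h with rfl | rfl | rfl <;> push_cast at h <;>
        constructor <;> omega
    · rcases bd k _ (by omega) (by omega) h with rfl | rfl | rfl <;> push_cast at h <;>
        constructor <;> omega

/-- Ladder coordinates in the circulant graph. -/
def vtx (n a : ℕ) (hn : 2 ≤ n) (c : ℕ) (v : ℤ × Bool) : Fin (2 * n) :=
  cl n hn (c + v.1 * a + if v.2 then (n : ℤ) else 0)

theorem DT_circ (n a g N b d : ℕ) (hn : 2 ≤ n) (ha : 1 ≤ a) (han : a < n)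
    (hg : g = Nat.gcd n a) (hN : n = g * N) (hb : a = g * b)
    (h1 : d + 1 ≤ (N + 1) / 2) (h2 : d + 1 ≤ segVal (N - 2) (!(b % 2 == 1)) + 1)
    (h3 : d + 1 ≤ segVal (N - 1) (b % 2 == 1)) :
    DT (circulantGraph (2 * n) ({a, n} : Set ℕ)) Set.univ (g * (d + 1)) := by
  have hg0 : 0 < g := by rw [hg]; exact Nat.gcd_pos_of_pos_left _ (by omega)
  have hcop : Nat.Coprime N b := by
    have := Nat.coprime_div_gcd_div_gcd (m := n) (n := a) (by omega)
    rwa [← hg, hN, hb, Nat.mul_div_cancel_left _ hg0, Nat.mul_div_cancel_left _ hg0] at this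
  have hb0 : 0 < b := by
    rcases Nat.eq_zero_or_pos b with h | h
    · subst h; omega
    · exact h
  have hN2 : 2 ≤ N := by
    have : b < N := by
      by_contra hh
      have := Nat.mul_le_mul_left g (not_lt.1 hh)
      omega
    omega
  set tw : Bool := (b % 2 == 1) with htw
  have hcyc : ∀ c : ℕ, DT (circulantGraph (2 * n) ({a, n} : Set ℕ))
      (Set.range (vtx n a hn c)) (d + 1) := by
    intro c
    refine DT_cyc (vtx n a hn c) N hN2 tw ?_ ?_ ?_ d h1 h2 h3
    · intro i r
      rw [vtx, vtx, cl_eq_iff]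
      have e : (N : ℤ) * a = n * b := by rw [hN, hb]; push_cast; ring
      obtain ⟨k, hk⟩ : ∃ k : ℕ, b = 2 * k + (if tw then 1 else 0) := by
        refine ⟨b / 2, ?_⟩
        rw [htw]
        split_ifs with h <;> simp at h <;> omega
      have hk' : (b : ℤ) = 2 * k + (if tw then 1 else 0) := by rw [hk]; push_cast; rfl
      have e2 : (i + N) * (a : ℤ) = i * a + n * (2 * k + (if tw then 1 else 0)) := by
        rw [add_mul, e, hk']
      simp only [e2]
      cases r <;> cases tw <;> simp
      · exact ⟨k, by ring⟩
      · exact ⟨k, by ring⟩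
      · exact ⟨k, by ring⟩
      · exact ⟨k + 1, by ring⟩
    · intro i r j s hij hji h
      rw [vtx, vtx, cl_eq_iff] at h
      obtain ⟨k, hk⟩ := h
      simp only at hk
      have hd : (N : ℤ) ∣ (i - j) * b := by
        have hg0' : (g : ℤ) ≠ 0 := by exact_mod_cast hg0.ne'
        rw [← mul_dvd_mul_iff_left hg0']
        have : (g : ℤ) * ((i - j) * b) = (g * N : ℤ) * (2 * k - (if r then 1 else 0) +
            (if s then 1 else 0)) := by
          have e1 : (n : ℤ) = g * N := by rw [hN]; push_cast; ring
          have e2 : (a : ℤ) = g * b := by rw [hb]; push_cast; ring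
          push_cast at hk
          rw [e1, e2] at hk
          cases r <;> cases s <;> simp at hk ⊢ <;> linarith
        rw [this]
        exact Dvd.intro _ rfl
      have hd2 : (N : ℤ) ∣ i - j :=
        IsCoprime.dvd_of_dvd_mul_right (Nat.isCoprime_iff_coprime.2 hcop) hd
      have hij0 : i - j = 0 := by
        apply Int.eq_zero_of_abs_lt_dvd hd2
        rw [abs_lt]; omega
      have hij1 : i = j := by omega
      refine ⟨hij1, ?_⟩
      subst hij1
      push_cast at hk
      have hn0 : (n : ℤ) ≠ 0 := by omega
      cases r <;> cases s <;> simp at hk ⊢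
      · have : (n : ℤ) * (2 * k + 1) = 0 := by linarith
        rcases mul_eq_zero.1 this with h | h <;> omega
      · have : (n : ℤ) * (2 * k - 1) = 0 := by linarith
        rcases mul_eq_zero.1 this with h | h <;> omega
    · intro i r v
      obtain ⟨y, rfl⟩ : ∃ y, v = cl n hn y := ⟨_, (cl_self n hn v).symm⟩
      have r3 : vtx n a hn c (i, !r) = cl n hn ((c + i * a + if r then (n : ℤ) else 0) + n) := by
        rw [vtx, cl_eq_iff]
        cases r <;> simp
        exact ⟨-1, by ring⟩
      rw [r3, show vtx n a hn c (i, r) = cl n hn (c + i * a + if r then (n : ℤ) else 0) from rfl,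
        circ_adj n a hn ha han]
      simp only [vtx]
      rw [show (c : ℤ) + (i + 1) * a + (if r then (n : ℤ) else 0) =
        c + i * a + (if r then (n : ℤ) else 0) + a by ring,
        show (c : ℤ) + (i - 1) * a + (if r then (n : ℤ) else 0) =
        c + i * a + (if r then (n : ℤ) else 0) - a by ring]
  have gn : (g : ℤ) ∣ n := ⟨N, by rw [hN]; push_cast; ring⟩
  have ga : (g : ℤ) ∣ a := ⟨b, by rw [hb]; push_cast; ring⟩
  have g2n : (g : ℤ) ∣ ((2 * n : ℕ) : ℤ) := by
    push_cast; exact Dvd.dvd.mul_left gn 2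
  -- residue mod g of a labelled vertex
  have hres : ∀ (c : ℕ) (v : ℤ × Bool) (y : ℤ), vtx n a hn c v = cl n hn y →
      (g : ℤ) ∣ y - c := by
    intro c v y h
    rw [vtx, cl_eq_iff] at h
    have h := dvd_trans g2n h
    have h' : (g : ℤ) ∣ v.1 * a + (if v.2 then (n : ℤ) else 0) := by
      apply dvd_add (Dvd.dvd.mul_left ga _)
      split_ifs
      · exact gn
      · simp
    have w0 := dvd_sub h' h
    obtain ⟨k, hk⟩ := w0
    exact ⟨k, by rw [← hk]; ring⟩
  have hcc : ∀ c c' : ℕ, c < g → c' < g → (g : ℤ) ∣ (c : ℤ) - c' → c = c' := by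
    intro c c' hc hc' h
    have := Int.eq_zero_of_abs_lt_dvd h (by rw [abs_lt]; omega)
    omega
  have hun : ∀ m : ℕ, m ≤ g → DT (circulantGraph (2 * n) ({a, n} : Set ℕ))
      {v | ∃ c < m, v ∈ Set.range (vtx n a hn c)} (m * (d + 1)) := by
    intro m
    induction m with
    | zero =>
      intro _
      rw [zero_mul]
      exact DT.nil _ (by ext v; simp)
    | succ m ih =>
      intro hm
      have := (ih (by omega)).union (hcyc m) (by
        rw [Set.disjoint_left]
        rintro v ⟨c, hc, ⟨w, rfl⟩⟩ ⟨w', h⟩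
        have := hres m w' _ h
        have := hres c w _ rfl
        have h3 : (g : ℤ) ∣ (c : ℤ) - m := by
          have w0 := dvd_sub (hres m w' _ h) (hres c w _ rfl)
          obtain ⟨k, hk⟩ := w0
          exact ⟨k, by rw [← hk]; ring⟩
        have := hcc c m (by omega) (by omega) h3
        omega) (by
        rintro v ⟨c, hc, ⟨w, rfl⟩⟩ _ ⟨w', rfl⟩ h
        rw [vtx, vtx, circ_adj n a hn ha han] at h
        have h3 : (g : ℤ) ∣ (c : ℤ) - m := by
          have q := hres c w _ rfl
          rcases h with h | h | h
          · have w0 := dvd_sub (dvd_sub (hres m w' _ h) q) ga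
            obtain ⟨k, hk⟩ := w0
            exact ⟨k, by rw [← hk]; ring⟩
          · have w0 := dvd_add (dvd_sub (hres m w' _ h) q) ga
            obtain ⟨k, hk⟩ := w0
            exact ⟨k, by rw [← hk]; ring⟩
          · have w0 := dvd_sub (dvd_sub (hres m w' _ h) q) gn
            obtain ⟨k, hk⟩ := w0
            exact ⟨k, by rw [← hk]; ring⟩
        have := hcc c m (by omega) (by omega) h3
        omega)
      rw [add_mul, one_mul]
      convert this using 1
      ext v
      constructor
      · rintro ⟨c, hc, h⟩
        rcases Nat.lt_succ_iff_lt_or_eq.1 hc with h' | rfl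
        · exact Or.inl ⟨c, h', h⟩
        · exact Or.inr h
      · rintro (⟨c, hc, h⟩ | h)
        · exact ⟨c, by omega, h⟩
        · exact ⟨m, by omega, h⟩
  convert hun g le_rfl using 1
  symm
  rw [Set.eq_univ_iff_forall]
  intro v
  refine ⟨v % g, Nat.mod_lt _ hg0, ?_⟩
  have bez := Nat.gcd_eq_gcd_ab n a
  rw [← hg] at bez
  obtain ⟨w, hw⟩ : ∃ w : ℤ, w = (((v : ℕ) / g : ℕ) : ℤ) := ⟨_, rfl⟩
  have hv : ((v : ℕ) : ℤ) = ((v % g : ℕ) : ℤ) + g * w := by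
    have := Nat.mod_add_div (v : ℕ) g
    rw [hw]
    exact_mod_cast this.symm
  set y : ℤ := Nat.gcdA n a * w
  refine ⟨(Nat.gcdB n a * w, y % 2 == 1), ?_⟩
  refine Eq.trans ?_ (cl_self n hn v)
  rw [vtx, cl_eq_iff, hv]
  have hy : y = 2 * (y / 2) + (if (y % 2 == 1) = true then 1 else 0) := by
    split_ifs with h <;> simp at h <;> omega
  refine ⟨-(y / 2), ?_⟩
  have hy' : (n : ℤ) * y = 2 * n * (y / 2) + (if (y % 2 == 1) = true then (n : ℤ) else 0) := by
    conv_lhs => rw [hy]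
    split_ifs <;> ring
  have e3 : (g : ℤ) * w = n * y + a * (Nat.gcdB n a * w) := by
    rw [bez]; simp only [y]; ring
  push_cast
  rw [e3, hy']
  ring

theorem sdepth_circ (n a g N b d : ℕ) (hn : 2 ≤ n) (ha : 1 ≤ a) (han : a < n)
    (hg : g = Nat.gcd n a) (hN : n = g * N) (hb : a = g * b) (hd : 1 ≤ d)
    (h1 : d ≤ (N + 1) / 2) (h2 : d ≤ segVal (N - 2) (!(b % 2 == 1)) + 1)
    (h3 : d ≤ segVal (N - 1) (b % 2 == 1)) (K : Type*) [Field K] :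
    d * g ≤ sdepthQuot (edgeIdeal K (circulantGraph (2 * n) ({a, n} : Set ℕ))) := by
  obtain ⟨d, rfl⟩ : ∃ e, d = e + 1 := ⟨d - 1, by omega⟩
  obtain ⟨P, hP⟩ := (DT_circ n a g N b d hn ha han hg hN hb h1 h2 h3).exists_IP
  rw [mul_comm]
  exact le_sdepth_of_IP K _ hP

theorem ceil_half (x : ℚ) (k m : ℕ) (h : x = (k : ℚ) / 2) (hm : m = (k + 1) / 2) : ⌈x⌉₊ = m := by
  subst h hm
  apply le_antisymm
  · rw [Nat.ceil_le, div_le_iff₀ (by norm_num)]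
    have : k ≤ (k + 1) / 2 * 2 := by omega
    exact_mod_cast this
  · by_contra hh
    have hh := not_le.1 hh
    have h2 := Nat.le_ceil ((k : ℚ) / 2)
    generalize ⌈(k : ℚ) / 2⌉₊ = z at hh h2
    rw [div_le_iff₀ (by norm_num)] at h2
    have h2 : k ≤ z * 2 := by exact_mod_cast h2
    omega

end CubicAux

theorem sdepth_cubic_circulant (n a t : ℕ) (hn : 2 ≤ n) (ha1 : 1 ≤ a) (han : a < n)
    (ht : t = Nat.gcd (2 * n) a) (K : Type*) [Field K] :
    (Even (2 * n / t) →
      ((n / t) % 4 = 1 → sdepthQuot (edgeIdeal K (circulantGraph (2 * n) ({a, n} : Set ℕ))) ≥ ⌈(n : ℚ) / (2 * (t : ℚ))⌉₊ * t) ∧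
      ((n / t) % 4 ≠ 1 → sdepthQuot (edgeIdeal K (circulantGraph (2 * n) ({a, n} : Set ℕ))) ≥ ⌈((n : ℚ) - (t : ℚ)) / (2 * (t : ℚ))⌉₊ * t)) ∧
    (¬ Even (2 * n / t) →
      ((2 * n / t) % 4 = 1 → sdepthQuot (edgeIdeal K (circulantGraph (2 * n) ({a, n} : Set ℕ))) ≥ ⌈(2 * (n : ℚ) - (t : ℚ)) / (2 * (t : ℚ))⌉₊ * (t / 2)) ∧
      ((2 * n / t) % 4 = 3 → sdepthQuot (edgeIdeal K (circulantGraph (2 * n) ({a, n} : Set ℕ))) ≥ ⌈(n : ℚ) / (t : ℚ)⌉₊ * (t / 2))) := by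
  obtain ⟨g, hg⟩ : ∃ g, g = Nat.gcd n a := ⟨_, rfl⟩
  have hg0 : 0 < g := by rw [hg]; exact Nat.gcd_pos_of_pos_left _ (by omega)
  obtain ⟨N, hN⟩ : g ∣ n := hg ▸ Nat.gcd_dvd_left n a
  obtain ⟨b, hb⟩ : g ∣ a := hg ▸ Nat.gcd_dvd_right n a
  have hcop : Nat.Coprime N b := by
    have := Nat.coprime_div_gcd_div_gcd (m := n) (n := a) (by omega)
    rwa [← hg, hN, hb, Nat.mul_div_cancel_left _ hg0, Nat.mul_div_cancel_left _ hg0] at this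
  have hb0 : 0 < b := by
    rcases Nat.eq_zero_or_pos b with h | h
    · subst h; omega
    · exact h
  have hbN : b < N := by
    by_contra hh
    have := Nat.mul_le_mul_left g (not_lt.1 hh)
    omega
  have ht' : t = g * Nat.gcd (2 * N) b := by
    rw [ht, hN, hb, ← Nat.gcd_mul_left]
    congr 1
    ring
  have ht2 : t = g * Nat.gcd 2 b := by
    rw [ht', Nat.Coprime.gcd_mul_right_cancel _ hcop]
  have hgq : (g : ℚ) ≠ 0 := by exact_mod_cast hg0.ne'
  have hnq : (n : ℚ) = g * N := by rw [hN]; push_cast; ring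
  by_cases hbp : b % 2 = 1
  · -- Moebius case
    have htg : t = g := by
      rw [ht2, Nat.coprime_iff_gcd_eq_one.1 (Nat.coprime_two_left.2 (Nat.odd_iff.2 hbp)), mul_one]
    have e1 : 2 * n / t = 2 * N := by
      rw [htg, hN, show 2 * (g * N) = g * (2 * N) by ring, Nat.mul_div_cancel_left _ hg0]
    have e2 : n / t = N := by rw [htg, hN, Nat.mul_div_cancel_left _ hg0]
    rw [e1, e2]
    refine ⟨fun _ => ⟨fun hm => ?_, fun hm => ?_⟩, fun h => absurd (even_two_mul N) h⟩
    · rw [CubicAux.ceil_half _ N ((N + 1) / 2) (by rw [htg, hnq]; field_simp) rfl, htg]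
      refine CubicAux.sdepth_circ n a g N b _ hn ha1 han hg hN hb ?_ ?_ ?_ ?_ K <;>
        (try simp [CubicAux.segVal, hbp]) <;> omega
    · rw [CubicAux.ceil_half _ (N - 1) (N / 2) (by
        rw [htg, hnq, Nat.cast_sub (by omega)]; field_simp; push_cast; ring) (by omega), htg]
      refine CubicAux.sdepth_circ n a g N b _ hn ha1 han hg hN hb ?_ ?_ ?_ ?_ K <;>
        (try simp [CubicAux.segVal, hbp]) <;> omega
  · -- prism case
    have hbe : 2 ∣ b := by omega
    have hNo : N % 2 = 1 := by
      by_contra hh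
      have := Nat.dvd_gcd (show 2 ∣ N by omega) hbe
      rw [Nat.coprime_iff_gcd_eq_one.1 hcop] at this
      omega
    have htg : t = 2 * g := by
      rw [ht2, Nat.gcd_eq_left hbe, mul_comm]
    have htq : (t : ℚ) = 2 * g := by rw [htg]; push_cast; ring
    have e1 : 2 * n / t = N := by
      rw [htg, hN, show 2 * (g * N) = (2 * g) * N by ring, Nat.mul_div_cancel_left _ (by omega)]
    have e3 : t / 2 = g := by omega
    rw [e1, e3]
    refine ⟨fun h => absurd (Nat.even_iff.1 h) (by omega), fun _ => ⟨fun hm => ?_, fun hm => ?_⟩⟩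
    · rw [CubicAux.ceil_half _ (N - 1) (N / 2) (by
        rw [htq, hnq, Nat.cast_sub (by omega)]; field_simp; push_cast; ring) (by omega)]
      refine CubicAux.sdepth_circ n a g N b _ hn ha1 han hg hN hb ?_ ?_ ?_ ?_ K <;>
        (try simp [CubicAux.segVal, hbp]) <;> omega
    · rw [CubicAux.ceil_half _ N ((N + 1) / 2) (by rw [htq, hnq]; field_simp) rfl]
      refine CubicAux.sdepth_circ n a g N b _ hn ha1 han hg hN hb ?_ ?_ ?_ ?_ K <;>
        (try simp [CubicAux.segVal, hbp]) <;> omega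
end

section
/- Let n ≥ 2, let 1 ≤ a < n, let K be a field, and let S = K[V(C_{2n}(a,n))]. Then Stanley's inequality holds for the quotient ring of the edge ideal of the cubic circulant graph C_{2n}(a,n), that is, sdepth(S/I(C_{2n}(a,n))) ≥ depth(S/I(C_{2n}(a,n))). -/
open MvPolynomial

section Combi

variable {V : Type*}

/-- Vertex-splitting certificates for a lower bound. -/
inductive Low (G : SimpleGraph V) : Finset V → ℕ → Prop
  | empty : Low G ∅ 0
  | iso {W W' : Finset V} {v : V} {d : ℕ} (hv : v ∈ W) (h' : ∀ x, x ∈ W' ↔ x ∈ W ∧ x ≠ v)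
      (hi : ∀ x ∈ W, ¬ G.Adj v x) (h : Low G W' d) : Low G W (d + 1)
  | split {W W1 W2 : Finset V} {v : V} {d e : ℕ} (hv : v ∈ W)
      (h1 : ∀ x, x ∈ W1 ↔ x ∈ W ∧ x ≠ v) (h2 : ∀ x, x ∈ W2 ↔ x ∈ W ∧ x ≠ v ∧ ¬ G.Adj v x)
      (l1 : Low G W1 d) (l2 : Low G W2 e) (hde : d ≤ e + 1) : Low G W d

/-- Certificates for vanishing of all cohomology. -/
inductive Acy (G : SimpleGraph V) : Finset V → Prop
  | cone {W : Finset V} {v : V} (hv : v ∈ W) (hi : ∀ x ∈ W, ¬ G.Adj v x) : Acy G W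
  | split {W W1 W2 : Finset V} {v : V} (hv : v ∈ W)
      (h1 : ∀ x, x ∈ W1 ↔ x ∈ W ∧ x ≠ v) (h2 : ∀ x, x ∈ W2 ↔ x ∈ W ∧ x ≠ v ∧ ¬ G.Adj v x)
      (l1 : Acy G W1) (l2 : Acy G W2) : Acy G W

/-- Certificates for nonvanishing cohomology in a given degree. -/
inductive Nz (G : SimpleGraph V) : Finset V → ℕ → Prop
  | empty : Nz G ∅ 0
  | link {W W1 W2 : Finset V} {v : V} {d : ℕ} (hv : v ∈ W)
      (h1 : ∀ x, x ∈ W1 ↔ x ∈ W ∧ x ≠ v) (h2 : ∀ x, x ∈ W2 ↔ x ∈ W ∧ x ≠ v ∧ ¬ G.Adj v x)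
      (l1 : Low G W1 (d + 1)) (l2 : Nz G W2 d) : Nz G W (d + 1)
  | linkA {W W1 W2 : Finset V} {v : V} {d : ℕ} (hv : v ∈ W)
      (h1 : ∀ x, x ∈ W1 ↔ x ∈ W ∧ x ≠ v) (h2 : ∀ x, x ∈ W2 ↔ x ∈ W ∧ x ≠ v ∧ ¬ G.Adj v x)
      (l1 : Acy G W1) (l2 : Nz G W2 d) : Nz G W (d + 1)
  | del {W W1 W2 : Finset V} {v : V} {d : ℕ} (hv : v ∈ W)
      (h1 : ∀ x, x ∈ W1 ↔ x ∈ W ∧ x ≠ v) (h2 : ∀ x, x ∈ W2 ↔ x ∈ W ∧ x ≠ v ∧ ¬ G.Adj v x)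
      (l1 : Nz G W1 d) (l2 : Acy G W2) : Nz G W d

theorem low_zero [DecidableEq V] (G : SimpleGraph V) (W : Finset V) : Low G W 0 := by
  classical
  induction' hk : W.card using Nat.strong_induction_on with k ih generalizing W
  rcases W.eq_empty_or_nonempty with rfl | ⟨v, hv⟩
  · exact Low.empty
  · refine Low.split (W1 := W.erase v) (W2 := (W.erase v).filter (fun x => ¬ G.Adj v x)) hv
      (by intro x; simp [and_comm]) (by intro x; simp; tauto)
      (ih _ ?_ _ rfl) (ih _ ?_ _ rfl) (by omega)
    · rw [← hk]; exact Finset.card_erase_lt_of_mem hv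
    · rw [← hk]
      exact lt_of_le_of_lt (Finset.card_filter_le _ _) (Finset.card_erase_lt_of_mem hv)

theorem Low.mono [DecidableEq V] {G : SimpleGraph V} {W : Finset V} {d : ℕ} (h : Low G W d) :
    ∀ d', d' ≤ d → Low G W d' := by
  induction h with
  | empty => intro d' hd; obtain rfl : d' = 0 := by omega
             exact Low.empty
  | iso hv h' hi h ih =>
    intro d' hd
    rcases d' with _ | d'
    · exact low_zero _ _
    · exact Low.iso hv h' hi (ih d' (by omega))
  | split hv h1 h2 l1 l2 hde ih1 ih2 =>
    intro d' hd
    exact Low.split hv h1 h2 (ih1 d' hd) l2 (by omega)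

theorem Low.split' [DecidableEq V] {G : SimpleGraph V} {W W1 W2 : Finset V} {v : V} {d e c : ℕ}
    (hv : v ∈ W)
    (h1 : ∀ x, x ∈ W1 ↔ x ∈ W ∧ x ≠ v) (h2 : ∀ x, x ∈ W2 ↔ x ∈ W ∧ x ≠ v ∧ ¬ G.Adj v x)
    (l1 : Low G W1 d) (l2 : Low G W2 e) (hd : c ≤ d) (he : c ≤ e + 1) : Low G W c :=
  Low.split hv h1 h2 (l1.mono c hd) l2 he

theorem low_one [DecidableEq V] (G : SimpleGraph V) (W : Finset V) (hW : W.Nonempty) :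
    Low G W 1 := by
  classical
  induction' hk : W.card using Nat.strong_induction_on with k ih generalizing W
  obtain ⟨v, hv⟩ := hW
  rcases (W.erase v).eq_empty_or_nonempty with h | h
  · refine Low.iso (W' := W.erase v) hv (by intro x; simp [and_comm]) ?_ (low_zero _ _)
    intro x hx
    have : x = v := by
      by_contra hne
      have : x ∈ W.erase v := Finset.mem_erase.2 ⟨hne, hx⟩
      simp [h] at this
    subst this; exact G.irrefl
  · refine Low.split (W1 := W.erase v) (W2 := (W.erase v).filter (fun x => ¬ G.Adj v x)) hv
      (by intro x; simp [and_comm]) (by intro x; simp; tauto)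
      (ih _ ?_ _ h rfl) (low_zero _ _) (by omega)
    rw [← hk]; exact Finset.card_erase_lt_of_mem hv

/-- separated sets -/
def VSep (G : SimpleGraph V) (W X : Finset V) : Prop :=
  ∀ x ∈ W, ∀ y ∈ X, x ≠ y ∧ ¬ G.Adj x y

theorem Low.union [DecidableEq V] {G : SimpleGraph V} {W X : Finset V} {d e : ℕ}
    (h : Low G W d) (hX : Low G X e) (hs : VSep G W X) : Low G (W ∪ X) (d + e) := by
  induction h with
  | empty => simpa using hX
  | @iso W W' v d hv h' hi h ih =>
    have hs' : VSep G W' X := fun x hx y hy => hs x ((h' x).1 hx).1 y hy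
    have := Low.iso (W := W ∪ X) (v := v) (by simp [hv]) (W' := W' ∪ X) ?_ ?_ (ih hs')
    · convert this using 1; omega
    · intro x; have := hs v hv x; simp only [Finset.mem_union, h']; grind
    · intro x hx
      rcases Finset.mem_union.1 hx with hx | hx
      · exact hi x hx
      · exact (hs v hv x hx).2
  | @split W W1 W2 v d e hv h1 h2 l1 l2 hde ih1 ih2 =>
    have hs1 : VSep G W1 X := fun x hx y hy => hs x ((h1 x).1 hx).1 y hy
    have hs2 : VSep G W2 X := fun x hx y hy => hs x ((h2 x).1 hx).1 y hy
    refine Low.split (W := W ∪ X) (v := v) (by simp [hv]) (W1 := W1 ∪ X) (W2 := W2 ∪ X) ?_ ?_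
      (ih1 hs1) (ih2 hs2) (by omega)
    · intro x; have := hs v hv x; simp only [Finset.mem_union, h1]; grind
    · intro x; have := hs v hv x; simp only [Finset.mem_union, h2]; grind

theorem Acy.union [DecidableEq V] {G : SimpleGraph V} {W X : Finset V}
    (h : Acy G W) (hs : VSep G W X) : Acy G (W ∪ X) := by
  induction h with
  | @cone W v hv hi =>
    refine Acy.cone (v := v) (by simp [hv]) ?_
    intro x hx
    rcases Finset.mem_union.1 hx with hx | hx
    · exact hi x hx
    · exact (hs v hv x hx).2
  | @split W W1 W2 v hv h1 h2 l1 l2 ih1 ih2 =>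
    have hs1 : VSep G W1 X := fun x hx y hy => hs x ((h1 x).1 hx).1 y hy
    have hs2 : VSep G W2 X := fun x hx y hy => hs x ((h2 x).1 hx).1 y hy
    refine Acy.split (W := W ∪ X) (v := v) (by simp [hv]) (W1 := W1 ∪ X) (W2 := W2 ∪ X) ?_ ?_
      (ih1 hs1) (ih2 hs2)
    · intro x; have := hs v hv x; simp only [Finset.mem_union, h1]; grind
    · intro x; have := hs v hv x; simp only [Finset.mem_union, h2]; grind

theorem Nz.union [DecidableEq V] {G : SimpleGraph V} {W X : Finset V} {d e : ℕ}
    (h : Nz G W d) (hX : Nz G X e) (hX' : Low G X e) (hs : VSep G W X) :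
    Nz G (W ∪ X) (d + e) := by
  induction h with
  | empty => simpa using hX
  | @link W W1 W2 v d hv h1 h2 l1 l2 ih =>
    have hs1 : VSep G W1 X := fun x hx y hy => hs x ((h1 x).1 hx).1 y hy
    have hs2 : VSep G W2 X := fun x hx y hy => hs x ((h2 x).1 hx).1 y hy
    have := Nz.link (W := W ∪ X) (v := v) (by simp [hv]) (W1 := W1 ∪ X) (W2 := W2 ∪ X) ?_ ?_
      (d := d + e) (by convert l1.union hX' hs1 using 1; omega) (ih hs2)
    · convert this using 1; omega
    · intro x; have := hs v hv x; simp only [Finset.mem_union, h1]; grind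
    · intro x; have := hs v hv x; simp only [Finset.mem_union, h2]; grind
  | @linkA W W1 W2 v d hv h1 h2 l1 l2 ih =>
    have hs1 : VSep G W1 X := fun x hx y hy => hs x ((h1 x).1 hx).1 y hy
    have hs2 : VSep G W2 X := fun x hx y hy => hs x ((h2 x).1 hx).1 y hy
    have := Nz.linkA (W := W ∪ X) (v := v) (by simp [hv]) (W1 := W1 ∪ X) (W2 := W2 ∪ X) ?_ ?_
      (d := d + e) (l1.union hs1) (ih hs2)
    · convert this using 1; omega
    · intro x; have := hs v hv x; simp only [Finset.mem_union, h1]; grind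
    · intro x; have := hs v hv x; simp only [Finset.mem_union, h2]; grind
  | @del W W1 W2 v d hv h1 h2 l1 l2 ih =>
    have hs1 : VSep G W1 X := fun x hx y hy => hs x ((h1 x).1 hx).1 y hy
    have hs2 : VSep G W2 X := fun x hx y hy => hs x ((h2 x).1 hx).1 y hy
    refine Nz.del (W := W ∪ X) (v := v) (by simp [hv]) (W1 := W1 ∪ X) (W2 := W2 ∪ X) ?_ ?_
      (ih hs1) (l2.union hs2)
    · intro x; have := hs v hv x; simp only [Finset.mem_union, h1]; grind
    · intro x; have := hs v hv x; simp only [Finset.mem_union, h2]; grind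

/-- `φ` embeds the induced subgraph on `W`. -/
structure Emb {V' : Type*} (G : SimpleGraph V) (G' : SimpleGraph V') (φ : V → V')
    (W : Finset V) : Prop where
  inj : ∀ x ∈ W, ∀ y ∈ W, φ x = φ y → x = y
  adj : ∀ x ∈ W, ∀ y ∈ W, (G.Adj x y ↔ G'.Adj (φ x) (φ y))

theorem Emb.sub {V' : Type*} {G : SimpleGraph V} {G' : SimpleGraph V'} {φ : V → V'}
    {W W' : Finset V} (h : Emb G G' φ W) (hW : ∀ x ∈ W', x ∈ W) : Emb G G' φ W' :=
  ⟨fun x hx y hy => h.inj x (hW x hx) y (hW y hy), fun x hx y hy => h.adj x (hW x hx) y (hW y hy)⟩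

theorem Emb.image1 {V' : Type*} [DecidableEq V'] {G : SimpleGraph V} {G' : SimpleGraph V'}
    {φ : V → V'} {W W1 : Finset V} {v : V} (h : Emb G G' φ W) (hv : v ∈ W)
    (h1 : ∀ x, x ∈ W1 ↔ x ∈ W ∧ x ≠ v) (y : V') :
    y ∈ W1.image φ ↔ y ∈ W.image φ ∧ y ≠ φ v := by
  simp only [Finset.mem_image, h1]
  constructor
  · rintro ⟨x, ⟨hx, hne⟩, rfl⟩
    exact ⟨⟨x, hx, rfl⟩, fun he => hne (h.inj x hx v hv he)⟩
  · rintro ⟨⟨x, hx, rfl⟩, hne⟩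
    exact ⟨x, ⟨hx, fun he => hne (by rw [he])⟩, rfl⟩

theorem Emb.image2 {V' : Type*} [DecidableEq V'] {G : SimpleGraph V} {G' : SimpleGraph V'}
    {φ : V → V'} {W W1 : Finset V} {v : V} (h : Emb G G' φ W) (hv : v ∈ W)
    (h1 : ∀ x, x ∈ W1 ↔ x ∈ W ∧ x ≠ v ∧ ¬ G.Adj v x) (y : V') :
    y ∈ W1.image φ ↔ y ∈ W.image φ ∧ y ≠ φ v ∧ ¬ G'.Adj (φ v) y := by
  simp only [Finset.mem_image, h1]
  constructor
  · rintro ⟨x, ⟨hx, hne, ha⟩, rfl⟩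
    exact ⟨⟨x, hx, rfl⟩, fun he => hne (h.inj x hx v hv he), fun h' => ha ((h.adj v hv x hx).2 h')⟩
  · rintro ⟨⟨x, hx, rfl⟩, hne, ha⟩
    exact ⟨x, ⟨hx, fun he => hne (by rw [he]), fun h' => ha ((h.adj v hv x hx).1 h')⟩, rfl⟩

theorem Emb.image3 {V' : Type*} [DecidableEq V'] {G : SimpleGraph V} {G' : SimpleGraph V'}
    {φ : V → V'} {W : Finset V} {v : V} (h : Emb G G' φ W) (hv : v ∈ W)
    (hi : ∀ x ∈ W, ¬ G.Adj v x) : ∀ y ∈ W.image φ, ¬ G'.Adj (φ v) y := by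
  intro y hy
  obtain ⟨x, hx, rfl⟩ := Finset.mem_image.1 hy
  exact fun h' => hi x hx ((h.adj v hv x hx).2 h')

theorem Low.map {V' : Type*} [DecidableEq V'] {G : SimpleGraph V} {G' : SimpleGraph V'}
    {φ : V → V'} {W : Finset V} {d : ℕ} (h : Low G W d) (he : Emb G G' φ W) :
    Low G' (W.image φ) d := by
  induction h with
  | empty => simpa using Low.empty
  | iso hv h' hi h ih =>
    exact Low.iso (Finset.mem_image_of_mem φ hv) (he.image1 hv h') (he.image3 hv hi)
      (ih (he.sub fun x hx => ((h' x).1 hx).1))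
  | split hv h1 h2 l1 l2 hde ih1 ih2 =>
    exact Low.split (Finset.mem_image_of_mem φ hv) (he.image1 hv h1) (he.image2 hv h2)
      (ih1 (he.sub fun x hx => ((h1 x).1 hx).1)) (ih2 (he.sub fun x hx => ((h2 x).1 hx).1)) hde

theorem Acy.map {V' : Type*} [DecidableEq V'] {G : SimpleGraph V} {G' : SimpleGraph V'}
    {φ : V → V'} {W : Finset V} (h : Acy G W) (he : Emb G G' φ W) :
    Acy G' (W.image φ) := by
  induction h with
  | cone hv hi =>
    exact Acy.cone (Finset.mem_image_of_mem φ hv) (he.image3 hv hi)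
  | split hv h1 h2 l1 l2 ih1 ih2 =>
    exact Acy.split (Finset.mem_image_of_mem φ hv) (he.image1 hv h1) (he.image2 hv h2)
      (ih1 (he.sub fun x hx => ((h1 x).1 hx).1)) (ih2 (he.sub fun x hx => ((h2 x).1 hx).1))

theorem Nz.map {V' : Type*} [DecidableEq V'] {G : SimpleGraph V} {G' : SimpleGraph V'}
    {φ : V → V'} {W : Finset V} {d : ℕ} (h : Nz G W d) (he : Emb G G' φ W) :
    Nz G' (W.image φ) d := by
  induction h with
  | empty => simpa using Nz.empty
  | link hv h1 h2 l1 l2 ih =>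
    exact Nz.link (Finset.mem_image_of_mem φ hv) (he.image1 hv h1) (he.image2 hv h2)
      (l1.map (he.sub fun x hx => ((h1 x).1 hx).1)) (ih (he.sub fun x hx => ((h2 x).1 hx).1))
  | linkA hv h1 h2 l1 l2 ih =>
    exact Nz.linkA (Finset.mem_image_of_mem φ hv) (he.image1 hv h1) (he.image2 hv h2)
      (l1.map (he.sub fun x hx => ((h1 x).1 hx).1)) (ih (he.sub fun x hx => ((h2 x).1 hx).1))
  | del hv h1 h2 l1 l2 ih =>
    exact Nz.del (Finset.mem_image_of_mem φ hv) (he.image1 hv h1) (he.image2 hv h2)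
      (ih (he.sub fun x hx => ((h1 x).1 hx).1)) (l2.map (he.sub fun x hx => ((h2 x).1 hx).1))

/-- leaf rules -/
theorem Low.leaf [DecidableEq V] {G : SimpleGraph V} {W W1 W2 : Finset V} {l w : V} {d : ℕ}
    (hl : l ∈ W) (hw : w ∈ W) (hlw : l ≠ w)
    (hN : ∀ x ∈ W, G.Adj l x → x = w)
    (h1 : ∀ x, x ∈ W1 ↔ x ∈ W ∧ x ≠ w ∧ x ≠ l)
    (h2 : ∀ x, x ∈ W2 ↔ x ∈ W ∧ x ≠ w ∧ ¬ G.Adj w x)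
    (l1 : Low G W1 d) (l2 : Low G W2 d) : Low G W (d + 1) := by
  refine Low.split (W1 := W.erase w) (W2 := W2) hw (by intro x; simp [and_comm]) h2 ?_ l2 le_rfl
  refine Low.iso (v := l) (W' := W1) (by simp [hl, hlw]) ?_ ?_ l1
  · intro x; rw [h1]; simp; tauto
  · intro x hx ha
    simp only [Finset.mem_erase] at hx
    exact hx.1 (hN x hx.2 ha)

theorem acy_del_leaf [DecidableEq V] {G : SimpleGraph V} {W : Finset V} {l w : V}
    (hl : l ∈ W) (hlw : l ≠ w)
    (hN : ∀ x ∈ W, G.Adj l x → x = w) : Acy G (W.erase w) := by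
  refine Acy.cone (v := l) (by simp [hl, hlw]) ?_
  intro x hx ha
  simp only [Finset.mem_erase] at hx
  exact hx.1 (hN x hx.2 ha)

theorem Nz.leaf [DecidableEq V] {G : SimpleGraph V} {W W2 : Finset V} {l w : V} {d : ℕ}
    (hl : l ∈ W) (hw : w ∈ W) (hlw : l ≠ w)
    (hN : ∀ x ∈ W, G.Adj l x → x = w)
    (h2 : ∀ x, x ∈ W2 ↔ x ∈ W ∧ x ≠ w ∧ ¬ G.Adj w x)
    (l2 : Nz G W2 d) : Nz G W (d + 1) :=
  Nz.linkA (W1 := W.erase w) (W2 := W2) hw (by intro x; simp [and_comm]) h2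
    (acy_del_leaf hl hlw hN) l2

theorem Acy.leaf [DecidableEq V] {G : SimpleGraph V} {W W2 : Finset V} {l w : V}
    (hl : l ∈ W) (hw : w ∈ W) (hlw : l ≠ w)
    (hN : ∀ x ∈ W, G.Adj l x → x = w)
    (h2 : ∀ x, x ∈ W2 ↔ x ∈ W ∧ x ≠ w ∧ ¬ G.Adj w x)
    (l2 : Acy G W2) : Acy G W :=
  Acy.split (W1 := W.erase w) (W2 := W2) hw (by intro x; simp [and_comm]) h2
    (acy_del_leaf hl hlw hN) l2

end Combi

section Ladder

/-- The infinite ladder. -/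
def ladder : SimpleGraph (ℕ × Bool) where
  Adj x y := (x.1 = y.1 ∧ x.2 ≠ y.2) ∨ (x.2 = y.2 ∧ (x.1 = y.1 + 1 ∨ y.1 = x.1 + 1))
  symm := ⟨by intro x y; grind⟩
  loopless := ⟨by intro x; simp⟩

theorem ladder_adj (x y : ℕ × Bool) : ladder.Adj x y ↔
    (x.1 = y.1 ∧ x.2 ≠ y.2) ∨ (x.2 = y.2 ∧ (x.1 = y.1 + 1 ∨ y.1 = x.1 + 1)) := Iff.rfl

/-- full columns `l+1..l+n` -/
def pieceA (l n : ℕ) : Finset (ℕ × Bool) := Finset.Icc (l + 1) (l + n) ×ˢ Finset.univ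

def pieceB (l n : ℕ) (a : Bool) : Finset (ℕ × Bool) := insert (l, a) (pieceA l n)

def pieceE (n : ℕ) (a b : Bool) : Finset (ℕ × Bool) := insert (n + 1, b) (pieceB 0 n a)

theorem mem_pieceA (l n : ℕ) (x : ℕ × Bool) : x ∈ pieceA l n ↔ l + 1 ≤ x.1 ∧ x.1 ≤ l + n := by
  simp [pieceA]

theorem mem_pieceB (l n : ℕ) (a : Bool) (x : ℕ × Bool) :
    x ∈ pieceB l n a ↔ (x.1 = l ∧ x.2 = a) ∨ l + 1 ≤ x.1 ∧ x.1 ≤ l + n := by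
  simp [pieceB, mem_pieceA, Prod.ext_iff]

theorem mem_pieceE (n : ℕ) (a b : Bool) (x : ℕ × Bool) :
    x ∈ pieceE n a b ↔ (x.1 = n + 1 ∧ x.2 = b) ∨ (x.1 = 0 ∧ x.2 = a) ∨ 1 ≤ x.1 ∧ x.1 ≤ n := by
  simp [pieceE, mem_pieceB, Prod.ext_iff]

theorem low_pieceB (n : ℕ) : ∀ l a, Low ladder (pieceB l n a) (n / 2 + 1) := by
  induction' n using Nat.strong_induction_on with n ih
  intro l a
  rcases n with _ | _ | n
  · exact low_one _ _ ⟨(l, a), by simp [mem_pieceB]⟩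
  · exact low_one _ _ ⟨(l, a), by simp [mem_pieceB]⟩
  · have e : (n + 1 + 1) / 2 + 1 = (n / 2 + 1) + 1 := by omega
    rw [e]
    refine Low.leaf (l := (l, a)) (w := (l + 1, a)) (W1 := pieceB (l + 1) (n + 1) (!a))
      (W2 := pieceB (l + 2) n (!a)) ?_ ?_ ?_ ?_ ?_ ?_
      ((ih (n + 1) (by omega) _ _).mono _ (by omega)) (ih n (by omega) _ _)
    · simp [mem_pieceB]
    · simp [mem_pieceB]
    · simp
    · rintro ⟨i, r⟩; simp only [mem_pieceB, ladder_adj, Prod.mk.injEq]; (try clear ih); (try clear i1 i2); (try clear hiff); (try clear e); (try clear e'); (try cases a) <;> (try cases b) <;> cases r <;> grind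
    · rintro ⟨i, r⟩; simp only [mem_pieceB, ne_eq, Prod.mk.injEq]; (try clear ih); (try clear i1 i2); (try clear hiff); (try clear e); (try clear e'); (try cases a) <;> (try cases b) <;> cases r <;> grind
    · rintro ⟨i, r⟩; simp only [mem_pieceB, ladder_adj, ne_eq, Prod.mk.injEq]; (try clear ih); (try clear i1 i2); (try clear hiff); (try clear e); (try clear e'); (try cases a) <;> (try cases b) <;> cases r <;> grind

theorem nz_pieceA (n : ℕ) : ∀ l, Nz ladder (pieceA l n) ((n + 1) / 2) := by
  induction' n using Nat.strong_induction_on with n ih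
  intro l
  rcases n with _ | _ | n
  · have : pieceA l 0 = ∅ := by ext ⟨i, r⟩; simp [mem_pieceA]
    rw [this]; exact Nz.empty
  · refine Nz.leaf (l := (l + 1, true)) (w := (l + 1, false)) (W2 := ∅) ?_ ?_ ?_ ?_ ?_ Nz.empty
    · simp [mem_pieceA]
    · simp [mem_pieceA]
    · simp
    · rintro ⟨i, r⟩; simp only [mem_pieceA, ladder_adj, Prod.mk.injEq]; (try clear ih); (try clear i1 i2); (try clear hiff); (try clear e); (try clear e'); (try cases a) <;> (try cases b) <;> cases r <;> grind
    · rintro ⟨i, r⟩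
      simp only [mem_pieceA, ladder_adj, ne_eq, Prod.mk.injEq, Finset.notMem_empty]; (try clear ih); (try clear i1 i2); (try clear hiff); (try clear e); (try clear e'); (try cases a) <;> (try cases b) <;> cases r <;> grind
  · have e : (n + 1 + 1 + 1) / 2 = ((n + 1) / 2) + 1 := by omega
    rw [e]
    refine Nz.del (v := (l + 2, true)) (W1 := (pieceA l (n + 2)).erase (l + 2, true))
      (W2 := ((pieceA l (n + 2)).filter fun x => x ≠ (l + 2, true) ∧
        ¬ ((l + 2 = x.1 ∧ true ≠ x.2) ∨ (true = x.2 ∧ (l + 2 = x.1 + 1 ∨ x.1 = l + 2 + 1)))))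
      ?_ ?_ ?_ ?_ ?_
    · simp [mem_pieceA]
    · intro x; simp [and_comm]
    · intro x; simp only [Finset.mem_filter, ladder_adj]
    · refine Nz.leaf (l := (l + 1, true)) (w := (l + 1, false)) (W2 := pieceA (l + 2) n)
        ?_ ?_ ?_ ?_ ?_ (ih n (by omega) _)
      · simp [mem_pieceA]
      · simp [mem_pieceA]
      · simp
      · rintro ⟨i, r⟩
        simp only [mem_pieceA, ladder_adj, Prod.mk.injEq, Finset.mem_erase, ne_eq]; (try clear ih); (try clear i1 i2); (try clear hiff); (try clear e); (try clear e'); (try cases a) <;> (try cases b) <;> cases r <;> grind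
      · rintro ⟨i, r⟩
        simp only [mem_pieceA, ladder_adj, ne_eq, Prod.mk.injEq, Finset.mem_erase]; (try clear ih); (try clear i1 i2); (try clear hiff); (try clear e); (try clear e'); (try cases a) <;> (try cases b) <;> cases r <;> grind
    · refine Acy.cone (v := (l + 1, false)) ?_ ?_
      · simp [mem_pieceA]
      · rintro ⟨i, r⟩
        simp only [mem_pieceA, ladder_adj, ne_eq, Prod.mk.injEq, Finset.mem_filter]; (try clear ih); (try clear i1 i2); (try clear hiff); (try clear e); (try clear e'); (try cases a) <;> (try cases b) <;> cases r <;> grind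

/-- value for the pieces with two pendants -/
def loE (n : ℕ) (s : Bool) : ℕ := if s then 2 * (n / 4) + 2 else 2 * ((n + 2) / 4) + 1

theorem low_pieceE (n : ℕ) : ∀ a b, Low ladder (pieceE n a b) (loE n (a ^^ b)) := by
  induction' n using Nat.strong_induction_on with n ih
  intro a b
  have ex : (a ^^ !b) = !(a ^^ b) := by simp
  rcases n with _ | _ | n
  · by_cases hab : a = b
    · subst hab
      have : loE 0 (a ^^ a) = 1 := by simp [loE]
      rw [this]
      exact low_one _ _ ⟨(0, a), by simp [mem_pieceE]⟩
    · have : loE 0 (a ^^ b) = 1 + 1 := by cases a <;> cases b <;> simp_all [loE]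
      rw [this]
      refine Low.iso (v := (0, a)) (W' := {(1, b)}) ?_ ?_ ?_ (low_one _ _ (by simp))
      · simp [mem_pieceE]
      · rintro ⟨i, r⟩; simp only [mem_pieceE, ne_eq, Prod.mk.injEq, Finset.mem_singleton]; (try clear ih); (try clear i1 i2); (try clear hiff); (try clear e); (try clear e'); (try cases a) <;> (try cases b) <;> cases r <;> grind
      · rintro ⟨i, r⟩; simp only [mem_pieceE, ladder_adj]; (try clear ih); (try clear i1 i2); (try clear hiff); (try clear e); (try clear e'); (try cases a) <;> (try cases b) <;> cases r <;> grind
  · by_cases hab : a = b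
    · subst hab
      have : loE (0 + 1) (a ^^ a) = 1 := by simp [loE]
      rw [this]
      exact low_one _ _ ⟨(0, a), by simp [mem_pieceE]⟩
    · have : loE (0 + 1) (a ^^ b) = 1 + 1 := by cases a <;> cases b <;> simp_all [loE]
      rw [this]
      refine Low.leaf (l := (2, b)) (w := (1, b)) (W1 := {(0, a), (1, a)}) (W2 := {(0, a)})
        ?_ ?_ ?_ ?_ ?_ ?_ (low_one _ _ (by simp)) (low_one _ _ (by simp))
      · simp [mem_pieceE]
      · simp [mem_pieceE]
      · simp
      · rintro ⟨i, r⟩; simp only [mem_pieceE, ladder_adj, Prod.mk.injEq]; (try clear ih); (try clear i1 i2); (try clear hiff); (try clear e); (try clear e'); (try cases a) <;> (try cases b) <;> cases r <;> grind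
      · rintro ⟨i, r⟩
        simp only [mem_pieceE, ne_eq, Prod.mk.injEq, Finset.mem_singleton, Finset.mem_insert]; (try clear ih); (try clear i1 i2); (try clear hiff); (try clear e); (try clear e'); (try cases a) <;> (try cases b) <;> cases r <;> grind
      · rintro ⟨i, r⟩
        simp only [mem_pieceE, ladder_adj, ne_eq, Prod.mk.injEq, Finset.mem_singleton]; (try clear ih); (try clear i1 i2); (try clear hiff); (try clear e); (try clear e'); (try cases a) <;> (try cases b) <;> cases r <;> grind
  · have e : loE (n + 1 + 1) (a ^^ b) = loE n (!(a ^^ b)) + 1 := by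
      cases (a ^^ b) <;> simp [loE] <;> omega
    have e' : loE n (!(a ^^ b)) ≤ loE (n + 1) (!(a ^^ b)) := by
      cases (a ^^ b) <;> simp [loE] <;> omega
    rw [e]
    refine Low.leaf (l := (n + 3, b)) (w := (n + 2, b)) (W1 := pieceE (n + 1) a (!b))
      (W2 := pieceE n a (!b)) ?_ ?_ ?_ ?_ ?_ ?_
      ((ih (n + 1) (by omega) a (!b)).mono _ (by rw [ex]; exact e'))
      (by rw [← ex]; exact ih n (by omega) _ _)
    · simp [mem_pieceE]
    · simp [mem_pieceE]
    · simp
    · rintro ⟨i, r⟩; simp only [mem_pieceE, ladder_adj, Prod.mk.injEq]; (try clear ih); (try clear i1 i2); (try clear hiff); (try clear e); (try clear e'); (try cases a) <;> (try cases b) <;> cases r <;> grind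
    · rintro ⟨i, r⟩; simp only [mem_pieceE, ne_eq, Prod.mk.injEq]; (try clear ih); (try clear i1 i2); (try clear hiff); (try clear e); (try clear e'); (try cases a) <;> (try cases b) <;> cases r <;> grind
    · rintro ⟨i, r⟩; simp only [mem_pieceE, ladder_adj, ne_eq, Prod.mk.injEq]; (try clear ih); (try clear i1 i2); (try clear hiff); (try clear e); (try clear e'); (try cases a) <;> (try cases b) <;> cases r <;> grind

theorem nz_acy_pieceE (n : ℕ) : ∀ a b,
    ((n % 4 ≤ 1 ↔ (a ^^ b) = false) → Nz ladder (pieceE n a b) (loE n (a ^^ b))) ∧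
    (¬ (n % 4 ≤ 1 ↔ (a ^^ b) = false) → Acy ladder (pieceE n a b)) := by
  induction' n using Nat.strong_induction_on with n ih
  intro a b
  have ex : (a ^^ !b) = !(a ^^ b) := by simp
  rcases n with _ | _ | n
  · constructor
    · intro h
      have hab : a = b := by cases a <;> cases b <;> simp_all
      subst hab
      have : loE 0 (a ^^ a) = 0 + 1 := by simp [loE]
      rw [this]
      refine Nz.leaf (l := (1, a)) (w := (0, a)) (W2 := ∅) ?_ ?_ ?_ ?_ ?_ Nz.empty
      · simp [mem_pieceE]
      · simp [mem_pieceE]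
      · simp
      · rintro ⟨i, r⟩; simp only [mem_pieceE, ladder_adj, Prod.mk.injEq]; (try clear ih); (try clear i1 i2); (try clear hiff); (try clear e); (try clear e'); (try cases a) <;> (try cases b) <;> cases r <;> grind
      · rintro ⟨i, r⟩
        simp only [mem_pieceE, ladder_adj, ne_eq, Prod.mk.injEq, Finset.notMem_empty]; (try clear ih); (try clear i1 i2); (try clear hiff); (try clear e); (try clear e'); (try cases a) <;> (try cases b) <;> cases r <;> grind
    · intro h
      have hab : a ≠ b := by rintro rfl; simp at h
      refine Acy.cone (v := (0, a)) ?_ ?_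
      · simp [mem_pieceE]
      · rintro ⟨i, r⟩; simp only [mem_pieceE, ladder_adj]; (try clear ih); (try clear i1 i2); (try clear hiff); (try clear e); (try clear e'); (try cases a) <;> (try cases b) <;> cases r <;> grind
  · constructor
    · intro h
      have hab : a = b := by cases a <;> cases b <;> simp_all
      subst hab
      have : loE (0 + 1) (a ^^ a) = 0 + 1 := by simp [loE]
      rw [this]
      refine Nz.leaf (l := (2, a)) (w := (1, a)) (W2 := ∅) ?_ ?_ ?_ ?_ ?_ Nz.empty
      · simp [mem_pieceE]
      · simp [mem_pieceE]
      · simp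
      · rintro ⟨i, r⟩; simp only [mem_pieceE, ladder_adj, Prod.mk.injEq]; (try clear ih); (try clear i1 i2); (try clear hiff); (try clear e); (try clear e'); (try cases a) <;> (try cases b) <;> cases r <;> grind
      · rintro ⟨i, r⟩
        simp only [mem_pieceE, ladder_adj, ne_eq, Prod.mk.injEq, Finset.notMem_empty]; (try clear ih); (try clear i1 i2); (try clear hiff); (try clear e); (try clear e'); (try cases a) <;> (try cases b) <;> cases r <;> grind
    · intro h
      have hab : a ≠ b := by rintro rfl; simp at h
      refine Acy.leaf (l := (2, b)) (w := (1, b)) (W2 := {(0, a)}) ?_ ?_ ?_ ?_ ?_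
        (Acy.cone (v := (0, a)) (by simp) (by simp))
      · simp [mem_pieceE]
      · simp [mem_pieceE]
      · simp
      · rintro ⟨i, r⟩; simp only [mem_pieceE, ladder_adj, Prod.mk.injEq]; (try clear ih); (try clear i1 i2); (try clear hiff); (try clear e); (try clear e'); (try cases a) <;> (try cases b) <;> cases r <;> grind
      · rintro ⟨i, r⟩
        simp only [mem_pieceE, ladder_adj, ne_eq, Prod.mk.injEq, Finset.mem_singleton]; (try clear ih); (try clear i1 i2); (try clear hiff); (try clear e); (try clear e'); (try cases a) <;> (try cases b) <;> cases r <;> grind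
  · have e : loE (n + 1 + 1) (a ^^ b) = loE n (a ^^ !b) + 1 := by
      rw [ex]; cases (a ^^ b) <;> simp [loE] <;> omega
    have hiff : (((n + 1 + 1) % 4 ≤ 1) ↔ (a ^^ b) = false) ↔ (n % 4 ≤ 1 ↔ (a ^^ !b) = false) := by
      have : ((n + 1 + 1) % 4 ≤ 1) ↔ ¬ (n % 4 ≤ 1) := by omega
      rw [this, ex]; cases (a ^^ b) <;> simp
    obtain ⟨i1, i2⟩ := ih n (by omega) a (!b)
    constructor
    · intro h
      rw [e]
      refine Nz.leaf (l := (n + 3, b)) (w := (n + 2, b)) 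
        (W2 := pieceE n a (!b)) ?_ ?_ ?_ ?_ ?_ (i1 (hiff.1 h))
      · simp [mem_pieceE]
      · simp [mem_pieceE]
      · simp
      · rintro ⟨i, r⟩; simp only [mem_pieceE, ladder_adj, Prod.mk.injEq]; (try clear ih); (try clear i1 i2); (try clear hiff); (try clear e); (try clear e'); (try cases a) <;> (try cases b) <;> cases r <;> grind
      · rintro ⟨i, r⟩; simp only [mem_pieceE, ladder_adj, ne_eq, Prod.mk.injEq]; (try clear ih); (try clear i1 i2); (try clear hiff); (try clear e); (try clear e'); (try cases a) <;> (try cases b) <;> cases r <;> grind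
    · intro h
      refine Acy.leaf (l := (n + 3, b)) (w := (n + 2, b)) 
        (W2 := pieceE n a (!b)) ?_ ?_ ?_ ?_ ?_ (i2 (fun h' => h (hiff.2 h')))
      · simp [mem_pieceE]
      · simp [mem_pieceE]
      · simp
      · rintro ⟨i, r⟩; simp only [mem_pieceE, ladder_adj, Prod.mk.injEq]; (try clear ih); (try clear i1 i2); (try clear hiff); (try clear e); (try clear e'); (try cases a) <;> (try cases b) <;> cases r <;> grind
      · rintro ⟨i, r⟩; simp only [mem_pieceE, ladder_adj, ne_eq, Prod.mk.injEq]; (try clear ih); (try clear i1 i2); (try clear hiff); (try clear e); (try clear e'); (try cases a) <;> (try cases b) <;> cases r <;> grind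

end Ladder

section Circ

/-- The circular (or Moebius) ladder with `N` columns, on columns `0..N-1`. -/
def circ (N : ℕ) (t : Bool) : SimpleGraph (ℕ × Bool) where
  Adj x y := x ≠ y ∧ (ladder.Adj x y ∨ (x.1 + 1 = y.1 + N ∧ x.2 = (y.2 ^^ t)) ∨
    (y.1 + 1 = x.1 + N ∧ y.2 = (x.2 ^^ t)))
  symm := ⟨by intro x y; rw [ladder.adj_comm]; rintro ⟨h, h'⟩; exact ⟨h.symm, by tauto⟩⟩
  loopless := ⟨by intro x; simp⟩

theorem circ_adj (N : ℕ) (t : Bool) (x y : ℕ × Bool) : (circ N t).Adj x y ↔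
    x ≠ y ∧ (((x.1 = y.1 ∧ x.2 ≠ y.2) ∨ (x.2 = y.2 ∧ (x.1 = y.1 + 1 ∨ y.1 = x.1 + 1))) ∨
      (x.1 + 1 = y.1 + N ∧ x.2 = (y.2 ^^ t)) ∨
    (y.1 + 1 = x.1 + N ∧ y.2 = (x.2 ^^ t))) := Iff.rfl

theorem image_eq_of {A B : Type*} [DecidableEq B] {X : Finset A} {W : Finset B} {f : A → B}
    (h1 : ∀ x ∈ X, f x ∈ W) (h2 : ∀ y ∈ W, ∃ x ∈ X, f x = y) : X.image f = W := by
  ext y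
  constructor
  · intro h; obtain ⟨x, hx, rfl⟩ := Finset.mem_image.1 h; exact h1 x hx
  · intro h; obtain ⟨x, hx, rfl⟩ := h2 y h; exact Finset.mem_image_of_mem f hx

def circW (N : ℕ) : Finset (ℕ × Bool) := Finset.range N ×ˢ Finset.univ

theorem mem_circW (N : ℕ) (x : ℕ × Bool) : x ∈ circW N ↔ x.1 < N := by simp [circW]

/-- column shift -/
def shf (l : ℕ) (x : ℕ × Bool) : ℕ × Bool := (x.1 + l, x.2)

/-- wrapped column shift -/
def wrp (N : ℕ) (t : Bool) (x : ℕ × Bool) : ℕ × Bool :=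
  if x.1 + 1 = N then (0, x.2 ^^ t) else (x.1 + 1, x.2)

theorem emb_shf (N l : ℕ) (t : Bool) (X : Finset (ℕ × Bool))
    (h : ∀ x ∈ X, ∀ y ∈ X, x.1 + 1 < y.1 + N) : Emb ladder (circ N t) (shf l) X := by
  constructor
  · rintro ⟨i, r⟩ hx ⟨j, s⟩ hy; simp [shf]
  · rintro ⟨i, r⟩ hx ⟨j, s⟩ hy
    have h1 := h _ hx _ hy
    have h2 := h _ hy _ hx
    simp only [ladder_adj, circ_adj, shf, ne_eq, Prod.mk.injEq] at *
    clear h hx hy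
    cases r <;> cases s <;> grind

theorem emb_wrp (N : ℕ) (t : Bool) : Emb ladder (circ (N + 3) t) (wrp (N + 3) t)
    (pieceE (N + 1) false (!t)) := by
  constructor
  · rintro ⟨i, r⟩ hx ⟨j, s⟩ hy
    rw [mem_pieceE] at hx hy
    simp only [wrp]
    cases t <;> cases r <;> cases s <;> grind
  · rintro ⟨i, r⟩ hx ⟨j, s⟩ hy
    rw [mem_pieceE] at hx hy
    simp only [ladder_adj, circ_adj, wrp]
    cases t <;> cases r <;> cases s <;> grind

/-- the common value -/
def dv (N : ℕ) (t : Bool) : ℕ := if N % 4 = (if t then 1 else 3) then (N + 1) / 2 else N / 2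

theorem low_circ_link (N : ℕ) (t : Bool) {W : Finset (ℕ × Bool)} (a : Bool)
    (hW : ∀ x, x ∈ W ↔ x.1 ≠ 0 ∧ x.1 < N + 3 ∧ (x.1 = 1 → x.2 = a) ∧
      (x.1 = N + 2 → x.2 = (a ^^ t))) (hN : N = 0 → 1 ≠ N + 2) :
    (pieceE N a (a ^^ t)).image (shf 1) = W ∧
      Emb ladder (circ (N + 3) t) (shf 1) (pieceE N a (a ^^ t)) := by
  constructor
  · apply image_eq_of
    · rintro ⟨i, r⟩ hx
      rw [mem_pieceE] at hx
      simp only [hW, shf]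
      cases t <;> cases r <;> cases a <;> grind
    · rintro ⟨i, r⟩ hx
      rw [hW] at hx
      refine ⟨(i - 1, r), ?_, ?_⟩
      · simp only [mem_pieceE]
        cases t <;> cases r <;> cases a <;> grind
      · simp only [shf, Prod.mk.injEq, and_true]; simp only at hx; omega
  · apply emb_shf
    rintro ⟨i, r⟩ hx ⟨j, s⟩ hy
    rw [mem_pieceE] at hx hy
    simp only at *
    omega

theorem low_circ1 (N : ℕ) (t : Bool) {W : Finset (ℕ × Bool)}
    (hW : ∀ x, x ∈ W ↔ x.1 < N + 3 ∧ x ≠ (0, false)) :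
    Low (circ (N + 3) t) W (dv (N + 3) t) := by
  have l1 : Low (circ (N + 3) t) (W.erase (1, true)) (loE (N + 1) (!t)) := by
    have h := (low_pieceE (N + 1) false (!t)).map (emb_wrp N t)
    have : (pieceE (N + 1) false (!t)).image (wrp (N + 3) t) = W.erase (1, true) := by
      apply image_eq_of
      · rintro ⟨i, r⟩ hx
        rw [mem_pieceE] at hx
        simp only [Finset.mem_erase, hW, wrp]
        cases t <;> cases r <;> grind
      · rintro ⟨i, r⟩ hx
        simp only [Finset.mem_erase, hW] at hx
        by_cases hi : i = 0
        · refine ⟨(N + 2, r ^^ t), ?_, ?_⟩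
          · simp only [mem_pieceE]
            cases t <;> cases r <;> grind
          · simp [wrp, hi]
        · refine ⟨(i - 1, r), ?_, ?_⟩
          · simp only [mem_pieceE]
            cases t <;> cases r <;> grind
          · simp only [wrp]
            grind
    rw [this] at h
    simpa using h
  have l2 : Low (circ (N + 3) t) ((pieceB 0 N false).image (shf 2)) (N / 2 + 1) := by
    refine (low_pieceB N 0 false).map ?_
    apply emb_shf
    rintro ⟨i, r⟩ hx ⟨j, s⟩ hy
    rw [mem_pieceB] at hx hy
    simp only at *
    omega
  refine Low.split' (v := (1, true)) (W1 := W.erase (1, true)) (W2 := (pieceB 0 N false).image (shf 2))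
    ?_ ?_ ?_ l1 l2 ?_ ?_
  · simp [hW]
  · intro x; simp [and_comm]
  · have : (pieceB 0 N false).image (shf 2) =
        (W.filter (fun x => x.1 ≠ 0 ∧ x.1 ≠ 1 ∧ (x.1 = 2 → x.2 = false))) := by
      apply image_eq_of
      · rintro ⟨i, r⟩ hx
        rw [mem_pieceB] at hx
        simp only [Finset.mem_filter, hW, shf]
        cases r <;> grind
      · rintro ⟨i, r⟩ hx
        simp only [Finset.mem_filter, hW] at hx
        refine ⟨(i - 2, r), ?_, ?_⟩
        · simp only [mem_pieceB]
          cases r <;> grind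
        · simp only [shf, Prod.mk.injEq, and_true]; omega
    rw [this]
    rintro ⟨i, r⟩
    simp only [Finset.mem_filter, hW, circ_adj]
    cases t <;> cases r <;> grind
  · cases t <;> simp only [dv, loE] <;> grind
  · cases t <;> simp only [dv] <;> grind

theorem circ_main (N : ℕ) (t : Bool) (hN : 2 ≤ N) (h2 : N = 2 → t = true) :
    ∃ d, Low (circ N t) (circW N) d ∧ Nz (circ N t) (circW N) d := by
  obtain rfl | ⟨N, rfl⟩ : N = 2 ∨ ∃ M, N = M + 3 := by
    rcases Nat.lt_or_ge N 3 with h | h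
    · left; omega
    · right; exact ⟨N - 3, by omega⟩
  · obtain rfl := h2 rfl
    refine ⟨1, low_one _ _ ⟨(0, false), by simp [mem_circW]⟩, ?_⟩
    refine Nz.link (v := (0, false)) (W1 := (circW 2).erase (0, false)) (W2 := ∅) ?_ ?_ ?_
      (low_one _ _ ⟨(0, true), by simp [mem_circW]⟩) Nz.empty
    · simp [mem_circW]
    · intro x; simp [and_comm]
    · rintro ⟨i, r⟩
      simp only [mem_circW, circ_adj]
      cases r <;> grind
  · refine ⟨dv (N + 3) t, ?_⟩
    set W := circW (N + 3) with hWdef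
    set W1 := W.erase (0, false) with hW1
    have mW : ∀ x, x ∈ W ↔ x.1 < N + 3 := mem_circW _
    have mW1 : ∀ x, x ∈ W1 ↔ x.1 < N + 3 ∧ x ≠ (0, false) := by
      intro x; simp [hW1, mW, and_comm]
    have L1 := low_circ1 N t mW1
    set W2 := (pieceE N true (true ^^ t)).image (shf 1) with hW2
    set W3 := (pieceE N false (false ^^ t)).image (shf 1) with hW3
    obtain ⟨e2, E2⟩ := low_circ_link N t (W := W.filter (fun x => x.1 ≠ 0 ∧ (x.1 = 1 → x.2 = true) ∧
      (x.1 = N + 2 → x.2 = (true ^^ t)))) true (by intro x; simp [mW]; tauto) (by omega)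
    obtain ⟨e3, E3⟩ := low_circ_link N t (W := W.filter (fun x => x.1 ≠ 0 ∧ (x.1 = 1 → x.2 = false) ∧
      (x.1 = N + 2 → x.2 = (false ^^ t)))) false (by intro x; simp [mW]; tauto) (by omega)
    have L2 : Low (circ (N + 3) t) W2 (loE N t) := by
      have := (low_pieceE N true (true ^^ t)).map E2
      rwa [show (true ^^ (true ^^ t)) = t by simp] at this
    have h0 : (0, false) ∈ W := by simp [mW]
    have hd1 : ∀ x, x ∈ W1 ↔ x ∈ W ∧ x ≠ (0, false) := by intro x; simp [hW1, and_comm]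
    have hd2 : ∀ x, x ∈ W2 ↔ x ∈ W ∧ x ≠ (0, false) ∧ ¬ (circ (N + 3) t).Adj (0, false) x := by
      rw [hW2, e2]
      rintro ⟨i, r⟩
      simp only [Finset.mem_filter, mW, circ_adj]
      clear * -
      cases t <;> cases r <;> grind
    have hd3 : ∀ x, x ∈ W3 ↔ x ∈ W1 ∧ x ≠ (0, true) ∧ ¬ (circ (N + 3) t).Adj (0, true) x := by
      rw [hW3, e3]
      rintro ⟨i, r⟩
      simp only [Finset.mem_filter, mW, mW1, circ_adj]
      clear * -
      cases t <;> cases r <;> grind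
    refine ⟨Low.split' h0 hd1 hd2 L1 L2 le_rfl ?_, ?_⟩
    · cases t <;> simp only [dv, loE] <;> grind
    · by_cases hc : N % 4 ≤ 1 ↔ t = false
      · have hn := ((nz_acy_pieceE N true (true ^^ t)).1 (by simpa using hc)).map E2
        have ee : dv (N + 3) t = loE N t + 1 := by
          clear * - hc
          cases t <;> simp only [dv, loE] <;> grind
        rw [ee]
        refine Nz.link h0 hd1 hd2 (ee ▸ L1) ?_
        rwa [show (true ^^ (true ^^ t)) = t by simp] at hn
      · have a2 := ((nz_acy_pieceE N true (true ^^ t)).2 (by simpa using hc)).map E2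
        have a3 := ((nz_acy_pieceE N false (false ^^ t)).2 (by simpa using hc)).map E3
        refine Nz.del h0 hd1 hd2 ?_ a2
        refine Nz.del (v := (0, true)) (W1 := W1.erase (0, true)) (W2 := W3) ?_ ?_ hd3 ?_ a3
        · simp [mW1]
        · intro x; simp [and_comm]
        · have := (nz_pieceA (N + 2) 0).map (φ := shf 0) (G' := circ (N + 3) t) (by
            apply emb_shf
            rintro ⟨i, r⟩ hx ⟨j, s⟩ hy
            rw [mem_pieceA] at hx hy
            simp only at *
            omega)
          have e4 : (pieceA 0 (N + 2)).image (shf 0) = W1.erase (0, true) := by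
            apply image_eq_of
            · rintro ⟨i, r⟩ hx
              rw [mem_pieceA] at hx
              simp only [Finset.mem_erase, mW1, shf]
              grind
            · rintro ⟨i, r⟩ hx
              simp only [Finset.mem_erase, mW1] at hx
              refine ⟨(i, r), ?_, rfl⟩
              simp only [mem_pieceA]
              cases r <;> grind
          rw [e4] at this
          have ee : dv (N + 3) t = (N + 2 + 1) / 2 := by
            clear * - hc
            cases t <;> simp only [dv] <;> grind
          rw [ee]; exact this

end Circ

section Cayley

variable {Q : Type*} [AddCommGroup Q] [DecidableEq Q]

def cc (c : Q) (r : Bool) : Q := if r then c else 0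

theorem cc_add {c : Q} (hc : c + c = 0) (r s : Bool) : cc c r + cc c s = cc c (r ^^ s) := by
  cases r <;> cases s <;> simp [cc, hc]

theorem cc_neg {c : Q} (hc : c + c = 0) (r : Bool) : - cc c r = cc c r := by
  have : -c = c := neg_eq_of_add_eq_zero_left hc
  cases r <;> simp [cc, this]

theorem cc_inj {c : Q} (hc0 : c ≠ 0) {r s : Bool} (h : cc c r = cc c s) : r = s := by
  cases r <;> cases s <;> simp_all [cc, eq_comm]

def pp (a c u : Q) (x : ℕ × Bool) : Q := u + x.1 • a + cc c x.2

structure CayHyp (a c : Q) (N : ℕ) (t : Bool) : Prop where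
  hc : c + c = 0
  hc0 : c ≠ 0
  hN2 : 2 ≤ N
  hmin : ∀ k, 0 < k → k < N → ∀ r, k • a ≠ cc c r
  hN : N • a = cc c t

theorem CayHyp.le {a c : Q} {N : ℕ} {t : Bool} (h : CayHyp a c N t) {k : ℕ} (hk : k ≤ N) {r : Bool}
    (hr : k • a = cc c r) : (k = 0 ∧ r = false) ∨ (k = N ∧ r = t) := by
  rcases Nat.eq_zero_or_pos k with rfl | hk0
  · left; refine ⟨rfl, ?_⟩
    apply cc_inj h.hc0
    rw [← hr]; simp [cc]
  · rcases Nat.lt_or_ge k N with h1 | h1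
    · exact absurd hr (h.hmin k hk0 h1 r)
    · obtain rfl : k = N := by omega
      right; exact ⟨rfl, cc_inj h.hc0 (hr.symm.trans h.hN)⟩

theorem pp_sub {a c u : Q} (hc : c + c = 0) (j k : ℕ) (r s : Bool) :
    pp a c u (j, s) - pp a c u (j + k, r) = cc c (r ^^ s) - k • a := by
  have := cc_add hc r s
  rw [← this]
  have h2 := cc_neg hc r
  simp only [pp, add_smul]
  nth_rewrite 2 [← h2]
  abel

theorem cay_adj {a c u : Q} {N : ℕ} {t : Bool} (h : CayHyp a c N t) (j k : ℕ) (hk : k < N)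
    (r s : Bool) :
    (pp a c u (j, s) - pp a c u (j + k, r) = a ∨ pp a c u (j, s) - pp a c u (j + k, r) = -a ∨
      pp a c u (j, s) - pp a c u (j + k, r) = c) ↔
    (k = 0 ∧ r ≠ s) ∨ (k = 1 ∧ r = s) ∨ (k + 1 = N ∧ (r ^^ s) = t) := by
  rw [pp_sub h.hc]
  have e1 : cc c (r ^^ s) - k • a = a ↔ (k + 1 = N ∧ (r ^^ s) = t) := by
    constructor
    · intro h1
      have : (k + 1) • a = cc c (r ^^ s) := by
        rw [succ_nsmul]; rw [sub_eq_iff_eq_add] at h1; rw [h1, add_comm]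
      rcases h.le (by omega) this with h2 | h2
      · omega
      · exact h2
    · rintro ⟨h1, h2⟩
      rw [h2, ← h.hN, ← h1, succ_nsmul]; abel
  have e2 : cc c (r ^^ s) - k • a = -a ↔ (k = 1 ∧ r = s) := by
    constructor
    · intro h1
      rcases k with _ | k
      · exfalso
        have h2 : 1 • a = cc c (r ^^ s) := by
          rw [one_nsmul]; rw [← cc_neg h.hc]; simp only [zero_smul, sub_zero] at h1
          rw [h1, neg_neg]
        exact h.hmin 1 (by omega) (by have := h.hN2; omega) _ h2
      · have : k • a = cc c (r ^^ s) := by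
          rw [succ_nsmul] at h1
          have h3 : cc c (r ^^ s) = (k • a + a) + -a := by rw [← h1]; abel
          rw [h3]; abel
        rcases h.le (by omega) this with h2 | h2
        · refine ⟨by omega, ?_⟩
          have := h2.2
          revert this
          cases r <;> cases s <;> simp
        · omega
    · rintro ⟨rfl, rfl⟩
      simp [cc]
  have e3 : cc c (r ^^ s) - k • a = c ↔ (k = 0 ∧ r ≠ s) := by
    have hcc : c = cc c true := by simp [cc]
    constructor
    · intro h1
      have : k • a = cc c ((r ^^ s) ^^ true) := by
        rw [← cc_add h.hc, ← cc_neg h.hc true, ← hcc]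
        rw [sub_eq_iff_eq_add] at h1
        rw [h1]; abel
      rcases h.le (by omega) this with h2 | h2
      · refine ⟨h2.1, ?_⟩
        have := h2.2
        revert this
        cases r <;> cases s <;> simp
      · omega
    · rintro ⟨rfl, h2⟩
      have : (r ^^ s) = true := by revert h2; cases r <;> cases s <;> simp
      rw [this]; simp [cc]
  rw [e1, e2, e3]
  tauto

theorem pp_inj {a c u : Q} {N : ℕ} {t : Bool} (h : CayHyp a c N t) (j k : ℕ) (hk : k < N)
    (r s : Bool) (he : pp a c u (j + k, r) = pp a c u (j, s)) : k = 0 ∧ r = s := by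
  have := pp_sub (a := a) (u := u) h.hc j k r s
  rw [he, sub_self] at this
  have h1 : k • a = cc c (r ^^ s) := (sub_eq_zero.1 this.symm).symm
  rcases h.le (by omega) h1 with h2 | h2
  · refine ⟨h2.1, ?_⟩
    have := h2.2
    revert this
    cases r <;> cases s <;> simp
  · omega

theorem emb_pp {a c : Q} {N : ℕ} {t : Bool} (h : CayHyp a c N t) {H : SimpleGraph Q}
    (hH : ∀ u v, H.Adj u v ↔ v - u = a ∨ v - u = -a ∨ v - u = c) (u : Q) :
    Emb (circ N t) H (pp a c u) (circW N) := by
  constructor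
  · rintro ⟨i, r⟩ hx ⟨j, s⟩ hy he
    rw [mem_circW] at hx hy
    rcases le_total i j with hij | hij
    · obtain ⟨k, rfl⟩ := Nat.exists_eq_add_of_le hij
      obtain ⟨rfl, rfl⟩ := pp_inj h i k (by simp only at *; omega) s r he.symm
      rfl
    · obtain ⟨k, rfl⟩ := Nat.exists_eq_add_of_le hij
      obtain ⟨rfl, rfl⟩ := pp_inj h j k (by simp only at *; omega) r s he
      rfl
  · have key : ∀ j k r s, j + k < N → ((circ N t).Adj (j + k, r) (j, s) ↔
        H.Adj (pp a c u (j + k, r)) (pp a c u (j, s))) := by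
      intro j k r s hx
      rw [hH, cay_adj h j k (by omega), circ_adj]
      have := h.hN2
      clear h hH
      cases t <;> cases r <;> cases s <;> grind
    rintro ⟨i, r⟩ hx ⟨j, s⟩ hy
    rw [mem_circW] at hx hy
    rcases le_total i j with hij | hij
    · obtain ⟨k, rfl⟩ := Nat.exists_eq_add_of_le hij
      rw [SimpleGraph.adj_comm, H.adj_comm]
      exact key _ _ _ _ hy
    · obtain ⟨k, rfl⟩ := Nat.exists_eq_add_of_le hij
      exact key _ _ _ _ hx

theorem pp_add_c {a c u : Q} (hc : c + c = 0) (i : ℕ) (r : Bool) :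
    pp a c u (i, r) + c = pp a c u (i, !r) := by
  have := cc_add hc r true
  simp only [pp, add_assoc]
  simp only [cc, if_true, Bool.xor_true] at this ⊢
  rw [this]

theorem pp_add_a {a c u : Q} (i : ℕ) (r : Bool) :
    pp a c u (i, r) + a = pp a c u (i + 1, r) := by
  simp only [pp, succ_nsmul]; abel

theorem pp_N {a c u : Q} {N : ℕ} {t : Bool} (h : CayHyp a c N t) (r : Bool) :
    pp a c u (N, r) = pp a c u (0, r ^^ t) := by
  have := cc_add h.hc r t
  simp only [pp, h.hN, ← this]; simp only [zero_smul, add_zero]; abel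

theorem comp_closed {a c : Q} {N : ℕ} {t : Bool} (h : CayHyp a c N t) (u : Q) :
    ∀ x ∈ (circW N).image (pp a c u), x + a ∈ (circW N).image (pp a c u) ∧
      x - a ∈ (circW N).image (pp a c u) ∧ x + c ∈ (circW N).image (pp a c u) := by
  have hN2 := h.hN2
  intro x hx
  obtain ⟨⟨i, r⟩, hi, rfl⟩ := Finset.mem_image.1 hx
  rw [mem_circW] at hi
  simp only at hi
  refine ⟨?_, ?_, ?_⟩
  · rw [pp_add_a]
    rcases Nat.lt_or_ge (i + 1) N with h1 | h1
    · exact Finset.mem_image_of_mem _ (by simp [mem_circW, h1])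
    · obtain rfl : i + 1 = N := by omega
      rw [pp_N h]
      exact Finset.mem_image_of_mem _ (by simp [mem_circW])
  · rcases i with _ | i
    · have : pp a c u (0, r) - a = pp a c u (N - 1, r ^^ t) := by
        rw [sub_eq_iff_eq_add, pp_add_a, show N - 1 + 1 = N by omega, pp_N h]
        congr 2; cases r <;> cases t <;> rfl
      rw [this]
      exact Finset.mem_image_of_mem _ (by simp [mem_circW]; omega)
    · rw [← pp_add_a, add_sub_cancel_right]
      exact Finset.mem_image_of_mem _ (by simp [mem_circW]; omega)
  · rw [pp_add_c h.hc]
    exact Finset.mem_image_of_mem _ (by simp [mem_circW, hi])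

theorem cay_main {a c : Q} {N : ℕ} {t : Bool} (h : CayHyp a c N t) (h2 : N = 2 → t = true)
    {H : SimpleGraph Q}
    (hH : ∀ u v, H.Adj u v ↔ v - u = a ∨ v - u = -a ∨ v - u = c) (W : Finset Q)
    (hW : ∀ x ∈ W, x + a ∈ W ∧ x - a ∈ W ∧ x + c ∈ W) : ∃ d, Low H W d ∧ Nz H W d := by
  induction' hk : W.card using Nat.strong_induction_on with k ih generalizing W
  rcases W.eq_empty_or_nonempty with rfl | ⟨u, hu⟩
  · exact ⟨0, Low.empty, Nz.empty⟩
  · set Y := (circW N).image (pp a c u) with hY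
    have cY := comp_closed h u
    rw [← hY] at cY
    have hcc2 : -c = c := neg_eq_of_add_eq_zero_left h.hc
    have hYW : Y ⊆ W := by
      intro x hx
      obtain ⟨⟨i, r⟩, hi, rfl⟩ := Finset.mem_image.1 hx
      clear hi hx
      have hf : ∀ i, pp a c u (i, false) ∈ W := by
        intro i
        induction i with
        | zero => simpa [pp, cc] using hu
        | succ i ih => rw [← pp_add_a]; exact (hW _ ih).1
      cases r
      · exact hf i
      · have := (hW _ (hf i)).2.2
        rwa [pp_add_c h.hc] at this
    have huY : u ∈ Y := Finset.mem_image.2 ⟨(0, false), by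
      rw [mem_circW]; exact lt_of_lt_of_le (by norm_num) h.hN2, by simp [pp, cc]⟩
    obtain ⟨d, ld, nd⟩ := circ_main N t h.hN2 h2
    have ld := ld.map (emb_pp h hH u)
    have nd := nd.map (emb_pp h hH u)
    obtain ⟨e, le, ne⟩ := ih (W \ Y).card (by
        rw [← hk]; apply Finset.card_lt_card
        refine ⟨Finset.sdiff_subset, fun hs => ?_⟩
        have := hs hu
        simp [huY] at this) (W \ Y) (by
      intro x hx
      rw [Finset.mem_sdiff] at hx
      obtain ⟨h1, h3, h4⟩ := hW x hx.1
      simp only [Finset.mem_sdiff]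
      refine ⟨⟨h1, fun hh => hx.2 ?_⟩, ⟨h3, fun hh => hx.2 ?_⟩, ⟨h4, fun hh => hx.2 ?_⟩⟩
      · simpa using (cY _ hh).2.1
      · simpa using (cY _ hh).1
      · have := (cY _ hh).2.2
        rwa [add_assoc, h.hc, add_zero] at this) rfl
    have hs : VSep H Y (W \ Y) := by
      intro x hx y hy
      rw [Finset.mem_sdiff] at hy
      refine ⟨fun he => hy.2 (he ▸ hx), fun ha => hy.2 ?_⟩
      rw [hH] at ha
      rcases ha with ha | ha | ha
      · rw [sub_eq_iff_eq_add] at ha; rw [ha, add_comm]; exact (cY x hx).1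
      · rw [sub_eq_iff_eq_add] at ha; rw [ha, add_comm, ← sub_eq_add_neg]; exact (cY x hx).2.1
      · rw [sub_eq_iff_eq_add] at ha; rw [ha, add_comm]; exact (cY x hx).2.2
    have eW : Y ∪ (W \ Y) = W := Finset.union_sdiff_of_subset hYW
    refine ⟨d + e, ?_, ?_⟩
    · have := ld.union le hs; rwa [eW] at this
    · have := nd.union ne le hs; rwa [eW] at this

theorem exists_cayHyp [Finite Q] {a c : Q} (hc : c + c = 0) (hc0 : c ≠ 0) (ha : a ≠ 0) (hac : a ≠ c)
    (ha2 : a + a ≠ 0) : ∃ N t, CayHyp a c N t ∧ (N = 2 → t = true) := by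
  have hex : ∃ k, 0 < k ∧ ∃ r, k • a = cc c r :=
    ⟨addOrderOf a, addOrderOf_pos a, false, by simp [cc]⟩
  classical
  obtain ⟨h0, t, ht⟩ := Nat.find_spec hex
  have hmin : ∀ k, 0 < k → k < Nat.find hex → ∀ r, k • a ≠ cc c r := by
    intro k hk hk2 r hr
    exact Nat.find_min hex hk2 ⟨hk, r, hr⟩
  have h2 : 2 ≤ Nat.find hex := by
    by_contra hlt
    have : Nat.find hex = 1 := by omega
    rw [this, one_smul] at ht
    cases t <;> simp_all [cc]
  refine ⟨Nat.find hex, t, ⟨hc, hc0, h2, hmin, ht⟩, ?_⟩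
  intro h
  rw [h, two_smul] at ht
  cases t
  · simp [cc, ha2] at ht
  · rfl

end Cayley

section Circulant

theorem zmod_eq_add_iff (m x y b : ℕ) (hx : x < m) (hy : y < m) (hb : b < m) :
    ((y : ZMod m) = x + b) ↔ (y = x + b ∨ y + m = x + b) := by
  rw [← Nat.cast_add, ZMod.natCast_eq_natCast_iff', Nat.mod_eq_of_lt hy]
  rcases Nat.lt_or_ge (x + b) m with h | h
  · rw [Nat.mod_eq_of_lt h]; omega
  · rw [Nat.mod_eq_sub_mod h, Nat.mod_eq_of_lt (by omega)]; omega

theorem circulant_main (n a : ℕ) (hn : 2 ≤ n) (ha1 : 1 ≤ a) (han : a < n) :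
    ∃ d, Low (circulantGraph (2 * n) ({a, n} : Set ℕ)) Finset.univ d ∧
      Nz (circulantGraph (2 * n) ({a, n} : Set ℕ)) Finset.univ d := by
  haveI : NeZero (2 * n) := ⟨by omega⟩
  have cz : ∀ k : ℕ, 0 < k → k < 2 * n → ((k : ℕ) : ZMod (2 * n)) ≠ 0 := by
    intro k h1 h2 h3
    rw [ZMod.natCast_eq_zero_iff] at h3
    exact absurd (Nat.le_of_dvd h1 h3) (by omega)
  have hc : ((n : ℕ) : ZMod (2 * n)) + (n : ℕ) = 0 := by
    rw [← Nat.cast_add, ← two_mul]; exact ZMod.natCast_self _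
  have hac : ((a : ℕ) : ZMod (2 * n)) ≠ (n : ℕ) := by
    intro h
    rw [ZMod.natCast_eq_natCast_iff', Nat.mod_eq_of_lt (by omega), Nat.mod_eq_of_lt (by omega)] at h
    omega
  obtain ⟨N, t, hN, h2⟩ := exists_cayHyp (a := ((a : ℕ) : ZMod (2 * n))) (c := ((n : ℕ) : ZMod (2 * n)))
    hc (cz n (by omega) (by omega)) (cz a (by omega) (by omega)) hac (by
      rw [← Nat.cast_add]; exact cz _ (by omega) (by omega))
  let φ : ZMod (2 * n) → Fin (2 * n) := fun z => ⟨z.val, ZMod.val_lt z⟩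
  have hadj : ∀ u v : ZMod (2 * n), (circulantGraph (2 * n) ({a, n} : Set ℕ)).Adj (φ u) (φ v) ↔
      (v - u = (a : ℕ) ∨ v - u = - (a : ℕ) ∨ v - u = (n : ℕ)) := by
    intro u v
    have e1 : v - u = (a : ℕ) ↔ (v.val = u.val + a ∨ v.val + 2 * n = u.val + a) := by
      rw [← zmod_eq_add_iff _ _ _ _ (ZMod.val_lt u) (ZMod.val_lt v) (by omega)]
      simp only [ZMod.natCast_val, ZMod.cast_id', id]
      rw [sub_eq_iff_eq_add, add_comm]
    have e2 : v - u = - (a : ℕ) ↔ (u.val = v.val + a ∨ u.val + 2 * n = v.val + a) := by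
      rw [← zmod_eq_add_iff _ _ _ _ (ZMod.val_lt v) (ZMod.val_lt u) (by omega)]
      simp only [ZMod.natCast_val, ZMod.cast_id', id]
      rw [← neg_inj, neg_sub, neg_neg, sub_eq_iff_eq_add, add_comm]
    have e3 : v - u = (n : ℕ) ↔ (v.val = u.val + n ∨ v.val + 2 * n = u.val + n) := by
      rw [← zmod_eq_add_iff _ _ _ _ (ZMod.val_lt u) (ZMod.val_lt v) (by omega)]
      simp only [ZMod.natCast_val, ZMod.cast_id', id]
      rw [sub_eq_iff_eq_add, add_comm]
    rw [e1, e2, e3]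
    have hu := ZMod.val_lt u
    have hv := ZMod.val_lt v
    simp only [circulantGraph, SimpleGraph.fromRel_adj, φ, ne_eq, Fin.mk.injEq,
      Set.mem_insert_iff, Set.mem_singleton_iff]
    omega
  let H : SimpleGraph (ZMod (2 * n)) := (circulantGraph (2 * n) ({a, n} : Set ℕ)).comap φ
  obtain ⟨d, l, z⟩ := cay_main hN h2 (H := H) (fun u v => hadj u v) Finset.univ (by simp)
  have hE : Emb H (circulantGraph (2 * n) ({a, n} : Set ℕ)) φ Finset.univ := by
    refine ⟨?_, fun x _ y _ => Iff.rfl⟩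
    intro x _ y _ h
    exact ZMod.val_injective _ (by simpa [φ] using h)
  have hI : Finset.univ.image φ = Finset.univ := by
    apply image_eq_of
    · simp
    · intro y _
      refine ⟨((y : ℕ) : ZMod (2 * n)), by simp, ?_⟩
      ext
      simp only [φ]
      exact ZMod.val_cast_of_lt y.2
  exact ⟨d, hI ▸ l.map hE, hI ▸ z.map hE⟩

end Circulant

section SDepth

def VInd {V : Type*} (G : SimpleGraph V) (F : Finset V) : Prop := ∀ x ∈ F, ∀ y ∈ F, ¬ G.Adj x y

theorem VInd.mono {V : Type*} {G : SimpleGraph V} {F F' : Finset V} (h : VInd G F) (hs : F' ⊆ F) :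
    VInd G F' := fun x hx y hy => h x (hs hx) y (hs hy)

theorem VInd.insert {V : Type*} [DecidableEq V] {G : SimpleGraph V} {F : Finset V} {v : V}
    (h : VInd G F) (hv : ∀ x ∈ F, ¬ G.Adj v x) : VInd G (insert v F) := by
  intro x hx y hy
  rw [Finset.mem_insert] at hx hy
  rcases hx with rfl | hx <;> rcases hy with rfl | hy
  · exact G.irrefl
  · exact hv y hy
  · intro h'; exact hv x hx h'.symm
  · exact h x hx y hy

/-- interval partition of the independence complex -/
def SDP {V : Type*} (G : SimpleGraph V) (W : Finset V) (d : ℕ) : Prop :=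
  ∃ P : Finset (Finset V × Finset V),
    (∀ q ∈ P, q.1 ⊆ q.2 ∧ q.2 ⊆ W ∧ VInd G q.2 ∧ d ≤ q.2.card) ∧
    ∀ F, F ⊆ W → VInd G F → ∃! q, q ∈ P ∧ q.1 ⊆ F ∧ F ⊆ q.2

theorem Low.sdp {V : Type*} [DecidableEq V] {G : SimpleGraph V} {W : Finset V} {d : ℕ}
    (h : Low G W d) : SDP G W d := by
  induction h with
  | empty =>
    refine ⟨{(∅, ∅)}, ?_, ?_⟩
    · simp [VInd]
    · intro F hF _
      obtain rfl := Finset.subset_empty.1 hF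
      refine ⟨(∅, ∅), by simp, ?_⟩
      rintro q ⟨hq, -⟩
      simpa using hq
  | @iso W W' v d hv h' hi h ih =>
    obtain ⟨P, hP, hu⟩ := ih
    have hsub : W' ⊆ W := fun x hx => ((h' x).1 hx).1
    have hvW : v ∉ W' := fun hh => ((h' v).1 hh).2 rfl
    refine ⟨P.image (fun q => (q.1, insert v q.2)), ?_, ?_⟩
    · intro q hq
      obtain ⟨q, hq', rfl⟩ := Finset.mem_image.1 hq
      obtain ⟨a1, a2, a3, a4⟩ := hP q hq'
      refine ⟨a1.trans (Finset.subset_insert _ _), ?_, ?_, ?_⟩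
      · exact Finset.insert_subset hv (a2.trans hsub)
      · exact a3.insert fun x hx => hi x (hsub (a2 hx))
      · rw [Finset.card_insert_of_notMem fun hh => hvW (a2 hh)]; omega
    · intro F hF hI
      obtain ⟨q, ⟨q1, q2, q3⟩, q4⟩ := hu (F.erase v) (by
        intro x hx; rw [Finset.mem_erase] at hx; exact (h' x).2 ⟨hF hx.2, hx.1⟩)
        (hI.mono (Finset.erase_subset _ _))
      refine ⟨(q.1, insert v q.2), ⟨Finset.mem_image_of_mem _ q1, ?_, ?_⟩, ?_⟩
      · exact q2.trans (Finset.erase_subset _ _)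
      · exact Finset.subset_insert_iff.2 q3
      · rintro p ⟨hp, p2, p3⟩
        obtain ⟨p, hp', rfl⟩ := Finset.mem_image.1 hp
        obtain ⟨a1, a2, a3, a4⟩ := hP p hp'
        have := q4 p ⟨hp', ?_, Finset.subset_insert_iff.1 p3⟩
        · rw [this]
        · intro x hx
          refine Finset.mem_erase.2 ⟨?_, p2 hx⟩
          rintro rfl; exact hvW (a2 (a1 hx))
  | @split W W1 W2 v d e hv h1 h2 l1 l2 hde ih1 ih2 =>
    obtain ⟨P1, hP1, hu1⟩ := ih1
    obtain ⟨P2, hP2, hu2⟩ := ih2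
    have hv1 : v ∉ W1 := fun hh => ((h1 v).1 hh).2 rfl
    have hv2 : v ∉ W2 := fun hh => ((h2 v).1 hh).2.1 rfl
    have hs1 : W1 ⊆ W := fun x hx => ((h1 x).1 hx).1
    have hs2 : W2 ⊆ W := fun x hx => ((h2 x).1 hx).1
    refine ⟨P1 ∪ P2.image (fun q => (insert v q.1, insert v q.2)), ?_, ?_⟩
    · intro q hq
      rcases Finset.mem_union.1 hq with hq | hq
      · obtain ⟨a1, a2, a3, a4⟩ := hP1 q hq
        exact ⟨a1, a2.trans hs1, a3, a4⟩
      · obtain ⟨q, hq', rfl⟩ := Finset.mem_image.1 hq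
        obtain ⟨a1, a2, a3, a4⟩ := hP2 q hq'
        refine ⟨Finset.insert_subset_insert _ a1, Finset.insert_subset hv (a2.trans hs2), ?_, ?_⟩
        · exact a3.insert fun x hx => ((h2 x).1 (a2 hx)).2.2
        · rw [Finset.card_insert_of_notMem fun hh => hv2 (a2 hh)]; omega
    · intro F hF hI
      by_cases hvF : v ∈ F
      · obtain ⟨q, ⟨q1, q2, q3⟩, q4⟩ := hu2 (F.erase v) (by
          intro x hx; rw [Finset.mem_erase] at hx
          exact (h2 x).2 ⟨hF hx.2, hx.1, hI v hvF x hx.2⟩)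
          (hI.mono (Finset.erase_subset _ _))
        refine ⟨(insert v q.1, insert v q.2), ⟨Finset.mem_union_right _ (Finset.mem_image_of_mem _ q1),
          ?_, ?_⟩, ?_⟩
        · exact Finset.insert_subset hvF (q2.trans (Finset.erase_subset _ _))
        · exact Finset.subset_insert_iff.2 q3
        · rintro p ⟨hp, p2, p3⟩
          rcases Finset.mem_union.1 hp with hp | hp
          · exact absurd ((hP1 p hp).2.1 (p3 hvF)) hv1
          · obtain ⟨p, hp', rfl⟩ := Finset.mem_image.1 hp
            obtain ⟨a1, a2, a3, a4⟩ := hP2 p hp'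
            have := q4 p ⟨hp', ?_, Finset.subset_insert_iff.1 p3⟩
            · rw [this]
            · intro x hx
              refine Finset.mem_erase.2 ⟨?_, p2 (Finset.mem_insert_of_mem hx)⟩
              rintro rfl; exact hv2 (a2 (a1 hx))
      · obtain ⟨q, ⟨q1, q2, q3⟩, q4⟩ := hu1 F (by
          intro x hx
          exact (h1 x).2 ⟨hF hx, fun hh => hvF (hh ▸ hx)⟩) hI
        refine ⟨q, ⟨Finset.mem_union_left _ q1, q2, q3⟩, ?_⟩
        rintro p ⟨hp, p2, p3⟩
        rcases Finset.mem_union.1 hp with hp | hp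
        · exact q4 p ⟨hp, p2, p3⟩
        · obtain ⟨p, hp', rfl⟩ := Finset.mem_image.1 hp
          exact absurd (p2 (Finset.mem_insert_self _ _)) hvF

variable {K : Type*} [Field K] {V : Type*}

theorem edgeIdeal_eq (G : SimpleGraph V) : edgeIdeal K G =
    Ideal.span ((fun s => monomial s (1 : K)) ''
      {m : V →₀ ℕ | ∃ i j, G.Adj i j ∧ m = Finsupp.single i 1 + Finsupp.single j 1}) := by
  unfold edgeIdeal
  congr 1
  ext m
  simp only [Set.mem_setOf_eq, Set.mem_image]
  constructor
  · rintro ⟨i, j, h, rfl⟩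
    refine ⟨_, ⟨i, j, h, rfl⟩, ?_⟩
    simp [X, monomial_mul]
  · rintro ⟨_, ⟨i, j, h, rfl⟩, rfl⟩
    refine ⟨i, j, h, ?_⟩
    simp [X, monomial_mul]

theorem coeff_edgeIdeal {G : SimpleGraph V} {f : MvPolynomial V K} (hf : f ∈ edgeIdeal K G)
    {m : V →₀ ℕ} (hm : VInd G m.support) : coeff m f = 0 := by
  classical
  by_contra hne
  rw [edgeIdeal_eq, mem_ideal_span_monomial_image] at hf
  obtain ⟨_, ⟨i, j, hij, rfl⟩, hle⟩ := hf m (mem_support_iff.2 hne)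
  refine hm i ?_ j ?_ hij
  · have := hle i
    rw [Finsupp.mem_support_iff]
    simp at this; omega
  · have := hle j
    rw [Finsupp.mem_support_iff]
    simp at this; omega

theorem mono_mem_edgeIdeal {G : SimpleGraph V} {m : V →₀ ℕ} (hm : ¬ VInd G m.support) (c : K) :
    monomial m c ∈ edgeIdeal K G := by
  classical
  unfold VInd at hm
  push Not at hm
  obtain ⟨i, hi, j, hj, hij⟩ := hm
  rw [edgeIdeal_eq, mem_ideal_span_monomial_image]
  intro x hx
  have : x = m := by
    have := support_monomial_subset hx
    simpa using this
  subst this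
  refine ⟨_, ⟨i, j, hij, rfl⟩, ?_⟩
  intro k
  have hne := hij.ne
  rw [Finsupp.mem_support_iff] at hi hj
  simp only [Finsupp.add_apply, Finsupp.single_apply]
  split_ifs with h1 h2 h2
  · exact absurd (h1.trans h2.symm) hne
  · subst h1; omega
  · subst h2; omega
  · omega

/-- the standard monomial -/
noncomputable def stdMon (K : Type*) [Field K] {V : Type*} (G : SimpleGraph V)
    (m : {m : V →₀ ℕ // VInd G m.support}) :
    MvPolynomial V K ⧸ edgeIdeal K G := Ideal.Quotient.mk _ (monomial m.1 (1 : K))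

theorem stdMon_li (G : SimpleGraph V) : LinearIndependent K (stdMon K G) := by
  classical
  rw [linearIndependent_iff']
  intro s g hg i hi
  have h1 : Ideal.Quotient.mk (edgeIdeal K G) (∑ i ∈ s, g i • monomial i.1 (1 : K)) = 0 := by
    rw [← hg, map_sum]
    rfl
  rw [Ideal.Quotient.eq_zero_iff_mem] at h1
  have h2 := coeff_edgeIdeal h1 i.2
  rw [coeff_sum] at h2
  simp only [coeff_smul, coeff_monomial, smul_eq_mul, mul_ite, mul_one, mul_zero] at h2
  rw [Finset.sum_eq_single i] at h2
  · simpa using h2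
  · intro b _ hb
    rw [if_neg]
    exact fun hh => hb (Subtype.ext hh)
  · intro hh; exact absurd hi hh

theorem stdMon_span (G : SimpleGraph V) : Submodule.span K (Set.range (stdMon K G)) = ⊤ := by
  rw [eq_top_iff]
  rintro x -
  obtain ⟨f, rfl⟩ := Ideal.Quotient.mk_surjective x
  induction f using MvPolynomial.induction_on' with
  | monomial m c =>
    by_cases hm : VInd G m.support
    · have : Ideal.Quotient.mk (edgeIdeal K G) (monomial m c) = c • stdMon K G ⟨m, hm⟩ := by
        have : monomial m c = c • monomial m (1 : K) := by rw [smul_monomial]; simp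
        rw [this]; rfl
      rw [this]
      exact Submodule.smul_mem _ _ (Submodule.subset_span ⟨_, rfl⟩)
    · rw [Ideal.Quotient.eq_zero_iff_mem.2 (mono_mem_edgeIdeal hm c)]
      exact Submodule.zero_mem _
  | add p q hp hq => rw [map_add]; exact Submodule.add_mem _ hp hq

theorem edge_one_ne (G : SimpleGraph V) : (1 : MvPolynomial V K ⧸ edgeIdeal K G) ≠ 0 := by
  intro h
  rw [← map_one (Ideal.Quotient.mk _), Ideal.Quotient.eq_zero_iff_mem] at h
  have := coeff_edgeIdeal h (m := 0) (by simp [VInd])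
  simp at this

theorem internal_of_partition {ι M : Type*} [AddCommGroup M] [Module K M] {k : ℕ}
    (b : ι → M) (hb : LinearIndependent K b) (hs : Submodule.span K (Set.range b) = ⊤)
    (f : ι → Fin k) (N : Fin k → Submodule K M)
    (hN : ∀ j, N j = Submodule.span K (b '' {i | f i = j})) : DirectSum.IsInternal N := by
  apply DirectSum.isInternal_submodule_of_iSupIndep_of_iSup_eq_top
  · intro j
    have h1 := hb.disjoint_span_image (s := {i | f i = j}) (t := {i | f i ≠ j}) (by
      rw [Set.disjoint_left]; intro i h1 h2; exact h2 h1)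
    rw [hN]
    refine h1.mono_right ?_
    refine iSup₂_le fun i hi => ?_
    rw [hN]
    apply Submodule.span_mono
    apply Set.image_mono
    rintro x rfl
    exact hi
  · rw [eq_top_iff, ← hs, Submodule.span_le]
    rintro _ ⟨i, rfl⟩
    refine Submodule.mem_iSup_of_mem (f i) ?_
    rw [hN]
    exact Submodule.subset_span ⟨i, rfl, rfl⟩

theorem exists_stanley [Fintype V] [DecidableEq V] {G : SimpleGraph V} {d : ℕ}
    (h : SDP G Finset.univ d) :
    ∃ D : StanleyDecomposition (edgeIdeal K G), ∀ j, d ≤ (D.Z j).card := by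
  classical
  obtain ⟨P, hP, hu⟩ := h
  let e := P.equivFin
  let u : Fin P.card → (V →₀ ℕ) := fun j =>
    Finsupp.equivFunOnFinite.symm (fun v => if v ∈ (e.symm j).1.1 then 1 else 0)
  have u_apply : ∀ j v, u j v = if v ∈ (e.symm j).1.1 then 1 else 0 := fun j v => rfl
  let Z : Fin P.card → Finset V := fun j => (e.symm j).1.2
  have key : ∀ j (a : V →₀ ℕ), a.support ⊆ Z j → (e.symm j).1.1 ⊆ (u j + a).support ∧
      (u j + a).support ⊆ Z j := by
    intro j a ha
    constructor
    · intro v hv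
      rw [Finsupp.mem_support_iff, Finsupp.add_apply, u_apply, if_pos hv]; omega
    · intro v hv
      rw [Finsupp.mem_support_iff, Finsupp.add_apply, u_apply] at hv
      by_cases h1 : v ∈ (e.symm j).1.1
      · exact (hP _ (e.symm j).2).1 h1
      · rw [if_neg h1, zero_add] at hv
        exact ha (Finsupp.mem_support_iff.2 hv)
  have indZ : ∀ j, VInd G (Z j) := fun j => (hP _ (e.symm j).2).2.2.1
  have hex : ∀ m : {m : V →₀ ℕ // VInd G m.support}, ∃ j : Fin P.card,
      (e.symm j).1.1 ⊆ m.1.support ∧ m.1.support ⊆ (e.symm j).1.2 := by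
    intro m
    obtain ⟨q, ⟨q1, q2, q3⟩, -⟩ := hu m.1.support (Finset.subset_univ _) m.2
    exact ⟨e ⟨q, q1⟩, by simpa using q2, by simpa using q3⟩
  have huniq : ∀ (m : V →₀ ℕ), VInd G m.support → ∀ j j',
      (e.symm j).1.1 ⊆ m.support → m.support ⊆ (e.symm j).1.2 → 
      (e.symm j').1.1 ⊆ m.support → m.support ⊆ (e.symm j').1.2 → j = j' := by
    intro m hm j j' h1 h2 h3 h4
    obtain ⟨q, -, hq⟩ := hu m.support (Finset.subset_univ _) hm
    have a1 := hq _ ⟨(e.symm j).2, h1, h2⟩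
    have a2 := hq _ ⟨(e.symm j').2, h3, h4⟩
    exact e.symm.injective (Subtype.ext (a1.trans a2.symm))
  choose f hf1 hf2 using hex
  refine ⟨⟨P.card, u, Z, ?_, ?_⟩, fun j => (hP _ (e.symm j).2).2.2.2⟩
  · intro j
    let g : {a : V →₀ ℕ // a.support ⊆ Z j} → {m : V →₀ ℕ // VInd G m.support} := fun a =>
      ⟨u j + a.1, (indZ j).mono (key j a.1 a.2).2⟩
    have hg : Function.Injective g := by
      intro a b hab
      have := congrArg Subtype.val hab
      exact Subtype.ext (add_left_cancel this)
    exact (stdMon_li (K := K) G).comp g hg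
  · refine internal_of_partition (stdMon K G) (stdMon_li G) (stdMon_span G) f _ ?_
    intro j
    unfold stanleySpace
    congr 1
    ext x
    simp only [Set.mem_setOf_eq, Set.mem_image]
    constructor
    · rintro ⟨a, ha, rfl⟩
      have hk := key j a ha
      refine ⟨⟨u j + a, (indZ j).mono hk.2⟩, ?_, rfl⟩
      exact huniq (u j + a) ((indZ j).mono hk.2) _ _ (hf1 ⟨u j + a, (indZ j).mono hk.2⟩)
        (hf2 ⟨u j + a, (indZ j).mono hk.2⟩) hk.1 hk.2
    · rintro ⟨m, rfl, rfl⟩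
      have hle : u (f m) ≤ m.1 := by
        intro v
        rw [u_apply]
        split_ifs with hv
        · have := Finsupp.mem_support_iff.1 (hf1 m hv); omega
        · omega
      refine ⟨m.1 - u (f m), ?_, ?_⟩
      · refine Finset.Subset.trans ?_ (hf2 m)
        intro v hv
        rw [Finsupp.mem_support_iff] at hv ⊢
        rw [Finsupp.tsub_apply] at hv; omega
      · rw [add_tsub_cancel_of_le hle]; rfl

theorem sdepth_ge [Fintype V] [DecidableEq V] {G : SimpleGraph V} {d : ℕ}
    (h : Low G Finset.univ d) : d ≤ sdepthQuot (edgeIdeal K G) := by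
  unfold sdepthQuot
  apply le_csSup
  · refine ⟨Fintype.card V, ?_⟩
    rintro n ⟨D, hD⟩
    have : D.m ≠ 0 := by
      intro h0
      have hi := D.internal
      obtain ⟨y, hy⟩ := hi.2 1
      haveI : IsEmpty (Fin D.m) := by rw [h0]; infer_instance
      have : y = 0 := by ext j; exact isEmptyElim j
      rw [this, map_zero] at hy
      exact edge_one_ne (K := K) G hy.symm
    exact (hD ⟨0, Nat.pos_of_ne_zero this⟩).trans (Finset.card_le_univ _)
  · exact exists_stanley h.sdp

end SDepth

section Clifford

variable {V : Type*} [LinearOrder V]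

def sg1 (w v : V) : ℤ := if w < v then -1 else 1

def sgv (v : V) (S : Finset V) : ℤ := ∏ w ∈ S, sg1 w v

theorem sg1_swap {v w : V} (h : v ≠ w) : sg1 w v = - sg1 v w := by
  unfold sg1
  rcases lt_or_gt_of_ne h with h | h
  · simp [h, not_lt_of_gt h]
  · simp [h, not_lt_of_gt h]

theorem sg1_sq (v w : V) : sg1 w v * sg1 w v = 1 := by unfold sg1; split_ifs <;> simp

theorem sgv_insert (v w : V) (T : Finset V) (h : w ∉ T) :
    sgv v (insert w T) = sg1 w v * sgv v T := Finset.prod_insert h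

theorem sgv_sq (v : V) (S : Finset V) : sgv v S * sgv v S = 1 := by
  unfold sgv; rw [← Finset.prod_mul_distrib]; exact Finset.prod_eq_one fun w _ => sg1_sq _ _

variable (R : Type*) [CommRing R] (M : Type*) [AddCommGroup M] [Module R M]

def eps (v : V) : Module.End R (Finset V → M) where
  toFun f S := if v ∈ S then sgv v (S.erase v) • f (S.erase v) else 0
  map_add' f g := by
    ext S
    simp only [Pi.add_apply]
    split_ifs
    · rw [smul_add]
    · simp
  map_smul' c f := by
    ext S
    simp only [Pi.smul_apply, RingHom.id_apply]
    split_ifs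
    · rw [smul_comm]
    · simp

def iot (v : V) : Module.End R (Finset V → M) where
  toFun f S := if v ∈ S then 0 else sgv v S • f (insert v S)
  map_add' f g := by
    ext S
    simp only [Pi.add_apply]
    split_ifs
    · simp
    · rw [smul_add]
  map_smul' c f := by
    ext S
    simp only [Pi.smul_apply, RingHom.id_apply]
    split_ifs
    · simp
    · rw [smul_comm]

variable {R M}

theorem eps_apply (v : V) (f : Finset V → M) (S : Finset V) :
    eps R M v f S = if v ∈ S then sgv v (S.erase v) • f (S.erase v) else 0 := rfl

theorem iot_apply (v : V) (f : Finset V → M) (S : Finset V) :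
    iot R M v f S = if v ∈ S then 0 else sgv v S • f (insert v S) := rfl

theorem eps_insert {v : V} {S : Finset V} (h : v ∉ S) (f : Finset V → M) :
    eps R M v f (insert v S) = sgv v S • f S := by
  rw [eps_apply, if_pos (Finset.mem_insert_self _ _), Finset.erase_insert h]

theorem eps_notMem {v : V} {S : Finset V} (h : v ∉ S) (f : Finset V → M) :
    eps R M v f S = 0 := by
  rw [eps_apply, if_neg h]

theorem iot_mem {v : V} {S : Finset V} (h : v ∈ S) (f : Finset V → M) :
    iot R M v f S = 0 := by
  rw [iot_apply, if_pos h]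

theorem iot_notMem {v : V} {S : Finset V} (h : v ∉ S) (f : Finset V → M) :
    iot R M v f S = sgv v S • f (insert v S) := by
  rw [iot_apply, if_neg h]

theorem eps_eps (v w : V) (h : v ≠ w) :
    eps R M v * eps R M w = - (eps R M w * eps R M v) := by
  ext f S
  simp only [Module.End.mul_apply, LinearMap.neg_apply, Pi.neg_apply]
  by_cases hv : v ∈ S
  · by_cases hw : w ∈ S
    · obtain ⟨T, hT, rfl⟩ : ∃ T, (v ∉ T ∧ w ∉ T) ∧ S = insert v (insert w T) :=
        ⟨(S.erase v).erase w, by simp, by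
          rw [Finset.insert_erase (by simp [hw, h.symm]), Finset.insert_erase hv]⟩
      rw [eps_insert (by simp [h, hT.1]), eps_insert hT.2, Finset.insert_comm,
        eps_insert (by simp [h.symm, hT.2]), eps_insert hT.1, sgv_insert _ _ _ hT.2,
        sgv_insert _ _ _ hT.1, sg1_swap h, smul_smul, smul_smul, ← neg_smul]
      congr 1; ring
    · rw [eps_notMem hw, eps_apply, if_pos hv, eps_notMem (by simp [hw]), smul_zero, neg_zero]
  · rw [eps_notMem hv]
    by_cases hw : w ∈ S
    · rw [eps_apply w, if_pos hw, eps_notMem (by simp [hv]), smul_zero, neg_zero]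
    · rw [eps_notMem hw, neg_zero]

theorem eps_sq (v : V) : eps R M v * eps R M v = 0 := by
  ext f S
  simp only [Module.End.mul_apply, LinearMap.zero_apply, Pi.zero_apply]
  rw [eps_apply]
  split_ifs with h
  · rw [eps_notMem (by simp), smul_zero]
  · rfl

theorem iot_eps (v w : V) (h : v ≠ w) :
    iot R M v * eps R M w = - (eps R M w * iot R M v) := by
  ext f S
  simp only [Module.End.mul_apply, LinearMap.neg_apply, Pi.neg_apply]
  by_cases hv : v ∈ S
  · rw [iot_mem hv, eps_apply]
    split_ifs with hw
    · rw [iot_mem (by simp [hv, h]), smul_zero, neg_zero]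
    · rw [neg_zero]
  · rw [iot_notMem hv]
    by_cases hw : w ∈ S
    · obtain ⟨T, hT, rfl⟩ : ∃ T, w ∉ T ∧ S = insert w T :=
        ⟨S.erase w, by simp, by rw [Finset.insert_erase hw]⟩
      have hv' : v ∉ T := fun hh => hv (Finset.mem_insert_of_mem hh)
      rw [Finset.insert_comm, eps_insert (by simp [h.symm, hT]), eps_insert hT,
        iot_notMem hv', sgv_insert _ _ _ hT, sgv_insert _ _ _ hv', sg1_swap h, smul_smul,
        smul_smul, ← neg_smul]
      congr 1
      have := sg1_sq w v
      linear_combination (- sgv v T * sgv w T) * this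
    · rw [eps_notMem hw, eps_notMem (by simp [hw, h.symm]), smul_zero, neg_zero]

theorem iot_eps_self (v : V) : iot R M v * eps R M v + eps R M v * iot R M v = 1 := by
  ext f S
  simp only [Module.End.mul_apply, LinearMap.add_apply, Pi.add_apply, Module.End.one_apply]
  by_cases hv : v ∈ S
  · rw [iot_mem hv, zero_add, eps_apply, if_pos hv, iot_notMem (by simp), Finset.insert_erase hv,
      smul_smul, sgv_sq, one_smul]
  · rw [eps_notMem hv, add_zero, iot_notMem hv, eps_insert hv, smul_smul, sgv_sq, one_smul]

variable [Fintype V] 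

/-- the (Koszul) differential -/
def kd (M : Type*) [AddCommGroup M] [Module R M] (x : V → R) : Module.End R (Finset V → M) :=
  ∑ v, x v • eps R M v

theorem kd_apply (x : V → R) (f : Finset V → M) (S : Finset V) :
    kd M x f S = ∑ v, x v • eps R M v f S := by
  simp [kd, LinearMap.sum_apply, Finset.sum_apply]

theorem kd_eps (x : V → R) (v : V) : kd M x * eps R M v = - (eps R M v * kd M x) := by
  unfold kd
  rw [Finset.sum_mul, Finset.mul_sum, ← Finset.sum_neg_distrib]
  refine Finset.sum_congr rfl fun w _ => ?_
  rw [smul_mul_assoc, mul_smul_comm]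
  by_cases h : w = v
  · subst h; rw [eps_sq, smul_zero, neg_zero]
  · exact (congrArg (fun z => x w • z) (eps_eps w v h)).trans (smul_neg _ _)

theorem kd_sq_aux (x : V → R) (T : Finset V) :
    (∑ v ∈ T, x v • eps R M v) * (∑ v ∈ T, x v • eps R M v) = 0 := by
  induction T using Finset.induction_on with
  | empty => simp
  | insert a T ha ih =>
    rw [Finset.sum_insert ha]
    have h1 : (∑ v ∈ T, x v • eps R M v) * (x a • eps R M a) =
        - ((x a • eps R M a) * (∑ v ∈ T, x v • eps R M v)) := by
      rw [Finset.sum_mul, Finset.mul_sum, ← Finset.sum_neg_distrib]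
      refine Finset.sum_congr rfl fun w hw => ?_
      have : w ≠ a := fun h => ha (h ▸ hw)
      rw [smul_mul_smul_comm, smul_mul_smul_comm, mul_comm (x w)]
      exact (congrArg (fun z => (x a * x w) • z) (eps_eps w a this)).trans (smul_neg _ _)
    rw [mul_add, add_mul, add_mul, ih, h1, smul_mul_smul_comm, eps_sq]
    simp

theorem kd_sq (x : V → R) : kd M x * kd M x = 0 := kd_sq_aux x Finset.univ

theorem kd_iot (x : V → R) (v : V) :
    kd M x * iot R M v = x v • (1 : Module.End R (Finset V → M)) - iot R M v * kd M x := by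
  rw [eq_sub_iff_add_eq]
  unfold kd
  rw [Finset.sum_mul, Finset.mul_sum, ← Finset.sum_add_distrib, Finset.sum_eq_single v]
  · rw [smul_mul_assoc, mul_smul_comm, ← smul_add, add_comm, iot_eps_self]
  · intro w _ hw
    rw [smul_mul_assoc, mul_smul_comm, ← smul_add, iot_eps v w hw.symm]
    simp
  · simp

theorem kd_kd (x : V → R) (f : Finset V → M) : kd M x (kd M x f) = 0 := by
  rw [← Module.End.mul_apply, kd_sq]; rfl

theorem kd_eps' (x : V → R) (v : V) (f : Finset V → M) (S : Finset V) :
    kd M x (eps R M v f) S = - eps R M v (kd M x f) S := by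
  rw [← Module.End.mul_apply, kd_eps]; rfl

theorem kd_iot' (x : V → R) (v : V) (f : Finset V → M) (S : Finset V) :
    kd M x (iot R M v f) S = x v • f S - iot R M v (kd M x f) S := by
  rw [← Module.End.mul_apply, kd_iot]; rfl

theorem kd_congr (x : V → R) {f g : Finset V → M} {S : Finset V}
    (h : ∀ v ∈ S, f (S.erase v) = g (S.erase v)) : kd M x f S = kd M x g S := by
  rw [kd_apply, kd_apply]
  refine Finset.sum_congr rfl fun v _ => ?_
  rw [eps_apply, eps_apply]
  split_ifs with hv
  · rw [h v hv]
  · rfl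

theorem kd_empty (x : V → R) (f : Finset V → M) : kd M x f ∅ = 0 := by
  rw [kd_apply]; exact Finset.sum_eq_zero fun v _ => by rw [eps_notMem (by simp), smul_zero]

theorem kd_map {M' : Type*} [AddCommGroup M'] [Module R M'] (φ : M →ₗ[R] M') (x : V → R)
    (f : Finset V → M) (S : Finset V) : kd M' x (fun T => φ (f T)) S = φ (kd M x f S) := by
  rw [kd_apply, kd_apply, map_sum]
  refine Finset.sum_congr rfl fun v _ => ?_
  rw [eps_apply, eps_apply, map_smul]
  split_ifs with hv
  · rw [map_zsmul]
  · simp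

end Clifford

section Koszul

open RingTheory.Sequence
open scoped Pointwise

variable {V : Type*} [LinearOrder V] [Fintype V] {R : Type*} [CommRing R]

/-- elements of the ideal `(x)` act trivially on Koszul cohomology -/
theorem koszul_homotopy (x : V → R) {M : Type*} [AddCommGroup M] [Module R M] (k : ℕ)
    (f : Finset V → M) (hf : ∀ S, S.card = k + 1 → kd M x f S = 0) (r : R)
    (hr : r ∈ Ideal.span (Set.range x)) : ∃ w, ∀ S, S.card = k → r • f S = kd M x w S := by
  induction hr using Submodule.span_induction with
  | mem r hr =>
    obtain ⟨v, rfl⟩ := hr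
    refine ⟨iot R M v f, fun S hS => ?_⟩
    rw [kd_iot', iot_apply]
    split_ifs with hv
    · rw [sub_zero]
    · rw [hf _ (by rw [Finset.card_insert_of_notMem hv, hS]), smul_zero, sub_zero]
  | zero => exact ⟨0, fun S _ => by rw [zero_smul, map_zero]; rfl⟩
  | add a b _ _ ha hb =>
    obtain ⟨w1, h1⟩ := ha
    obtain ⟨w2, h2⟩ := hb
    exact ⟨w1 + w2, fun S hS => by rw [add_smul, h1 S hS, h2 S hS, map_add]; rfl⟩
  | smul c a _ ha =>
    obtain ⟨w1, h1⟩ := ha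
    exact ⟨c • w1, fun S hS => by rw [smul_assoc, h1 S hS, map_smul]; rfl⟩

theorem koszul_vanish (x : V → R) (k : ℕ) : ∀ (rs : List R) (M : Type*) [AddCommGroup M]
    [Module R M], IsWeaklyRegular M rs → (∀ r ∈ rs, r ∈ Ideal.span (Set.range x)) →
    k < rs.length → ∀ f : Finset V → M, (∀ S, S.card = k + 1 → kd M x f S = 0) →
    ∃ g, ∀ S, S.card = k → f S = kd M x g S := by
  induction k with
  | zero =>
    intro rs M _ _ hreg hmem hlen f hf
    rcases rs with _ | ⟨r, rs⟩
    · simp at hlen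
    rw [isWeaklyRegular_cons_iff] at hreg
    obtain ⟨w, hw⟩ := koszul_homotopy x 0 f hf r (hmem r (by simp))
    refine ⟨0, fun S hS => ?_⟩
    obtain rfl := Finset.card_eq_zero.1 hS
    have := hw ∅ rfl
    rw [kd_empty] at this ⊢
    exact hreg.1 (by simpa using this)
  | succ k ih =>
    intro rs M _ _ hreg hmem hlen f hf
    rcases rs with _ | ⟨r, rs⟩
    · simp at hlen
    rw [isWeaklyRegular_cons_iff] at hreg
    obtain ⟨w, hw⟩ := koszul_homotopy x (k + 1) f hf r (hmem r (by simp))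
    let π : M →ₗ[R] QuotSMulTop r M := Submodule.mkQ _
    have hπ : ∀ m, π (r • m) = 0 := by
      intro m
      refine (Submodule.Quotient.mk_eq_zero _).2 ?_
      exact Submodule.smul_mem_pointwise_smul m r ⊤ trivial
    obtain ⟨g, hg⟩ := ih rs (QuotSMulTop r M) hreg.2 (fun s hs => hmem s (by simp [hs]))
      (by simpa using hlen) (fun T => π (w T)) (by
        intro S hS
        rw [kd_map, ← hw S hS, hπ])
    choose g' hg' using fun T => Submodule.mkQ_surjective (r • (⊤ : Submodule R M)) (g T)
    have hex : ∀ T : Finset V, ∃ m : M, T.card = k → w T - kd M x g' T = r • m := by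
      intro T
      by_cases hT : T.card = k
      · have h1 := hg T hT
        have h2 : kd (QuotSMulTop r M) x g T = π (kd M x g' T) := by
          have hgg : g = fun T => π (g' T) := funext fun T => (hg' T).symm
          rw [hgg, kd_map]
        rw [h2, ← sub_eq_zero, ← map_sub] at h1
        have h3 : w T - kd M x g' T ∈ r • (⊤ : Submodule R M) :=
          (Submodule.Quotient.mk_eq_zero _).1 h1
        obtain ⟨m, -, hm⟩ := (Submodule.mem_smul_pointwise_iff_exists _ _ _).1 h3
        exact ⟨m, fun _ => hm.symm⟩
      · exact ⟨0, fun h => absurd h hT⟩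
    choose w' hw' using hex
    refine ⟨w', fun S hS => ?_⟩
    have e1 : kd M x w S = kd M x (kd M x g' + r • w') S := by
      apply kd_congr
      intro v hv
      have := hw' (S.erase v) (by rw [Finset.card_erase_of_mem hv, hS]; rfl)
      rw [sub_eq_iff_eq_add] at this
      rw [this, add_comm]; rfl
    rw [map_add, kd_kd, zero_add, map_smul, ← hw S hS] at e1
    exact hreg.1 e1

end Koszul

section Simplicial

variable {V : Type*} [LinearOrder V] [Fintype V] (K : Type*) [Field K]

/-- faces -/
def VFc (G : SimpleGraph V) (W : Finset V) (k : ℕ) (S : Finset V) : Prop :=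
  S ⊆ W ∧ VInd G S ∧ S.card = k

/-- simplicial coboundary -/
def sd : Module.End K (Finset V → K) := kd K (fun _ : V => (1 : K))

/-- vanishing of the reduced cohomology of the independence complex in (shifted) degree `k` -/
def VZ (G : SimpleGraph V) (W : Finset V) (k : ℕ) : Prop :=
  ∀ f : Finset V → K, (∀ S, VFc G W (k + 1) S → sd K f S = 0) →
    ∃ g, ∀ S, VFc G W k S → f S = sd K g S

variable {K}

theorem sd_eps (v : V) (f : Finset V → K) (S : Finset V) :
    sd K (eps K K v f) S = - eps K K v (sd K f) S := kd_eps' _ v f S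

theorem sd_iot (v : V) (f : Finset V → K) (S : Finset V) :
    sd K (iot K K v f) S = f S - iot K K v (sd K f) S := by
  have := kd_iot' (fun _ : V => (1 : K)) v f S
  rwa [one_smul] at this

theorem sd_sd (f : Finset V → K) (S : Finset V) : sd K (sd K f) S = 0 :=
  congrFun (kd_kd (fun _ : V => (1 : K)) f) S

theorem VFc.erase {G : SimpleGraph V} {W : Finset V} {k : ℕ} {S : Finset V} (h : VFc G W (k + 1) S)
    {v : V} (hv : v ∈ S) : VFc G W k (S.erase v) :=
  ⟨(Finset.erase_subset _ _).trans h.1, h.2.1.mono (Finset.erase_subset _ _), by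
    rw [Finset.card_erase_of_mem hv, h.2.2]; rfl⟩

theorem VFc.sub {G : SimpleGraph V} {W W' : Finset V} {k : ℕ} {S : Finset V} (h : VFc G W k S)
    (hW : W ⊆ W') : VFc G W' k S := ⟨h.1.trans hW, h.2⟩

theorem sd_congr {G : SimpleGraph V} {W : Finset V} {k : ℕ} {S : Finset V} (h : VFc G W (k + 1) S)
    {f g : Finset V → K} (hfg : ∀ T, VFc G W k T → f T = g T) : sd K f S = sd K g S :=
  kd_congr _ fun _ hv => hfg _ (h.erase hv)

theorem VZ.cone {G : SimpleGraph V} {W : Finset V} {v : V} (hv : v ∈ W)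
    (hi : ∀ x ∈ W, ¬ G.Adj v x) (k : ℕ) : VZ K G W k := by
  intro f hf
  refine ⟨iot K K v f, fun S hS => ?_⟩
  rw [sd_iot, iot_apply]
  split_ifs with h
  · rw [sub_zero]
  · rw [hf, smul_zero, sub_zero]
    exact ⟨Finset.insert_subset hv hS.1, hS.2.1.insert fun x hx => hi x (hS.1 hx), by
      rw [Finset.card_insert_of_notMem h, hS.2.2]⟩

section

variable {G : SimpleGraph V} {W W1 W2 : Finset V} {v : V}

theorem fc_del (h1 : ∀ x, x ∈ W1 ↔ x ∈ W ∧ x ≠ v) {k : ℕ} {S : Finset V} (hS : VFc G W k S)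
    (h : v ∉ S) : VFc G W1 k S :=
  ⟨fun x hx => (h1 x).2 ⟨hS.1 hx, fun hh => h (hh ▸ hx)⟩, hS.2⟩

theorem fc_lk (h2 : ∀ x, x ∈ W2 ↔ x ∈ W ∧ x ≠ v ∧ ¬ G.Adj v x) {k : ℕ} {S : Finset V}
    (hS : VFc G W (k + 1) S) (h : v ∈ S) : VFc G W2 k (S.erase v) := by
  refine ⟨fun x hx => ?_, (hS.erase h).2⟩
  rw [Finset.mem_erase] at hx
  exact (h2 x).2 ⟨hS.1 hx.2, hx.1, hS.2.1 v h x hx.2⟩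

theorem fc_ins (hv : v ∈ W) (h2 : ∀ x, x ∈ W2 ↔ x ∈ W ∧ x ≠ v ∧ ¬ G.Adj v x) {k : ℕ}
    {S : Finset V} (hS : VFc G W2 k S) : VFc G W (k + 1) (insert v S) ∧ v ∉ S := by
  have hn : v ∉ S := fun hh => ((h2 v).1 (hS.1 hh)).2.1 rfl
  refine ⟨⟨Finset.insert_subset hv fun x hx => ((h2 x).1 (hS.1 hx)).1, 
    hS.2.1.insert fun x hx => ((h2 x).1 (hS.1 hx)).2.2, ?_⟩, hn⟩
  rw [Finset.card_insert_of_notMem hn, hS.2.2]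

theorem lk_del (h1 : ∀ x, x ∈ W1 ↔ x ∈ W ∧ x ≠ v)
    (h2 : ∀ x, x ∈ W2 ↔ x ∈ W ∧ x ≠ v ∧ ¬ G.Adj v x) : W2 ⊆ W1 :=
  fun x hx => (h1 x).2 ⟨((h2 x).1 hx).1, ((h2 x).1 hx).2.1⟩

theorem VZ.zero (h1 : ∀ x, x ∈ W1 ↔ x ∈ W ∧ x ≠ v) (z : VZ K G W1 0) : VZ K G W 0 := by
  intro f hf
  have hs : W1 ⊆ W := fun x hx => ((h1 x).1 hx).1
  obtain ⟨g, hg⟩ := z f fun S hS => hf S (hS.sub hs)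
  refine ⟨g, fun S hS => ?_⟩
  have : S = ∅ := Finset.card_eq_zero.1 hS.2.2
  subst this
  exact hg _ ⟨by simp, hS.2⟩

theorem VZ.glue (hv : v ∈ W) (h1 : ∀ x, x ∈ W1 ↔ x ∈ W ∧ x ≠ v)
    (h2 : ∀ x, x ∈ W2 ↔ x ∈ W ∧ x ≠ v ∧ ¬ G.Adj v x) {k : ℕ} (z1 : VZ K G W1 (k + 1))
    (z2 : VZ K G W2 k) : VZ K G W (k + 1) := by
  intro f hf
  have hs : W1 ⊆ W := fun x hx => ((h1 x).1 hx).1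
  obtain ⟨g, hg⟩ := z1 f fun S hS => hf S (hS.sub hs)
  obtain ⟨g', hg'⟩ := z2 (iot K K v (f - sd K g)) (by
    intro S hS
    obtain ⟨hi, hn⟩ := fc_ins hv h2 hS
    rw [sd_iot, iot_notMem hn, map_sub]
    simp only [Pi.sub_apply]
    rw [sd_sd, hf _ hi, hg S (hS.sub (lk_del h1 h2))]
    simp)
  refine ⟨g - eps K K v g', fun S hS => ?_⟩
  rw [map_sub]
  simp only [Pi.sub_apply]
  rw [sd_eps, eps_apply]
  split_ifs with h
  · rw [← hg' _ (fc_lk h2 hS h), iot_notMem (by simp), Finset.insert_erase h, smul_smul, sgv_sq,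
      one_smul]
    simp
  · rw [hg S (fc_del h1 hS h)]; simp

theorem VZ.toLink (hv : v ∈ W) (h1 : ∀ x, x ∈ W1 ↔ x ∈ W ∧ x ≠ v)
    (h2 : ∀ x, x ∈ W2 ↔ x ∈ W ∧ x ≠ v ∧ ¬ G.Adj v x) {k : ℕ} (z : VZ K G W (k + 1))
    (z1 : VZ K G W1 k) : VZ K G W2 k := by
  intro f hf
  have hs : W1 ⊆ W := fun x hx => ((h1 x).1 hx).1
  obtain ⟨g, hg⟩ := z (eps K K v f) (by
    intro S hS
    rw [sd_eps, eps_apply]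
    split_ifs with h
    · rw [hf _ (fc_lk h2 hS h), smul_zero, neg_zero]
    · rw [neg_zero])
  obtain ⟨g2, hg2⟩ := z1 g (by
    intro S hS
    rw [← hg S (hS.sub hs), eps_notMem]
    exact fun h => ((h1 v).1 (hS.1 h)).2 rfl)
  refine ⟨- iot K K v (g - sd K g2), fun S hS => ?_⟩
  obtain ⟨hi, hn⟩ := fc_ins hv h2 hS
  rw [map_neg, Pi.neg_apply, sd_iot, iot_notMem hn, map_sub]
  simp only [Pi.sub_apply]
  rw [sd_sd, ← hg _ hi, ← hg2 S (hS.sub (lk_del h1 h2)), eps_insert hn, sub_zero, smul_smul, sgv_sq,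
    one_smul]
  simp

theorem VZ.toDel (hv : v ∈ W) (h1 : ∀ x, x ∈ W1 ↔ x ∈ W ∧ x ≠ v)
    (h2 : ∀ x, x ∈ W2 ↔ x ∈ W ∧ x ≠ v ∧ ¬ G.Adj v x) {k : ℕ} (z : VZ K G W k)
    (z2 : VZ K G W2 k) : VZ K G W1 k := by
  intro f hf
  have hs : W1 ⊆ W := fun x hx => ((h1 x).1 hx).1
  obtain ⟨g, hg⟩ := z2 f fun S hS => hf S (hS.sub (lk_del h1 h2))
  obtain ⟨g3, hg3⟩ := z (iot K K v (eps K K v f) + eps K K v g) (by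
    intro S hS
    rw [map_add, Pi.add_apply, sd_iot, sd_eps]
    by_cases h : v ∈ S
    · rw [iot_mem h, eps_apply, if_pos h, eps_apply, if_pos h, hg _ (fc_lk h2 hS h)]
      simp
    · rw [eps_notMem h, eps_notMem h, iot_notMem h, sd_eps, eps_insert h,
        hf S (fc_del h1 hS h)]
      simp)
  refine ⟨g3, fun S hS => ?_⟩
  have hn : v ∉ S := fun h => ((h1 v).1 (hS.1 h)).2 rfl
  rw [← hg3 S (hS.sub hs), Pi.add_apply, iot_notMem hn, eps_insert hn, eps_notMem hn, smul_smul,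
    sgv_sq, one_smul, add_zero]

end

theorem Low.vz {G : SimpleGraph V} {W : Finset V} {d : ℕ} (h : Low G W d) :
    ∀ k < d, VZ K G W k := by
  induction h with
  | empty => intro k hk; omega
  | iso hv h' hi h ih => intro k _; exact VZ.cone hv hi k
  | split hv h1 h2 l1 l2 hde ih1 ih2 =>
    intro k hk
    rcases k with _ | k
    · exact VZ.zero h1 (ih1 0 hk)
    · exact VZ.glue hv h1 h2 (ih1 _ hk) (ih2 k (by omega))

theorem Acy.vz {G : SimpleGraph V} {W : Finset V} (h : Acy G W) : ∀ k, VZ K G W k := by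
  induction h with
  | cone hv hi => intro k; exact VZ.cone hv hi k
  | split hv h1 h2 l1 l2 ih1 ih2 =>
    intro k
    rcases k with _ | k
    · exact VZ.zero h1 (ih1 0)
    · exact VZ.glue hv h1 h2 (ih1 _) (ih2 k)

theorem Nz.not_vz {G : SimpleGraph V} {W : Finset V} {d : ℕ} (h : Nz G W d) : ¬ VZ K G W d := by
  induction h with
  | empty =>
    intro z
    obtain ⟨g, hg⟩ := z (fun _ => 1) (by
      intro S hS
      have h1 := hS.2.2
      rw [Finset.subset_empty.1 hS.1] at h1
      simp at h1)
    have h1 := hg ∅ ⟨by simp, by simp [VInd], by simp⟩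
    rw [show sd K g ∅ = 0 from kd_empty _ _] at h1
    exact one_ne_zero h1
  | link hv h1 h2 l1 l2 ih => exact fun z => ih (VZ.toLink hv h1 h2 z (l1.vz _ (by omega)))
  | linkA hv h1 h2 l1 l2 ih => exact fun z => ih (VZ.toLink hv h1 h2 z (l1.vz _))
  | del hv h1 h2 l1 l2 ih => exact fun z => ih (VZ.toDel hv h1 h2 z (l2.vz _))

end Simplicial

section Bridge

variable {V : Type*} [LinearOrder V] [Fintype V] {K : Type*} [Field K]

/-- exponent vector of a squarefree monomial -/
noncomputable def sqf (S : Finset V) : V →₀ ℕ := ∑ v ∈ S, Finsupp.single v 1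

theorem sqf_apply (S : Finset V) (w : V) : sqf S w = if w ∈ S then 1 else 0 := by
  simp [sqf, Finsupp.finsetSum_apply, Finsupp.single_apply]

theorem sqf_support (S : Finset V) : (sqf S).support = S := by
  ext w; simp [Finsupp.mem_support_iff, sqf_apply]

theorem sqf_erase {S : Finset V} {v : V} (h : v ∈ S) :
    Finsupp.single v 1 + sqf (S.erase v) = sqf S := by
  unfold sqf; rw [Finset.add_sum_erase S (fun v => Finsupp.single v 1) h]

theorem depth_le {G : SimpleGraph V} {d : ℕ} (h : Nz G Finset.univ d) :
    depthQuot (edgeIdeal K G) ≤ d := by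
  have hz := h.not_vz (K := K)
  unfold VZ at hz
  push Not at hz
  obtain ⟨z, hz1, hz2⟩ := hz
  unfold depthQuot
  apply csSup_le'
  rintro n ⟨rs, rfl, hmem, hreg⟩
  by_contra hlt
  push Not at hlt
  let R := MvPolynomial V K
  let π : R →ₗ[R] (R ⧸ edgeIdeal K G) := Submodule.mkQ (edgeIdeal K G)
  let x : V → R := X
  have hπ0 : ∀ p, π p = 0 ↔ p ∈ edgeIdeal K G := fun p => Submodule.Quotient.mk_eq_zero _
  have hkd : ∀ S, kd R x (fun T => monomial (sqf T) (z T)) S = monomial (sqf S) (sd K z S) := by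
    intro S
    rw [sd, kd_apply, kd_apply, map_sum]
    refine Finset.sum_congr rfl fun v _ => ?_
    rw [eps_apply, eps_apply, one_smul]
    split_ifs with hv
    · rw [map_zsmul, smul_comm]
      congr 1
      rw [← sqf_erase hv, smul_eq_mul]
      change (monomial (Finsupp.single v 1) (1 : K)) * monomial (sqf (S.erase v)) (z (S.erase v)) = _
      rw [monomial_mul, one_mul]
    · simp
  obtain ⟨g, hg⟩ := koszul_vanish x d rs (R ⧸ edgeIdeal K G) hreg.toIsWeaklyRegular hmem hlt
    (fun T => π (monomial (sqf T) (z T))) (by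
      intro S hS
      rw [kd_map, hkd, hπ0]
      by_cases hI : VInd G S
      · rw [hz1 S ⟨Finset.subset_univ _, hI, hS⟩, map_zero]
        exact Submodule.zero_mem _
      · exact mono_mem_edgeIdeal (by rwa [sqf_support]) _)
  choose g' hg' using fun T => Submodule.mkQ_surjective (edgeIdeal K G) (g T)
  obtain ⟨S, hS, hne⟩ := hz2 (fun T => coeff (sqf T) (g' T))
  apply hne
  have hgg : g = fun T => π (g' T) := funext fun T => (hg' T).symm
  have h1 := hg S hS.2.2
  rw [hgg, kd_map, ← sub_eq_zero, ← map_sub, hπ0] at h1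
  have h2 := coeff_edgeIdeal h1 (m := sqf S) (by rw [sqf_support]; exact hS.2.1)
  rw [coeff_sub, coeff_monomial, if_pos rfl, sub_eq_zero] at h2
  rw [h2, sd, kd_apply, kd_apply, coeff_sum]
  refine Finset.sum_congr rfl fun v _ => ?_
  rw [eps_apply, eps_apply, one_smul]
  split_ifs with hv
  · rw [smul_comm, ← lcoeff_apply, map_zsmul, lcoeff_apply]
    congr 1
    rw [← sqf_erase hv, smul_eq_mul]
    exact coeff_X_mul _ _ _
  · simp

end Bridge

theorem stanley_inequality_cubic_circulant (n a : ℕ) (hn : 2 ≤ n) (ha1 : 1 ≤ a) (han : a < n)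
    (K : Type*) [Field K] :
    sdepthQuot (edgeIdeal K (circulantGraph (2 * n) ({a, n} : Set ℕ))) ≥ depthQuot (edgeIdeal K (circulantGraph (2 * n) ({a, n} : Set ℕ))) := by
  obtain ⟨d, hl, hz⟩ := circulant_main n a hn ha1 han
  exact (depth_le hz).trans (sdepth_ge hl)
end
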